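/- arXiv:2411.11298 — 2 statements merged into one kernel-verified Lean document; each statement's English description precedes it below -/
import Mathlib

section
/- There is a constant C > 0 such that for every n ≥ 2 and all strings w and w' of length n that are cyclic rotations of each other, r_B(w') ≤ C · r_B(w) · (log₂ n)⁴. -/
/-! Basic definitions: strings as `List α`, rotations, runs, BWT, Lyndon
factorization, ω-order, bijective BWT, and Fibonacci words. -/

variable {α : Type*}

/-- Left cyclic rotation by one symbol. -/
def rot (x : List α) : List α := x.drop 1 ++ x.take 1

/-- The list of all `|x|` cyclic rotations of `x`. -/
def rotations (x : List α) : List (List α) :=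
  (List.range x.length).map (fun i => rot^[i] x)

/-- ρ: the number of maximal runs of equal consecutive symbols. -/
def runsCount [DecidableEq α] : List α → ℕ
  | [] => 0
  | [_] => 1
  | a :: b :: t => (if a = b then 0 else 1) + runsCount (b :: t)

/-- The Burrows–Wheeler transform: last symbols of the lexicographically
sorted rotations. -/
def BWT [LinearOrder α] (w : List α) : List α :=
  (List.insertionSort (· ≤ ·) (rotations w)).filterMap List.getLast?

/-- The lexicographically smallest rotation of `x`. -/
def lexMinRotation [LinearOrder α] (x : List α) : List α :=
  (List.insertionSort (· ≤ ·) (rotations x)).headD x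

/-- A Lyndon word: nonempty and strictly smaller than all its proper rotations. -/
def IsLyndon [LinearOrder α] (x : List α) : Prop :=
  x ≠ [] ∧ ∀ i < x.length, 0 < i → x < rot^[i] x

instance [LinearOrder α] : DecidablePred (IsLyndon (α := α)) := fun _ =>
  inferInstanceAs (Decidable (_ ∧ _))

/-- The longest prefix of `w` that is a Lyndon word (the first Lyndon factor). -/
def firstLyndonFactor [LinearOrder α] (w : List α) : List α :=
  (((List.range (w.length + 1)).map (fun i => w.take i)).filter
    (fun x => decide (IsLyndon x))).getLastD []

def lyndonFactAux [LinearOrder α] : ℕ → List α → List (List α)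
  | 0, _ => []
  | _, [] => []
  | fuel+1, w =>
      let p := firstLyndonFactor w
      if p.isEmpty then [] else p :: lyndonFactAux fuel (w.drop p.length)

/-- The Lyndon factorization of `w`: repeatedly peel off the longest Lyndon
prefix (equivalently, the unique nonincreasing factorization into Lyndon words). -/
def lyndonFactorization [LinearOrder α] (w : List α) : List (List α) :=
  lyndonFactAux w.length w

/-- `listPow x n = x^n`. -/
def listPow (x : List α) : ℕ → List α
  | 0 => []
  | n+1 => x ++ listPow x n

/-- ω-order: `x ≤ω y` iff `x^∞ ≤ y^∞` lexicographically; comparing the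
equal-length words `x^{|y|}` and `y^{|x|}` is equivalent. -/
def omegaLE [LinearOrder α] (x y : List α) : Prop :=
  listPow x y.length ≤ listPow y x.length

instance [LinearOrder α] : DecidableRel (omegaLE (α := α)) := fun _ _ =>
  inferInstanceAs (Decidable (_ ≤ _))

/-- The bijective Burrows–Wheeler transform: last symbols of all rotations of
all Lyndon factors of `w`, sorted in ω-order. -/
def BBWT [LinearOrder α] (w : List α) : List α :=
  (List.insertionSort omegaLE
    (((lyndonFactorization w).map rotations).flatten)).filterMap List.getLast?

/-- Fibonacci words over symbols `a < b`: `F 0 = b`, `F 1 = a`,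
`F (i+2) = F (i+1) ++ F i`. -/
def fibWordG (a b : α) : ℕ → List α
  | 0 => [b]
  | 1 => [a]
  | n+2 => fibWordG a b (n+1) ++ fibWordG a b n

/-- Fibonacci words over `Fin 2` with `a = 0 < b = 1`. -/
def fibWord : ℕ → List (Fin 2) := fibWordG 0 1

section Jumps

open Classical in
/-- Elements `u` of `X` whose successor in `X` carries a different label. -/
noncomputable def jumpSet {γ β : Type*} [LinearOrder γ] (X : Finset γ) (φ : γ → β) : Finset γ :=
  X.filter (fun u => ∃ v ∈ X, u < v ∧ (∀ z ∈ X, z ≤ u ∨ v ≤ z) ∧ φ u ≠ φ v)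

theorem mem_jumpSet {γ β : Type*} [LinearOrder γ] {X : Finset γ} {φ : γ → β} {u : γ} :
    u ∈ jumpSet X φ ↔ u ∈ X ∧ ∃ v ∈ X, u < v ∧ (∀ z ∈ X, z ≤ u ∨ v ≤ z) ∧ φ u ≠ φ v := by
  simp [jumpSet]

theorem runsCount_map_eq_jumpSet {γ β : Type*} [LinearOrder γ] [DecidableEq β] (φ : γ → β) :
    ∀ (G : List γ), G ≠ [] → G.Pairwise (· ≤ ·) →
      runsCount (G.map φ) = 1 + (jumpSet G.toFinset φ).card
  | [], h, _ => absurd rfl h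
  | [a], _, _ => by
    have : jumpSet [a].toFinset φ = ∅ := by
      ext u
      simp only [mem_jumpSet, List.toFinset_cons, List.toFinset_nil, Finset.notMem_empty, iff_false]
      rintro ⟨hu, v, hv, huv, -⟩
      simp at hu hv
      subst hu hv
      exact lt_irrefl _ huv
    rw [this]; rfl
  | a :: b :: t, _, hs => by
    have ih := runsCount_map_eq_jumpSet φ (b :: t) (by simp) hs.of_cons
    have hle : ∀ z ∈ b :: t, a ≤ z := (List.pairwise_cons.1 hs).1
    have hble : ∀ z ∈ b :: t, b ≤ z := by
      intro z hz
      rcases List.mem_cons.1 hz with h | h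
      · exact h.ge
      · exact (List.pairwise_cons.1 hs.of_cons).1 z h
    have hab : a ≤ b := hle b (by simp)
    have hrun : runsCount ((a :: b :: t).map φ)
        = (if φ a = φ b then 0 else 1) + runsCount ((b :: t).map φ) := rfl
    rw [hrun, ih]
    rcases hab.eq_or_lt with h | h
    · subst h
      simp
    · have hna : a ∉ b :: t := fun hm => absurd (hble a hm) (not_le.2 h)
      have hX : ∀ z, z ∈ (a :: b :: t).toFinset ↔ z = a ∨ z ∈ (b :: t).toFinset := by
        intro z; simp
      by_cases hφ : φ a = φ b
      · have : jumpSet (a :: b :: t).toFinset φ = jumpSet (b :: t).toFinset φ := by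
          ext u
          simp only [mem_jumpSet, hX]
          constructor
          · rintro ⟨rfl | hu, v, hv, huv, hz, hne⟩
            · rcases hv with rfl | hv
              · exact absurd huv (lt_irrefl _)
              · rcases hz b (by simp) with h1 | h1
                · exact absurd h1 (not_le.2 h)
                · have : v = b := le_antisymm h1 (hble v (by simpa using hv))
                  subst this
                  exact absurd hφ hne
            · refine ⟨hu, v, ?_, huv, fun z hzz => hz z (Or.inr hzz), hne⟩
              rcases hv with rfl | hv
              · exact absurd (hle u (by simpa using hu)) (not_le.2 huv)
              · exact hv
          · rintro ⟨hu, v, hv, huv, hz, hne⟩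
            refine ⟨Or.inr hu, v, Or.inr hv, huv, ?_, hne⟩
            rintro z (rfl | hzz)
            · exact Or.inl (hle u (by simpa using hu))
            · exact hz z hzz
        rw [this]; simp [hφ]
      · have : jumpSet (a :: b :: t).toFinset φ = insert a (jumpSet (b :: t).toFinset φ) := by
          ext u
          simp only [mem_jumpSet, hX, Finset.mem_insert]
          constructor
          · rintro ⟨rfl | hu, v, hv, huv, hz, hne⟩
            · exact Or.inl rfl
            · refine Or.inr ⟨hu, v, ?_, huv, fun z hzz => hz z (Or.inr hzz), hne⟩
              rcases hv with rfl | hv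
              · exact absurd (hle u (by simpa using hu)) (not_le.2 huv)
              · exact hv
          · rintro (rfl | ⟨hu, v, hv, huv, hz, hne⟩)
            · refine ⟨Or.inl rfl, b, Or.inr (by simp), h, ?_, hφ⟩
              rintro z (rfl | hzz)
              · exact Or.inl le_rfl
              · exact Or.inr (hble z (by simpa using hzz))
            · refine ⟨Or.inr hu, v, Or.inr hv, huv, ?_, hne⟩
              rintro z (rfl | hzz)
              · exact Or.inl (hle u (by simpa using hu))
              · exact hz z hzz
        rw [this, Finset.card_insert_of_notMem]
        · rw [if_neg hφ]; omega
        · intro hm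
          exact hna (by simpa using (mem_jumpSet.1 hm).1)

theorem exists_card_image_eq_maximal {γ δ : Type*} [LinearOrder γ] [DecidableEq δ]
    (X : Finset γ) (g : γ → δ) :
    ∃ A : Finset γ, (X.image g).card = A.card ∧
      ∀ u, u ∈ A ↔ u ∈ X ∧ ∀ v ∈ X, g v = g u → v ≤ u := by
  classical
  refine ⟨X.filter (fun u => ∀ v ∈ X, g v = g u → v ≤ u), ?_, fun u => Finset.mem_filter⟩
  symm
  apply Finset.card_bij (fun u _ => g u)
  · intro u hu
    exact Finset.mem_image_of_mem g (Finset.mem_filter.1 hu).1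
  · intro u hu v hv huv
    rw [Finset.mem_filter] at hu hv
    exact le_antisymm (hv.2 u hu.1 huv) (hu.2 v hv.1 huv.symm)
  · intro y hy
    obtain ⟨u, hu, rfl⟩ := Finset.mem_image.1 hy
    obtain ⟨m, hm, hmax⟩ := Finset.exists_max_image (X.filter (fun v => g v = g u)) id
      ⟨u, by simp [hu]⟩
    rw [Finset.mem_filter] at hm
    refine ⟨m, ?_, hm.2⟩
    rw [Finset.mem_filter]
    refine ⟨hm.1, fun v hv hvm => hmax v ?_⟩
    simp [hv, hvm, hm.2]

end Jumps

section Windows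

/-- The first `k` symbols of an infinite word. -/
def window {β : Type*} (k : ℕ) (f : ℕ → β) : Fin k → β := fun i => f i

theorem window_eq_iff {β : Type*} {k : ℕ} {f g : ℕ → β} :
    window k f = window k g ↔ ∀ i < k, f i = g i :=
  ⟨fun h i hi => congrFun h ⟨i, hi⟩, fun h => funext fun i => h i i.2⟩

/-- The infinite word `f` with its first `t` symbols removed. -/
def shiftWord {β : Type*} (t : ℕ) (f : Lex (ℕ → β)) : Lex (ℕ → β) :=
  toLex fun i => f (t + i)

theorem shiftWord_apply {β : Type*} (t i : ℕ) (f : Lex (ℕ → β)) :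
    shiftWord t f i = f (t + i) := rfl

theorem shiftWord_zero {β : Type*} (f : Lex (ℕ → β)) : shiftWord 0 f = f := by
  funext i; simp [shiftWord_apply]

theorem shiftWord_shiftWord {β : Type*} (s t : ℕ) (f : Lex (ℕ → β)) :
    shiftWord s (shiftWord t f) = shiftWord (t + s) f := by
  funext i; simp [shiftWord_apply, Nat.add_assoc]

theorem lexWord_lt_iff {β : Type*} [LinearOrder β] {f g : Lex (ℕ → β)} :
    f < g ↔ ∃ i, (∀ j < i, f j = g j) ∧ f i < g i := Iff.rfl

theorem window_eq_of_between {β : Type*} [LinearOrder β] {f g h : Lex (ℕ → β)} {k : ℕ}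
    (hfg : f ≤ g) (hgh : g ≤ h) (hfh : ∀ i < k, f i = h i) : ∀ i < k, f i = g i := by
  rcases hfg.eq_or_lt with rfl | hfg
  · exact fun _ _ => rfl
  obtain ⟨a, ha, ha'⟩ := lexWord_lt_iff.1 hfg
  by_cases hak : a < k
  · exfalso
    have : h < g := lexWord_lt_iff.2 ⟨a, fun j hj => by rw [← hfh j (hj.trans hak), ha j hj],
      by rw [← hfh a hak]; exact ha'⟩
    exact absurd hgh (not_le.2 this)
  · exact fun i hi => ha i (by omega)

/-- A finite set of infinite words that the one-symbol shift permutes, where `φ` is the symbol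
lost by the shift. -/
structure ShiftSystem {β : Type*} (X : Finset (Lex (ℕ → β))) (φ : Lex (ℕ → β) → β) : Prop where
  shift_mem : ∀ f ∈ X, shiftWord 1 f ∈ X
  label_shift : ∀ f ∈ X, φ (shiftWord 1 f) = f 0

/-- The number of distinct length-`k` prefixes of the words in `X`. -/
def prefixCount {β : Type*} [DecidableEq β] (X : Finset (Lex (ℕ → β))) (k : ℕ) : ℕ :=
  (X.image (fun f => window k (ofLex f))).card

namespace ShiftSystem

variable {β : Type*} {X : Finset (Lex (ℕ → β))} {φ : Lex (ℕ → β) → β}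

theorem shift_mem_add (hX : ShiftSystem X φ) (t : ℕ) : ∀ f ∈ X, shiftWord t f ∈ X := by
  induction t with
  | zero => intro f hf; rwa [shiftWord_zero]
  | succ t ih => intro f hf; rw [← shiftWord_shiftWord]; exact hX.shift_mem _ (ih f hf)

theorem shift_injOn (hX : ShiftSystem X φ) {f g : Lex (ℕ → β)} (hf : f ∈ X) (hg : g ∈ X)
    (h : shiftWord 1 f = shiftWord 1 g) : f = g := by
  funext i
  cases i with
  | zero => rw [← hX.label_shift f hf, ← hX.label_shift g hg, h]
  | succ i =>
    have := congrFun h i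
    simpa [shiftWord_apply, Nat.add_comm] using this

theorem shift_injOn_add (hX : ShiftSystem X φ) (t : ℕ) : ∀ {f g : Lex (ℕ → β)}, f ∈ X → g ∈ X →
    shiftWord t f = shiftWord t g → f = g := by
  induction t with
  | zero => intro f g _ _ h; simpa [shiftWord_zero] using h
  | succ t ih =>
    intro f g hf hg h
    rw [← shiftWord_shiftWord, ← shiftWord_shiftWord] at h
    exact ih hf hg (hX.shift_injOn (hX.shift_mem_add t f hf) (hX.shift_mem_add t g hg) h)

theorem exists_shift (hX : ShiftSystem X φ) (t : ℕ) {u : Lex (ℕ → β)} (hu : u ∈ X) :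
    ∃ f ∈ X, shiftWord t f = u := by
  have := Finset.surj_on_of_inj_on_of_card_le (s := X) (t := X) (fun f _ => shiftWord t f)
    (fun f hf => hX.shift_mem_add t f hf) (fun f g hf hg h => hX.shift_injOn_add t hf hg h) le_rfl u hu
  obtain ⟨f, hf, h⟩ := this
  exact ⟨f, hf, h.symm⟩

theorem label_shift_succ (hX : ShiftSystem X φ) {f : Lex (ℕ → β)} (hf : f ∈ X) (t : ℕ) :
    φ (shiftWord (t + 1) f) = f t := by
  rw [← shiftWord_shiftWord, hX.label_shift _ (hX.shift_mem_add t f hf), shiftWord_apply]; simp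

theorem prefixCount_succ_le [LinearOrder β] (hX : ShiftSystem X φ) (k : ℕ) :
    prefixCount X (k + 1) ≤ prefixCount X k + (jumpSet X φ).card := by
  classical
  have h1 : prefixCount X (k + 1)
      = (X.image (fun u => (φ u, window k (ofLex u)))).card := by
    unfold prefixCount
    apply le_antisymm
    · refine Finset.card_le_card_of_injOn
        (fun x => (x 0, fun i : Fin k => x i.succ)) ?_ ?_
      · intro x hx
        obtain ⟨f, hf, rfl⟩ := Finset.mem_image.1 hx
        refine Finset.mem_coe.2 (Finset.mem_image.2 ⟨shiftWord 1 f, hX.shift_mem f hf, ?_⟩)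
        refine Prod.ext (hX.label_shift f hf) ?_
        funext i
        show f (1 + i) = f (i.succ : Fin (k+1))
        simp [Nat.add_comm]
      · intro x _ y _ hxy
        simp only [Prod.mk.injEq] at hxy
        funext i
        refine Fin.cases hxy.1 (fun j => congrFun hxy.2 j) i
    · refine Finset.card_le_card_of_injOn (fun x => Fin.cons x.1 x.2) ?_ ?_
      · intro x hx
        obtain ⟨u, hu, rfl⟩ := Finset.mem_image.1 hx
        obtain ⟨f, hf, rfl⟩ := hX.exists_shift 1 hu
        refine Finset.mem_coe.2 (Finset.mem_image.2 ⟨f, hf, ?_⟩)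
        funext i
        refine Fin.cases ?_ (fun j => ?_) i
        · exact (hX.label_shift f hf).symm
        · show f ((j.succ : Fin (k+1)) : ℕ) = f (1 + j)
          simp [Nat.add_comm]
      · intro x _ y _ hxy
        have := Fin.cons_injective2 (α := fun _ => β) hxy
        exact Prod.ext this.1 this.2
  rw [h1]
  unfold prefixCount
  obtain ⟨A, hA, hAmem⟩ := exists_card_image_eq_maximal X (fun u => (φ u, window k (ofLex u)))
  obtain ⟨B, hB, hBmem⟩ :=
    exists_card_image_eq_maximal X (fun f : Lex (ℕ → β) => window k (ofLex f))
  rw [hA, hB, Nat.add_comm]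
  refine le_trans (Finset.card_le_card ?_) (Finset.card_union_le _ _)
  intro u hu
  rw [hAmem] at hu
  rw [Finset.mem_union, hBmem]
  by_contra hcon
  push Not at hcon
  obtain ⟨v, hv, hvu, huv⟩ := hcon.2 hu.1
  obtain ⟨s, hs, hmin⟩ := Finset.exists_min_image (X.filter (fun z => u < z)) id
    ⟨v, Finset.mem_filter.2 ⟨hv, huv⟩⟩
  rw [Finset.mem_filter] at hs
  have hsv : s ≤ v := hmin v (Finset.mem_filter.2 ⟨hv, huv⟩)
  have hpre : ∀ i < k, u i = s i :=
    window_eq_of_between hs.2.le hsv (window_eq_iff.1 hvu.symm)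
  refine hcon.1 (mem_jumpSet.2 ⟨hu.1, s, hs.1, hs.2, ?_, ?_⟩)
  · intro z hz
    rcases le_or_gt z u with h | h
    · exact Or.inl h
    · exact Or.inr (hmin z (Finset.mem_filter.2 ⟨hz, h⟩))
  · intro hφ
    have := hu.2 s hs.1 (Prod.ext hφ.symm (window_eq_iff.2 fun i hi => (hpre i hi).symm))
    exact absurd this (not_le.2 hs.2)

theorem prefixCount_le [LinearOrder β] (hX : ShiftSystem X φ) (k : ℕ) :
    prefixCount X k ≤ 1 + k * (jumpSet X φ).card := by
  induction k with
  | zero =>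
    unfold prefixCount
    refine le_trans (Finset.card_le_one.2 ?_) (by omega)
    intro x _ y _
    funext i
    exact i.elim0
  | succ k ih =>
    have := hX.prefixCount_succ_le k
    rw [Nat.succ_mul]; omega

end ShiftSystem

end Windows

section Doubling

theorem two_pow_card_le_of_doubling {N : ℕ → ℕ} {K : ℕ} (h0 : 1 ≤ N 0)
    (hmono : ∀ t < K, N t ≤ N (t + 1)) {T : Finset ℕ} (hT : T ⊆ Finset.range K)
    (hdouble : ∀ t ∈ T, 2 * N t ≤ N (t + 1)) : 2 ^ T.card ≤ N K := by
  induction K generalizing T with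
  | zero =>
    have : T = ∅ := by simpa using hT
    simpa [this] using h0
  | succ K ih =>
    have hsub : T.erase K ⊆ Finset.range K := by
      intro t ht
      have h1 := Finset.mem_range.1 (hT (Finset.mem_of_mem_erase ht))
      have h2 := Finset.ne_of_mem_erase ht
      exact Finset.mem_range.2 (by omega)
    have h := ih (fun t ht => hmono t (by omega)) hsub
      (fun t ht => hdouble t (Finset.mem_of_mem_erase ht))
    by_cases hK : K ∈ T
    · rw [← Finset.card_erase_add_one hK, pow_succ]
      have := hdouble K hK
      omega
    · rw [Finset.erase_eq_of_notMem hK] at h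
      exact h.trans (hmono K (by omega))

open Classical in
/-- The elements of `X` satisfying `p`. -/
noncomputable def select {γ : Type*} (X : Finset γ) (p : γ → Prop) : Finset γ := X.filter p

theorem mem_select {γ : Type*} {X : Finset γ} {p : γ → Prop} {g : γ} :
    g ∈ select X p ↔ g ∈ X ∧ p g := by
  simp [select]

/-- The number of words of `X` with label `a` that agree with `u` on the first `m` symbols. -/
noncomputable def labelCount {β : Type*} (X : Finset (Lex (ℕ → β)))
    (φ : Lex (ℕ → β) → β) (a : β) (u : Lex (ℕ → β)) (m : ℕ) : ℕ :=
  (select X (fun g => φ g = a ∧ ∀ i < m, g i = u i)).card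

theorem labelCount_congr {β : Type*} (X : Finset (Lex (ℕ → β)))
    (φ : Lex (ℕ → β) → β) (a : β) {u v : Lex (ℕ → β)} {m : ℕ} (h : ∀ i < m, u i = v i) :
    labelCount X φ a u m = labelCount X φ a v m := by
  unfold labelCount
  congr 1
  ext g
  simp only [mem_select]
  refine and_congr_right fun _ => and_congr_right fun _ => forall₂_congr fun i hi => ?_
  rw [h i hi]

namespace ShiftSystem

variable {β : Type*} [LinearOrder β] {X : Finset (Lex (ℕ → β))} {φ : Lex (ℕ → β) → β}

theorem card_small_side_le (hX : ShiftSystem X φ) {K : ℕ}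
    {E : Finset (Lex (ℕ → β) × Lex (ℕ → β))}
    (hmem : ∀ e ∈ E, e.1 ∈ X) (hφ : ∀ e ∈ E, φ e.1 ≠ φ e.2)
    (huniq : ∀ e ∈ E, ∀ e' ∈ E, (∀ i < 2 * K, e.1 i = e'.1 i) → e = e') :
    ((E ×ˢ Finset.range K).filter (fun p =>
      labelCount X φ (φ p.1.1) p.1.1 (K - 1 - p.2)
        ≤ labelCount X φ (φ p.1.2) p.1.1 (K - 1 - p.2))).card
      ≤ Nat.log 2 X.card * prefixCount X (3 * K) := by
  classical
  set P := (E ×ˢ Finset.range K).filter (fun p =>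
      labelCount X φ (φ p.1.1) p.1.1 (K - 1 - p.2)
        ≤ labelCount X φ (φ p.1.2) p.1.1 (K - 1 - p.2)) with hP
  have hex : ∀ p : (Lex (ℕ → β) × Lex (ℕ → β)) × ℕ, ∃ f : Lex (ℕ → β),
      p ∈ P → f ∈ X ∧ shiftWord (p.2 + 1) f = p.1.1 := by
    intro p
    by_cases hp : p ∈ P
    · have h1 := (Finset.mem_product.1 (Finset.mem_filter.1 hp).1).1
      obtain ⟨f, hf, h⟩ := hX.exists_shift (p.2 + 1) (hmem _ h1)
      exact ⟨f, fun _ => ⟨hf, h⟩⟩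
    · exact ⟨p.1.1, fun h => absurd h hp⟩
  choose F hF using hex
  unfold prefixCount
  refine Finset.card_le_mul_card_image_of_maps_to
    (f := fun p => window (3 * K) (ofLex (F p))) ?_ _ ?_
  · intro p hp
    exact Finset.mem_image.2 ⟨F p, (hF p hp).1, rfl⟩
  · intro x _
    set Q := P.filter (fun p => window (3 * K) (ofLex (F p)) = x) with hQ
    rcases Q.eq_empty_or_nonempty with hQe | ⟨p0, hp0⟩
    · rw [hQe]; simp
    have hp0' := Finset.mem_filter.1 hp0
    have hf0 := (hF p0 hp0'.1).1
    set f0 := F p0 with hf0def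
    have hagree : ∀ p ∈ Q, ∀ i < 3 * K, F p i = f0 i := by
      intro p hp
      exact window_eq_iff.1 ((Finset.mem_filter.1 hp).2.trans hp0'.2.symm)
    have hlt : ∀ p ∈ Q, p.2 < K := fun p hp => Finset.mem_range.1
      (Finset.mem_product.1 (Finset.mem_filter.1 (Finset.mem_filter.1 hp).1).1).2
    have hE : ∀ p ∈ Q, p.1 ∈ E := fun p hp =>
      (Finset.mem_product.1 (Finset.mem_filter.1 (Finset.mem_filter.1 hp).1).1).1
    have hfirst : ∀ p ∈ Q, ∀ i < 2 * K, p.1.1 i = f0 (p.2 + 1 + i) := by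
      intro p hp i hi
      rw [← (hF p (Finset.mem_filter.1 hp).1).2, shiftWord_apply]
      exact hagree p hp _ (by have := hlt p hp; omega)
    have hinj : Set.InjOn (fun p : (Lex (ℕ → β) × Lex (ℕ → β)) × ℕ => p.2) Q := by
      intro p hp q hq hpq
      refine Prod.ext (huniq _ (hE p hp) _ (hE q hq) fun i hi => ?_) hpq
      rw [hfirst p hp i hi, hfirst q hq i hi]
      simp only at hpq
      rw [hpq]
    rw [← Finset.card_image_of_injOn hinj]
    have hXne : X.card ≠ 0 := Finset.card_ne_zero_of_mem hf0
    apply Nat.le_log_of_pow_le (by norm_num)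
    let N : ℕ → ℕ := fun t => (select X (fun g => ∀ i < K - t, g i = f0 (t + i))).card
    have hstep1 : ∀ t < K, N t ≤ labelCount X φ (f0 t) (shiftWord (t + 1) f0) (K - 1 - t) := by
      intro t ht
      refine Finset.card_le_card_of_injOn (shiftWord 1) ?_ ?_
      · intro g hg
        rw [Finset.mem_coe, mem_select] at hg
        rw [Finset.mem_coe, mem_select]
        refine ⟨hX.shift_mem g hg.1, ?_, ?_⟩
        · rw [hX.label_shift g hg.1]; simpa using hg.2 0 (by omega)
        · intro i hi
          rw [shiftWord_apply, shiftWord_apply, hg.2 (1 + i) (by omega)]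
          congr 1; omega
      · intro g hg h hh hgh
        rw [Finset.mem_coe, mem_select] at hg hh
        exact hX.shift_injOn hg.1 hh.1 hgh
    have hNK : N K = X.card := by simp [N, select]
    rw [← hNK]
    apply two_pow_card_le_of_doubling
    · refine Finset.card_pos.2 ⟨f0, ?_⟩
      rw [mem_select]
      exact ⟨hf0, fun i _ => by simp⟩
    · intro t ht
      refine (hstep1 t ht).trans (Finset.card_le_card ?_)
      intro g hg
      rw [mem_select] at hg ⊢
      exact ⟨hg.1, fun i hi => hg.2.2 i (by omega)⟩
    · intro t ht
      obtain ⟨p, hp, rfl⟩ := Finset.mem_image.1 ht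
      exact Finset.mem_range.2 (hlt p hp)
    · intro t ht
      obtain ⟨p, hp, rfl⟩ := Finset.mem_image.1 ht
      have hpK := hlt p hp
      have hpP := (Finset.mem_filter.1 hp).1
      have hlab : φ p.1.1 = f0 p.2 := by
        rw [← (hF p hpP).2, hX.label_shift_succ (hF p hpP).1, hagree p hp _ (by omega)]
      have hcmp := (Finset.mem_filter.1 hpP).2
      have hcong : ∀ a, labelCount X φ a p.1.1 (K - 1 - p.2)
          = labelCount X φ a (shiftWord (p.2 + 1) f0) (K - 1 - p.2) := fun a =>
        labelCount_congr X φ a fun i hi => by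
          rw [hfirst p hp i (by omega), shiftWord_apply]
      rw [hcong, hcong, hlab] at hcmp
      have h1 := hstep1 p.2 hpK
      have hsum : labelCount X φ (f0 p.2) (shiftWord (p.2 + 1) f0) (K - 1 - p.2)
          + labelCount X φ (φ p.1.2) (shiftWord (p.2 + 1) f0) (K - 1 - p.2) ≤ N (p.2 + 1) := by
        unfold labelCount
        rw [← Finset.card_union_of_disjoint]
        · apply Finset.card_le_card
          intro g hg
          rw [Finset.mem_union, mem_select, mem_select] at hg
          rw [mem_select]
          rcases hg with hg | hg <;>
            exact ⟨hg.1, fun i hi => hg.2.2 i (by omega)⟩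
        · rw [Finset.disjoint_left]
          intro g hg hg'
          rw [mem_select] at hg hg'
          exact hφ _ (hE p hp) (by rw [hlab, ← hg.2.1, hg'.2.1])
      omega

theorem mul_card_pairs_le (hX : ShiftSystem X φ) {K : ℕ}
    {E : Finset (Lex (ℕ → β) × Lex (ℕ → β))}
    (hmem : ∀ e ∈ E, e.1 ∈ X ∧ e.2 ∈ X) (hφ : ∀ e ∈ E, φ e.1 ≠ φ e.2)
    (hagree : ∀ e ∈ E, ∀ i < K - 1, e.1 i = e.2 i)
    (huniq : ∀ e ∈ E, ∀ e' ∈ E, (∀ i < 2 * K, e.1 i = e'.1 i) → e = e')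
    (huniq' : ∀ e ∈ E, ∀ e' ∈ E, (∀ i < 2 * K, e.2 i = e'.2 i) → e = e') :
    E.card * K ≤ 2 * (Nat.log 2 X.card * prefixCount X (3 * K)) := by
  classical
  have h1 := hX.card_small_side_le (fun e he => (hmem e he).1) hφ huniq
  have h2 := hX.card_small_side_le (E := E.image Prod.swap) (K := K)
    (by
      intro e he
      obtain ⟨e', he', rfl⟩ := Finset.mem_image.1 he
      exact (hmem e' he').2)
    (by
      intro e he
      obtain ⟨e', he', rfl⟩ := Finset.mem_image.1 he
      exact (hφ e' he').symm)
    (by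
      intro e he d hd h
      obtain ⟨e', he', rfl⟩ := Finset.mem_image.1 he
      obtain ⟨d', hd', rfl⟩ := Finset.mem_image.1 hd
      rw [huniq' e' he' d' hd' h])
  have hcard : E.card * K = (E ×ˢ Finset.range K).card := by simp
  rw [hcard, ← Finset.card_filter_add_card_filter_not (fun p =>
      labelCount X φ (φ p.1.1) p.1.1 (K - 1 - p.2)
        ≤ labelCount X φ (φ p.1.2) p.1.1 (K - 1 - p.2))]
  have h3 : ((E ×ˢ Finset.range K).filter (fun p => ¬
      labelCount X φ (φ p.1.1) p.1.1 (K - 1 - p.2)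
        ≤ labelCount X φ (φ p.1.2) p.1.1 (K - 1 - p.2))).card ≤
      (((E.image Prod.swap) ×ˢ Finset.range K).filter (fun p =>
      labelCount X φ (φ p.1.1) p.1.1 (K - 1 - p.2)
        ≤ labelCount X φ (φ p.1.2) p.1.1 (K - 1 - p.2))).card := by
    refine Finset.card_le_card_of_injOn (fun p => (p.1.swap, p.2)) ?_ ?_
    · intro p hp
      rw [Finset.mem_coe, Finset.mem_filter, Finset.mem_product] at hp
      rw [Finset.mem_coe, Finset.mem_filter, Finset.mem_product]
      refine ⟨⟨Finset.mem_image_of_mem _ hp.1.1, hp.1.2⟩, ?_⟩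
      have hc : ∀ a, labelCount X φ a p.1.1 (K - 1 - p.2)
          = labelCount X φ a p.1.2 (K - 1 - p.2) := fun a =>
        labelCount_congr X φ a fun i hi => hagree _ hp.1.1 i (by omega)
      have := hp.2
      rw [hc, hc] at this
      exact (not_le.1 this).le
    · rintro ⟨⟨a, b⟩, c⟩ _ ⟨⟨a', b'⟩, c'⟩ _ h
      simp only [Prod.mk.injEq, Prod.swap_prod_mk] at h ⊢
      tauto
  omega

theorem card_jumpSet_le (hX : ShiftSystem X φ) {B M : ℕ}
    (hsep : ∀ f ∈ X, ∀ g ∈ X, (∀ i < B, f i = g i) → f = g)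
    (hM : ∀ k, 1 ≤ k → prefixCount X k ≤ k * M) :
    (jumpSet X φ).card ≤ (Nat.log 2 B + 1) * (6 * Nat.log 2 X.card * M) := by
  classical
  let E : ℕ → Finset (Lex (ℕ → β) × Lex (ℕ → β)) := fun K =>
    (X ×ˢ X).filter (fun e => (e.1 < e.2 ∧ (∀ z ∈ X, z ≤ e.1 ∨ e.2 ≤ z) ∧ φ e.1 ≠ φ e.2) ∧
      (∀ i < K - 1, e.1 i = e.2 i) ∧ ∃ d < 2 * K - 1, e.1 d ≠ e.2 d)
  have hmemE : ∀ K e, e ∈ E K ↔ (e.1 ∈ X ∧ e.2 ∈ X) ∧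
      (e.1 < e.2 ∧ (∀ z ∈ X, z ≤ e.1 ∨ e.2 ≤ z) ∧ φ e.1 ≠ φ e.2) ∧
      (∀ i < K - 1, e.1 i = e.2 i) ∧ ∃ d < 2 * K - 1, e.1 d ≠ e.2 d := by
    intro K e
    simp only [E, Finset.mem_filter, Finset.mem_product]
  have key : ∀ K, ∀ e ∈ E K, ∀ e' ∈ E K, (∀ i < 2 * K, e.1 i = e'.1 i) → ¬ e.1 < e'.1 := by
    intro K e he e' he' h hlt
    rw [hmemE] at he he'
    obtain ⟨d, hd, hne⟩ := he.2.2.2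
    have h2 : e.2 ≤ e'.1 := (he.2.1.2.1 _ he'.1.1).resolve_left (not_le.2 hlt)
    exact hne (window_eq_of_between he.2.1.1.le h2 h d (by omega))
  have key' : ∀ K, ∀ e ∈ E K, ∀ e' ∈ E K, (∀ i < 2 * K, e.2 i = e'.2 i) → ¬ e.2 < e'.2 := by
    intro K e he e' he' h hlt
    rw [hmemE] at he he'
    obtain ⟨d, hd, hne⟩ := he'.2.2.2
    have h2 : e.2 ≤ e'.1 := (he'.2.1.2.1 _ he.1.2).resolve_right (not_le.2 hlt)
    have h3 := window_eq_of_between h2 he'.2.1.1.le h d (by omega)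
    exact hne (h3.symm.trans (h d (by omega)))
  have hbound : ∀ K, 1 ≤ K → (E K).card ≤ 6 * Nat.log 2 X.card * M := by
    intro K hK
    have h1 := hX.mul_card_pairs_le (K := K) (E := E K) (fun e he => ((hmemE K e).1 he).1)
      (fun e he => ((hmemE K e).1 he).2.1.2.2) (fun e he => ((hmemE K e).1 he).2.2.1)
      (by
        intro e he e' he' h
        have heq : e.1 = e'.1 := le_antisymm
          (not_lt.1 (key K e' he' e he fun i hi => (h i hi).symm)) (not_lt.1 (key K e he e' he' h))
        rw [hmemE] at he he'
        refine Prod.ext heq (le_antisymm ?_ ?_)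
        · exact (he.2.1.2.1 _ he'.1.2).resolve_left (not_le.2 (heq ▸ he'.2.1.1))
        · exact (he'.2.1.2.1 _ he.1.2).resolve_left (not_le.2 (heq ▸ he.2.1.1)))
      (by
        intro e he e' he' h
        have heq : e.2 = e'.2 := le_antisymm
          (not_lt.1 (key' K e' he' e he fun i hi => (h i hi).symm))
          (not_lt.1 (key' K e he e' he' h))
        rw [hmemE] at he he'
        refine Prod.ext (le_antisymm ?_ ?_) heq
        · exact (he'.2.1.2.1 _ he.1.1).resolve_right (not_le.2 (heq ▸ he.2.1.1))
        · exact (he.2.1.2.1 _ he'.1.1).resolve_right (not_le.2 (heq ▸ he'.2.1.1)))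
    have h2 := hM (3 * K) (by omega)
    have h3 : (E K).card * K ≤ (6 * Nat.log 2 X.card * M) * K := by
      calc (E K).card * K ≤ 2 * (Nat.log 2 X.card * prefixCount X (3 * K)) := h1
        _ ≤ 2 * (Nat.log 2 X.card * (3 * K * M)) := by gcongr
        _ = _ := by ring
    exact Nat.le_of_mul_le_mul_right h3 hK
  have hsub : jumpSet X φ ⊆
      (Finset.range (Nat.log 2 B + 1)).biUnion (fun j => (E (2 ^ j)).image Prod.fst) := by
    intro u hu
    obtain ⟨hu, v, hv, huv, hz, hne⟩ := mem_jumpSet.1 hu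
    have hdiff : ∃ d, u d ≠ v d := by
      by_contra hcon
      push Not at hcon
      exact huv.ne (funext hcon)
    have hd := Nat.find_spec hdiff
    have hmin : ∀ i < Nat.find hdiff, u i = v i := fun i hi => not_not.1 (Nat.find_min hdiff hi)
    set d := Nat.find hdiff
    have hdB : d < B := by
      by_contra hcon
      exact huv.ne (hsep u hu v hv fun i hi => hmin i (by omega))
    rw [Finset.mem_biUnion]
    refine ⟨Nat.log 2 (d + 1), ?_, ?_⟩
    · rw [Finset.mem_range]
      have : Nat.log 2 (d + 1) ≤ Nat.log 2 B := Nat.log_mono_right (by omega)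
      omega
    · refine Finset.mem_image.2 ⟨(u, v), ?_, rfl⟩
      rw [hmemE]
      have h1 : 2 ^ Nat.log 2 (d + 1) ≤ d + 1 := Nat.pow_log_le_self 2 (by omega)
      have h2 : d + 1 < 2 ^ (Nat.log 2 (d + 1) + 1) := Nat.lt_pow_succ_log_self (by norm_num) _
      rw [pow_succ] at h2
      exact ⟨⟨hu, hv⟩, ⟨huv, hz, hne⟩, fun i hi => hmin i (by omega), d, by omega, hd⟩
  calc (jumpSet X φ).card ≤ _ := Finset.card_le_card hsub
    _ ≤ ∑ j ∈ Finset.range (Nat.log 2 B + 1), ((E (2 ^ j)).image Prod.fst).card :=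
        Finset.card_biUnion_le
    _ ≤ ∑ j ∈ Finset.range (Nat.log 2 B + 1), 6 * Nat.log 2 X.card * M :=
        Finset.sum_le_sum fun j _ => Finset.card_image_le.trans (hbound _ Nat.one_le_two_pow)
    _ = _ := by simp

end ShiftSystem

end Doubling

section Slices

/-- The length-`p` factor of the infinite word `T` at position `a`. -/
def slice {β : Type*} (T : ℕ → β) (a p : ℕ) : List β := (List.range p).map fun i => T (a + i)

@[simp] theorem length_slice {β : Type*} (T : ℕ → β) (a p : ℕ) : (slice T a p).length = p := by
  simp [slice]

theorem getElem_slice {β : Type*} (T : ℕ → β) (a p i : ℕ) (h : i < (slice T a p).length) :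
    (slice T a p)[i] = T (a + i) := by
  simp [slice]

theorem slice_eq_slice_iff {β : Type*} {T U : ℕ → β} {a b p : ℕ} :
    slice T a p = slice U b p ↔ ∀ i < p, T (a + i) = U (b + i) := by
  constructor
  · intro h i hi
    rw [← getElem_slice T a p i (by simpa), ← getElem_slice U b p i (by simpa)]
    simp only [h]
  · intro h
    refine List.ext_getElem (by simp) fun i h1 h2 => ?_
    rw [getElem_slice, getElem_slice, h i (by simpa using h1)]

theorem take_slice {β : Type*} (T : ℕ → β) {a p q : ℕ} (h : q ≤ p) :
    (slice T a p).take q = slice T a q := by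
  refine List.ext_getElem (by simpa) fun i h1 h2 => ?_
  rw [List.getElem_take, getElem_slice, getElem_slice]

theorem drop_slice {β : Type*} (T : ℕ → β) (a p q : ℕ) :
    (slice T a p).drop q = slice T (a + q) (p - q) := by
  refine List.ext_getElem (by simp) fun i h1 h2 => ?_
  rw [List.getElem_drop, getElem_slice, getElem_slice, Nat.add_assoc]

/-- The suffixes of `T` at `a` and `c` first differ at offset `k`, where the former is smaller. -/
def LtAt {β : Type*} [LT β] (T : ℕ → β) (a c k : ℕ) : Prop :=
  (∀ j < k, T (a + j) = T (c + j)) ∧ T (a + k) < T (c + k)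

theorem LtAt.trans {β : Type*} [Preorder β] {T : ℕ → β} {a b c k l : ℕ} (h1 : LtAt T a b k)
    (h2 : LtAt T b c l) : LtAt T a c (min k l) := by
  refine ⟨fun j hj => (h1.1 j (by omega)).trans (h2.1 j (by omega)), ?_⟩
  rcases lt_trichotomy k l with h | h | h
  · rw [min_eq_left h.le, ← h2.1 k h]; exact h1.2
  · subst h; rw [min_self]; exact h1.2.trans h2.2
  · rw [min_eq_right h.le, h1.1 l h]; exact h2.2

theorem slice_lt_slice_iff {β : Type*} [LinearOrder β] {T : ℕ → β} {a b p q : ℕ} :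
    slice T a p < slice T b q ↔
      (p < q ∧ ∀ i < p, T (a + i) = T (b + i)) ∨ ∃ k, k < p ∧ k < q ∧ LtAt T a b k := by
  rw [List.lt_iff_exists]
  simp only [length_slice, getElem_slice]
  refine or_congr ?_ ?_
  · rw [and_comm]
    refine and_congr_right fun h => ?_
    rw [take_slice T h.le, slice_eq_slice_iff]
  · constructor
    · rintro ⟨k, h1, h2, h3, h4⟩
      exact ⟨k, h1, h2, h3, h4⟩
    · rintro ⟨k, h1, h2, h3, h4⟩
      exact ⟨k, h1, h2, h3, h4⟩

/-- The length-`p` factor of `T` at position `a` is smaller than all its proper suffixes. -/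
def LyndonAt {β : Type*} [LT β] (T : ℕ → β) (a p : ℕ) : Prop :=
  0 < p ∧ ∀ i, 0 < i → i < p → ∃ k, i + k < p ∧ LtAt T a (a + i) k

theorem LyndonAt.congr {β : Type*} [LT β] {T U : ℕ → β} {a b p : ℕ} (h : LyndonAt T a p)
    (hTU : ∀ i < p, T (a + i) = U (b + i)) : LyndonAt U b p := by
  refine ⟨h.1, fun i hi hip => ?_⟩
  obtain ⟨k, hk, hk1, hk2⟩ := h.2 i hi hip
  refine ⟨k, hk, fun j hj => ?_, ?_⟩
  · rw [Nat.add_assoc b, ← hTU j (by omega), ← hTU (i + j) (by omega), ← Nat.add_assoc, hk1 j hj]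
  · rw [Nat.add_assoc b, ← hTU k (by omega), ← hTU (i + k) (by omega), ← Nat.add_assoc]
    exact hk2

theorem LyndonAt.union_of_overlap {β : Type*} [LinearOrder β] {T : ℕ → β} {a b p q : ℕ}
    (ha : LyndonAt T a p) (hb : LyndonAt T b q) (hab : a < b) (hba : b < a + p) :
    a + p < b + q → LyndonAt T a (b + q - a) := by
  intro hpq
  refine ⟨by omega, fun i hi hiq => ?_⟩
  by_cases hip : i < p
  · obtain ⟨k, hk, h⟩ := ha.2 i hi hip
    exact ⟨k, by omega, h⟩
  · obtain ⟨k, hk, h⟩ := ha.2 (b - a) (by omega) (by omega)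
    obtain ⟨l, hl, h'⟩ := hb.2 (a + i - b) (by omega) (by omega)
    rw [show a + (b - a) = b by omega] at h
    rw [show b + (a + i - b) = a + i by omega] at h'
    exact ⟨min k l, by omega, h.trans h'⟩

theorem LyndonAt.append {β : Type*} [LinearOrder β] {T : ℕ → β} {a p q : ℕ}
    (ha : LyndonAt T a p) (hb : LyndonAt T (a + p) q) (h : slice T a p < slice T (a + p) q) :
    LyndonAt T a (p + q) := by
  have hmid : ∃ k, k < q ∧ LtAt T a (a + p) k := by
    rcases slice_lt_slice_iff.1 h with ⟨hpq, heq⟩ | ⟨k, _, hk, h⟩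
    · obtain ⟨k, hk, h1, h2⟩ := hb.2 p ha.1 hpq
      refine ⟨p + k, hk, fun j hj => ?_, ?_⟩
      · by_cases hjp : j < p
        · exact heq j hjp
        · have := h1 (j - p) (by omega)
          rwa [show a + p + (j - p) = a + j by omega,
            show a + p + p + (j - p) = a + p + j by omega] at this
      · rwa [show a + p + p + k = a + p + (p + k) by omega, Nat.add_assoc a] at h2
    · exact ⟨k, hk, h⟩
  refine ⟨by have := ha.1; omega, fun i hi hiq => ?_⟩
  rcases lt_trichotomy i p with hip | hip | hip
  · obtain ⟨k, hk, h⟩ := ha.2 i hi hip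
    exact ⟨k, by omega, h⟩
  · obtain ⟨k, hk, h⟩ := hmid
    subst hip
    exact ⟨k, by omega, h⟩
  · obtain ⟨k, hk, h⟩ := hmid
    obtain ⟨l, hl, h'⟩ := hb.2 (i - p) (by omega) (by omega)
    rw [show a + p + (i - p) = a + i by omega] at h'
    exact ⟨min k l, by omega, h.trans h'⟩

end Slices

section Periodic

variable {β : Type*} [Inhabited β]

/-- The periodic infinite word `x x x ⋯`. -/
def periodicWord (x : List β) : ℕ → β := fun i => x.getD (i % x.length) default

theorem periodicWord_of_lt {x : List β} {i : ℕ} (h : i < x.length) : periodicWord x i = x[i] := by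
  show x.getD (i % x.length) default = _
  rw [Nat.mod_eq_of_lt h, List.getD_eq_getElem _ _ h]

theorem periodicWord_mod (x : List β) (i : ℕ) :
    periodicWord x (i % x.length) = periodicWord x i := by
  show x.getD (i % x.length % x.length) default = x.getD (i % x.length) default
  rw [Nat.mod_mod]

theorem periodicWord_add_length (x : List β) (i : ℕ) :
    periodicWord x (i + x.length) = periodicWord x i := by
  rw [← periodicWord_mod x (i + x.length), Nat.add_mod_right, periodicWord_mod]

theorem periodicWord_add_mul_length (x : List β) (i k : ℕ) :
    periodicWord x (i + x.length * k) = periodicWord x i := by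
  rw [← periodicWord_mod x (i + x.length * k), Nat.add_mul_mod_self_left, periodicWord_mod]

theorem slice_periodicWord (x : List β) : slice (periodicWord x) 0 x.length = x := by
  refine List.ext_getElem (by simp) fun i h1 h2 => ?_
  rw [getElem_slice, Nat.zero_add, periodicWord_of_lt h2]

omit [Inhabited β] in
theorem rot_slice {f : ℕ → β} {p : ℕ} (hf : ∀ i, f (i + p) = f i) (a : ℕ) :
    rot (slice f a p) = slice f (a + 1) p := by
  rcases Nat.eq_zero_or_pos p with rfl | hp
  · simp [rot, slice]
  unfold rot
  rw [drop_slice, take_slice f hp]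
  refine List.ext_getElem (by simp; omega) fun i h1 h2 => ?_
  rw [List.getElem_append, getElem_slice]
  simp only [length_slice] at h2 ⊢
  split
  · rw [getElem_slice]
  · rw [getElem_slice, ← hf]
    congr 1; omega

theorem rot_iterate_eq_slice (x : List β) (i : ℕ) :
    rot^[i] x = slice (periodicWord x) i x.length := by
  induction i with
  | zero => exact (slice_periodicWord x).symm
  | succ i ih => rw [Function.iterate_succ_apply', ih, rot_slice (periodicWord_add_length x)]

theorem length_rot_iterate (x : List β) (i : ℕ) : (rot^[i] x).length = x.length := by
  rw [rot_iterate_eq_slice, length_slice]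

theorem periodicWord_rot_iterate {x : List β} (hx : x ≠ []) (i : ℕ) :
    periodicWord (rot^[i] x) = fun j => periodicWord x (i + j) := by
  have hpos : 0 < x.length := List.length_pos_iff.2 hx
  funext j
  rw [← periodicWord_mod, length_rot_iterate, periodicWord_of_lt
    (by rw [length_rot_iterate]; exact Nat.mod_lt _ hpos)]
  simp only [rot_iterate_eq_slice, getElem_slice]
  rw [← periodicWord_mod, Nat.add_mod_mod, periodicWord_mod]

omit [Inhabited β] in
theorem eq_of_periodic_of_agree {γ : Type*} {f g : ℕ → γ} {p q : ℕ} (hp : 0 < p) (hq : 0 < q)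
    (hf : ∀ i, f (i + p) = f i) (hg : ∀ i, g (i + q) = g i) (h : ∀ i < p + q, f i = g i) :
    f = g := by
  have hfmul : ∀ k i, f (i + k * p) = f i := by
    intro k
    induction k with
    | zero => simp
    | succ k ih => intro i; rw [Nat.succ_mul, ← Nat.add_assoc, hf, ih]
  have hgmul : ∀ k i, g (i + k * q) = g i := by
    intro k
    induction k with
    | zero => simp
    | succ k ih => intro i; rw [Nat.succ_mul, ← Nat.add_assoc, hg, ih]
  have hfq : ∀ i, f (i + q) = f i := by
    intro i
    have h1 : f (i + q) = f (i % p + q) := by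
      conv_lhs => rw [← Nat.mod_add_div i p]
      rw [show i % p + p * (i / p) + q = i % p + q + (i / p) * p by ring, hfmul]
    have h2 : f i = f (i % p) := by
      conv_lhs => rw [← Nat.mod_add_div i p]
      rw [Nat.mul_comm, hfmul]
    have h3 := Nat.mod_lt i hp
    rw [h1, h2, h _ (by omega), hg, ← h _ (by omega)]
  have hfqmul : ∀ k i, f (i + k * q) = f i := by
    intro k
    induction k with
    | zero => simp
    | succ k ih => intro i; rw [Nat.succ_mul, ← Nat.add_assoc, hfq, ih]
  funext i
  have h3 := Nat.mod_lt i hq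
  rw [← Nat.mod_add_div i q, Nat.mul_comm, hfqmul, hgmul, h _ (by omega)]

end Periodic

section Lyndon

variable {β : Type*} [Inhabited β] [LinearOrder β]

theorem isLyndon_iff_lyndonAt {x : List β} : IsLyndon x ↔ LyndonAt (periodicWord x) 0 x.length := by
  have hrot : ∀ i, x < rot^[i] x ↔ ∃ k, k < x.length ∧ LtAt (periodicWord x) 0 i k := by
    intro i
    have : x < rot^[i] x ↔
        slice (periodicWord x) 0 x.length < slice (periodicWord x) i x.length := by
      rw [slice_periodicWord, rot_iterate_eq_slice]
    rw [this, slice_lt_slice_iff]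
    constructor
    · rintro (⟨h, _⟩ | ⟨k, hk, _, h⟩)
      · exact absurd h (lt_irrefl _)
      · exact ⟨k, hk, h⟩
    · rintro ⟨k, hk, h⟩
      exact Or.inr ⟨k, hk, hk, h⟩
  constructor
  · rintro ⟨hne, h⟩
    refine ⟨List.length_pos_iff.2 hne, fun i hi hix => ?_⟩
    obtain ⟨k, hk, h1, h2⟩ := (hrot i).1 (h i hix hi)
    by_cases hik : i + k < x.length
    · exact ⟨k, hik, by rw [Nat.zero_add]; exact ⟨h1, h2⟩⟩
    exfalso
    obtain ⟨l, hl, h3, h4⟩ := (hrot (x.length - i)).1 (h (x.length - i) (by omega) (by omega))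
    have hper : ∀ j, periodicWord x (i + (x.length - i + j)) = periodicWord x j := by
      intro j
      rw [show i + (x.length - i + j) = j + x.length by omega, periodicWord_add_length]
    have hk' : LtAt (periodicWord x) (x.length - i) 0 (k - (x.length - i)) := by
      refine ⟨fun j hj => ?_, ?_⟩
      · have := h1 (x.length - i + j) (by omega)
        rw [hper] at this
        simpa using this
      · have := h2
        rw [show k = x.length - i + (k - (x.length - i)) by omega, hper] at this
        simpa using this
    have := LtAt.trans ⟨h3, h4⟩ hk'
    exact lt_irrefl _ this.2
  · rintro ⟨hpos, h⟩
    refine ⟨List.length_pos_iff.1 hpos, fun i hix hi => (hrot i).2 ?_⟩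
    obtain ⟨k, hk, h1⟩ := h i hi hix
    rw [Nat.zero_add] at h1
    exact ⟨k, by omega, h1⟩

theorem isLyndon_slice_iff {T : ℕ → β} {a p : ℕ} : IsLyndon (slice T a p) ↔ LyndonAt T a p := by
  rw [isLyndon_iff_lyndonAt, length_slice]
  have h : ∀ i < p, periodicWord (slice T a p) (0 + i) = T (a + i) := by
    intro i hi
    rw [Nat.zero_add, periodicWord_of_lt (by simpa using hi), getElem_slice]
  exact ⟨fun hl => hl.congr h, fun hl => hl.congr fun i hi => (h i hi).symm⟩

omit [Inhabited β] in
theorem exists_firstLyndonFactor_eq_take {w : List β} (hw : w ≠ []) :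
    ∃ q, 0 < q ∧ q ≤ w.length ∧ firstLyndonFactor w = w.take q ∧ IsLyndon (w.take q) ∧
      ∀ q', q < q' → q' ≤ w.length → ¬ IsLyndon (w.take q') := by
  set l := (List.range (w.length + 1)).filter (fun i => decide (IsLyndon (w.take i))) with hl
  have hpos : 0 < w.length := List.length_pos_iff.2 hw
  have hmem : ∀ q, q ∈ l ↔ q ≤ w.length ∧ IsLyndon (w.take q) := by
    intro q
    simp [hl]
  have h1 : 1 ∈ l := by
    rw [hmem]
    refine ⟨hpos, ?_, ?_⟩
    · simp [hw]
    · intro i hi h0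
      rw [List.length_take] at hi
      omega
  have hne : l ≠ [] := List.ne_nil_of_mem h1
  have hfirst : firstLyndonFactor w = w.take (l.getLast hne) := by
    unfold firstLyndonFactor
    rw [List.filter_map]
    show (List.map _ l).getLastD [] = _
    rw [List.getLastD_eq_getLast?, List.getLast?_map, List.getLast?_eq_some_getLast hne]
    rfl
  have hsorted : l.Pairwise (· < ·) := List.Pairwise.filter _ List.pairwise_lt_range
  have hlast : ∀ q ∈ l, q ≤ l.getLast hne := by
    intro q hq
    rw [← List.dropLast_append_getLast hne] at hsorted hq
    rcases List.mem_append.1 hq with h | h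
    · exact ((List.pairwise_append.1 hsorted).2.2 q h _ (by simp)).le
    · exact (List.mem_singleton.1 h).le
  have hL := (hmem _).1 (List.getLast_mem hne)
  refine ⟨l.getLast hne, ?_, hL.1, hfirst, hL.2, fun q' hq hq' hLyn => ?_⟩
  · exact hlast 1 h1
  · exact absurd (hlast q' ((hmem q').2 ⟨hq', hLyn⟩)) (not_le.2 hq)

/-- `s 0 < s 1 < ⋯ < s m = n` are the starting positions of the greedy factorization of
`T[s 0..n)` into longest Lyndon prefixes. -/
structure IsLyndonStarts (T : ℕ → β) (n m : ℕ) (s : ℕ → ℕ) : Prop where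
  last : s m = n
  lt_succ : ∀ i < m, s i < s (i + 1)
  lyndon : ∀ i < m, LyndonAt T (s i) (s (i + 1) - s i)
  maximal : ∀ i < m, ∀ q, s (i + 1) < s i + q → s i + q ≤ n → ¬ LyndonAt T (s i) q

theorem exists_starts_aux (T : ℕ → β) (n : ℕ) : ∀ fuel a, a ≤ n → n - a ≤ fuel →
    ∃ m s, s 0 = a ∧ IsLyndonStarts T n m s ∧
      lyndonFactAux fuel (slice T a (n - a))
        = (List.range m).map fun i => slice T (s i) (s (i + 1) - s i) := by
  intro fuel
  induction fuel with
  | zero =>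
    intro a ha h
    refine ⟨0, fun _ => a, rfl, ⟨by omega, ?_, ?_, ?_⟩, by simp [lyndonFactAux]⟩ <;>
      exact fun i hi => absurd hi (Nat.not_lt_zero i)
  | succ fuel ih =>
    intro a ha h
    rcases ha.eq_or_lt with rfl | ha
    · refine ⟨0, fun _ => a, rfl, ⟨by omega, ?_, ?_, ?_⟩, by simp [slice, lyndonFactAux]⟩ <;>
        exact fun i hi => absurd hi (Nat.not_lt_zero i)
    · have hne : slice T a (n - a) ≠ [] := by
        rw [← List.length_pos_iff, length_slice]; omega
      obtain ⟨q, hq, hqle, hfirst, hLyn, hmax⟩ := exists_firstLyndonFactor_eq_take hne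
      rw [length_slice] at hqle
      obtain ⟨m, s, hs0, hs, hfac⟩ := ih (a + q) (by omega) (by omega)
      rw [take_slice T hqle] at hfirst hLyn
      refine ⟨m + 1, fun i => Nat.casesOn i a s, rfl, ⟨hs.last, ?_, ?_, ?_⟩, ?_⟩
      · intro i hi
        cases i with
        | zero => show a < s 0; omega
        | succ i => exact hs.lt_succ i (by omega)
      · intro i hi
        cases i with
        | zero =>
          show LyndonAt T a (s 0 - a)
          rw [hs0, Nat.add_sub_cancel_left]
          exact isLyndon_slice_iff.1 hLyn
        | succ i => exact hs.lyndon i (by omega)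
      · intro i hi
        cases i with
        | zero =>
          intro q' h1 h2 h3
          change s 0 < a + q' at h1
          change a + q' ≤ n at h2
          have := hmax q' (by omega) (by rw [length_slice]; omega)
          rw [take_slice T (by omega)] at this
          exact this (isLyndon_slice_iff.2 h3)
        | succ i => exact hs.maximal i (by omega)
      · have hstep : lyndonFactAux (fuel + 1) (slice T a (n - a))
            = slice T a q :: lyndonFactAux fuel (slice T (a + q) (n - (a + q))) := by
          obtain ⟨b, t, hbt⟩ := List.exists_cons_of_ne_nil hne
          have : ∀ v : List β, v ≠ [] → firstLyndonFactor v ≠ [] →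
              lyndonFactAux (fuel + 1) v = firstLyndonFactor v ::
                lyndonFactAux fuel (v.drop (firstLyndonFactor v).length) := by
            intro v hv hf
            cases v with
            | nil => exact absurd rfl hv
            | cons b t => simp [lyndonFactAux, hf]
          rw [this _ hne, hfirst, length_slice, drop_slice, Nat.sub_add_eq]
          rw [hfirst, ← List.length_pos_iff, length_slice]
          exact hq
        rw [hstep, hfac, List.range_succ_eq_map, List.map_cons, List.map_map]
        congr 1
        show slice T a q = slice T a (s 0 - a)
        rw [hs0, Nat.add_sub_cancel_left]

theorem exists_lyndonFactorization_eq (w : List β) :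
    ∃ m s, s 0 = 0 ∧ IsLyndonStarts (periodicWord w) w.length m s ∧
      lyndonFactorization w
        = (List.range m).map fun i => slice (periodicWord w) (s i) (s (i + 1) - s i) := by
  obtain ⟨m, s, h0, hs, h⟩ :=
    exists_starts_aux (periodicWord w) w.length w.length 0 (Nat.zero_le _) (by omega)
  refine ⟨m, s, h0, hs, ?_⟩
  rw [← h, Nat.sub_zero, slice_periodicWord]
  rfl

end Lyndon

section RotationWords

variable {β : Type*} [Inhabited β]

omit [Inhabited β] in
theorem slice_append (T : ℕ → β) (a p q : ℕ) :
    slice T a (p + q) = slice T a p ++ slice T (a + p) q := by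
  rw [← List.take_append_drop p (slice T a (p + q)), take_slice T (by omega), drop_slice,
    Nat.add_sub_cancel_left]

theorem listPow_eq_slice (x : List β) (m : ℕ) :
    listPow x m = slice (periodicWord x) 0 (m * x.length) := by
  induction m with
  | zero => simp [listPow, slice]
  | succ m ih =>
    rw [Nat.succ_mul, Nat.add_comm (m * x.length), slice_append, slice_periodicWord, listPow, ih]
    congr 1
    rw [slice_eq_slice_iff]
    intro i _
    rw [← periodicWord_add_length, Nat.zero_add, Nat.zero_add, Nat.add_comm]

theorem omegaLE_iff [LinearOrder β] {x y : List β} (hx : x ≠ []) (hy : y ≠ []) :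
    omegaLE x y ↔ toLex (periodicWord x) ≤ toLex (periodicWord y) := by
  unfold omegaLE
  rw [← not_lt, ← not_lt, not_iff_not, listPow_eq_slice, listPow_eq_slice,
    Nat.mul_comm y.length, List.lt_iff_exists]
  refine Iff.trans ?_ lexWord_lt_iff.symm
  have hN : 0 < x.length * y.length :=
    Nat.mul_pos (List.length_pos_iff.2 hx) (List.length_pos_iff.2 hy)
  have hmodx : ∀ i, periodicWord x (i % (x.length * y.length)) = periodicWord x i := by
    intro i
    conv_rhs => rw [← Nat.mod_add_div i (x.length * y.length), Nat.mul_assoc]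
    rw [periodicWord_add_mul_length]
  have hmody : ∀ i, periodicWord y (i % (x.length * y.length)) = periodicWord y i := by
    intro i
    conv_rhs => rw [← Nat.mod_add_div i (x.length * y.length), Nat.mul_comm x.length, Nat.mul_assoc]
    rw [periodicWord_add_mul_length, Nat.mul_comm x.length]
  simp only [length_slice, getElem_slice, lt_irrefl, and_false, false_or, Nat.zero_add]
  constructor
  · rintro ⟨k, _, _, h1, h2⟩
    exact ⟨k, fun j hj => h1 j hj, h2⟩
  · rintro ⟨k, h1, h2⟩
    have hk : k < x.length * y.length := by
      by_contra hk
      have := h1 (k % (x.length * y.length)) ((Nat.mod_lt _ hN).trans_le (not_lt.1 hk))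
      change periodicWord y _ = periodicWord x _ at this
      rw [hmodx, hmody] at this
      exact absurd this h2.ne
    exact ⟨k, hk, hk, fun j hj => h1 j hj, h2⟩

open Classical in
/-- The infinite periodic words generated by all rotations of words of `F`. -/
noncomputable def rotationWords (F : List (List β)) : Finset (Lex (ℕ → β)) :=
  ((F.map rotations).flatten.map fun x => toLex (periodicWord x)).toFinset

theorem mem_rotations {β : Type*} {x y : List β} :
    y ∈ rotations x ↔ ∃ i < x.length, y = rot^[i] x := by
  simp [rotations]

theorem mem_rotationWords {F : List (List β)} {f : Lex (ℕ → β)} :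
    f ∈ rotationWords F ↔ ∃ u ∈ F, ∃ t < u.length, f = shiftWord t (toLex (periodicWord u)) := by
  have hshift : ∀ u : List β, ∀ t < u.length,
      toLex (periodicWord (rot^[t] u)) = shiftWord t (toLex (periodicWord u)) := by
    intro u t ht
    rw [periodicWord_rot_iterate (List.length_pos_iff.1 (Nat.zero_lt_of_lt ht))]
    rfl
  simp only [rotationWords, List.mem_toFinset, List.mem_map, List.mem_flatten]
  constructor
  · rintro ⟨x, ⟨l, ⟨u, hu, rfl⟩, hx⟩, rfl⟩
    obtain ⟨t, ht, rfl⟩ := mem_rotations.1 hx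
    exact ⟨u, hu, t, ht, hshift u t ht⟩
  · rintro ⟨u, hu, t, ht, rfl⟩
    exact ⟨_, ⟨_, ⟨u, hu, rfl⟩, mem_rotations.2 ⟨t, ht, rfl⟩⟩, hshift u t ht⟩

theorem card_rotationWords_le (F : List (List β)) :
    (rotationWords F).card ≤ (F.map List.length).sum := by
  classical
  refine (List.toFinset_card_le _).trans ?_
  rw [List.length_map, List.length_flatten, List.map_map]
  exact le_of_eq (congrArg List.sum (List.map_congr_left fun x _ => by simp [rotations]))

theorem shift_mem_rotationWords {F : List (List β)} {u : List β} (hu : u ∈ F) (hne : u ≠ [])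
    (t : ℕ) : shiftWord t (toLex (periodicWord u)) ∈ rotationWords F := by
  refine mem_rotationWords.2 ⟨u, hu, t % u.length, Nat.mod_lt _ (List.length_pos_iff.2 hne), ?_⟩
  funext i
  show periodicWord u (t + i) = periodicWord u (t % u.length + i)
  rw [← periodicWord_mod, ← periodicWord_mod u (t % u.length + i), Nat.mod_add_mod]

theorem shiftSystem_rotationWords {F : List (List β)} {P : ℕ} (hP : 0 < P)
    (hF : ∀ u ∈ F, u ≠ [] ∧ u.length ∣ P) :
    ShiftSystem (rotationWords F) (fun f => f (P - 1)) := by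
  constructor
  · intro f hf
    obtain ⟨u, hu, t, ht, rfl⟩ := mem_rotationWords.1 hf
    rw [shiftWord_shiftWord]
    exact shift_mem_rotationWords hu (hF u hu).1 _
  · intro f hf
    obtain ⟨u, hu, t, ht, rfl⟩ := mem_rotationWords.1 hf
    obtain ⟨q, hq⟩ := (hF u hu).2
    show periodicWord u (t + (1 + (P - 1))) = periodicWord u (t + 0)
    rw [show t + (1 + (P - 1)) = t + u.length * q by omega, periodicWord_add_mul_length]
    rfl

theorem getLast?_eq_periodicWord {x : List β} {P : ℕ} (hx : x ≠ []) (hP : 0 < P)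
    (h : x.length ∣ P) : x.getLast? = some (periodicWord x (P - 1)) := by
  obtain ⟨q, rfl⟩ := h
  have hpos : 0 < x.length := List.length_pos_iff.2 hx
  have hq : 0 < q := Nat.pos_of_mul_pos_left hP
  have h1 : x.length * q - 1 = x.length - 1 + x.length * (q - 1) := by
    obtain ⟨r, rfl⟩ := Nat.exists_eq_succ_of_ne_zero hq.ne'
    rw [Nat.mul_succ, Nat.succ_sub_one]; omega
  rw [h1, periodicWord_add_mul_length, periodicWord_of_lt (by omega),
    List.getLast?_eq_some_getLast hx, List.getLast_eq_getElem]

theorem runsCount_BBWT_eq [LinearOrder β] {w : List β} {P : ℕ} (hP : 0 < P)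
    (hne : lyndonFactorization w ≠ [])
    (hF : ∀ u ∈ lyndonFactorization w, u ≠ [] ∧ u.length ∣ P) :
    runsCount (BBWT w) =
      1 + (jumpSet (rotationWords (lyndonFactorization w)) (fun f => f (P - 1))).card := by
  set F := lyndonFactorization w with hFdef
  set l := (F.map rotations).flatten with hl
  have hmem : ∀ x ∈ l, x ≠ [] ∧ x.length ∣ P := by
    intro x hx
    obtain ⟨_, h1, h2⟩ := List.mem_flatten.1 hx
    obtain ⟨u, hu, rfl⟩ := List.mem_map.1 h1
    obtain ⟨t, ht, rfl⟩ := mem_rotations.1 h2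
    refine ⟨?_, by rw [length_rot_iterate]; exact (hF u hu).2⟩
    rw [← List.length_pos_iff, length_rot_iterate]; omega
  have h1 : BBWT w = (l.insertionSort omegaLE).map (fun x => periodicWord x (P - 1)) := by
    show (l.insertionSort omegaLE).filterMap List.getLast? = _
    rw [← List.filterMap_eq_map]
    refine List.filterMap_congr fun x hx => ?_
    have := hmem x ((List.mem_insertionSort omegaLE).1 hx)
    exact getLast?_eq_periodicWord this.1 hP this.2
  have h2 : (l.insertionSort omegaLE).map (fun x => toLex (periodicWord x))
      = (l.map fun x => toLex (periodicWord x)).insertionSort (· ≤ ·) :=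
    List.map_insertionSort _ _ _ _ fun a ha b hb => omegaLE_iff (hmem a ha).1 (hmem b hb).1
  have h3 : BBWT w = ((l.map fun x => toLex (periodicWord x)).insertionSort (· ≤ ·)).map
      (fun f => f (P - 1)) := by
    rw [h1, ← h2, List.map_map]
    rfl
  have hlne : l ≠ [] := by
    obtain ⟨u, hu⟩ := List.exists_mem_of_ne_nil _ hne
    refine List.ne_nil_of_mem (a := u) (List.mem_flatten.2 ⟨rotations u,
      List.mem_map.2 ⟨u, hu, rfl⟩, mem_rotations.2 ⟨0, List.length_pos_iff.2 (hF u hu).1, rfl⟩⟩)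
  rw [h3, runsCount_map_eq_jumpSet]
  · congr 3
    ext f
    simp [rotationWords, hl, hFdef]
  · rw [← List.length_pos_iff, List.length_insertionSort, List.length_map]
    exact List.length_pos_iff.2 hlne
  · exact List.pairwise_insertionSort _ _

theorem eq_of_agree_of_mem_rotationWords {F : List (List β)} {n : ℕ}
    (hF : ∀ u ∈ F, u.length ≤ n) {f g : Lex (ℕ → β)} (hf : f ∈ rotationWords F)
    (hg : g ∈ rotationWords F) (h : ∀ i < 2 * n, f i = g i) : f = g := by
  obtain ⟨u, hu, t, ht, rfl⟩ := mem_rotationWords.1 hf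
  obtain ⟨v, hv, s, hs, rfl⟩ := mem_rotationWords.1 hg
  have h1 := hF u hu
  have h2 := hF v hv
  refine eq_of_periodic_of_agree (p := u.length) (q := v.length) (by omega) (by omega)
    (fun i => ?_) (fun i => ?_) fun i hi => h i (by omega)
  · rw [shiftWord_apply, shiftWord_apply, ← Nat.add_assoc]
    exact periodicWord_add_length u (t + i)
  · rw [shiftWord_apply, shiftWord_apply, ← Nat.add_assoc]
    exact periodicWord_add_length v (s + i)

end RotationWords

section Blocks

variable {β : Type*}

/-- The factors of `T` delimited by consecutive positions `s 0, …, s m`. -/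
def blocks (T : ℕ → β) (m : ℕ) (s : ℕ → ℕ) : List (List β) :=
  (List.range m).map fun i => slice T (s i) (s (i + 1) - s i)

theorem mem_blocks {T : ℕ → β} {m : ℕ} {s : ℕ → ℕ} {u : List β} :
    u ∈ blocks T m s ↔ ∃ i < m, slice T (s i) (s (i + 1) - s i) = u := by
  simp [blocks]

/-- The number of distinct words of length `k` that occur in `T` at a position below `n`. -/
def factorCount [DecidableEq β] (T : ℕ → β) (n k : ℕ) : ℕ :=
  ((Finset.range n).image fun p => window k fun r => T (p + r)).card

theorem factorCount_shift_le [DecidableEq β] {T : ℕ → β} {n : ℕ} (hn : 0 < n)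
    (hT : ∀ i, T (i % n) = T i) (a k : ℕ) :
    factorCount (fun j => T (a + j)) n k ≤ factorCount T n k := by
  refine Finset.card_le_card fun x hx => ?_
  obtain ⟨p, _, rfl⟩ := Finset.mem_image.1 hx
  refine Finset.mem_image.2 ⟨(a + p) % n, Finset.mem_range.2 (Nat.mod_lt _ hn), ?_⟩
  rw [window_eq_iff]
  intro r _
  rw [← hT, Nat.mod_add_mod, hT, Nat.add_assoc]

variable [LinearOrder β]

theorem IsLyndon.eq_of_shift_eq [Inhabited β] {u v : List β} (hu : IsLyndon u) (hv : IsLyndon v)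
    {a b : ℕ} (ha : a < u.length) (hb : b < v.length)
    (h : ∀ i, periodicWord u (a + i) = periodicWord v (b + i)) : u = v ∧ a = b := by
  have hlen : ∀ {u v : List β} {a b : ℕ}, IsLyndon v → a < u.length → b < v.length →
      (∀ i, periodicWord u (a + i) = periodicWord v (b + i)) → ¬ u.length < v.length := by
    intro u v a b hv ha hb h hlt
    obtain ⟨k, _, _, hk⟩ := (isLyndon_iff_lyndonAt.1 hv).2 u.length (by omega) hlt
    refine hk.ne ?_
    have e1 : periodicWord v (0 + k) = periodicWord u (a + (v.length - b + k)) := by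
      rw [h, show b + (v.length - b + k) = 0 + k + v.length by omega, periodicWord_add_length]
    have e2 : periodicWord v (0 + u.length + k)
        = periodicWord u (a + (v.length - b + k) + u.length) := by
      rw [Nat.add_assoc a, h,
        show b + (v.length - b + k + u.length) = 0 + u.length + k + v.length by omega,
        periodicWord_add_length]
    rw [e1, e2, periodicWord_add_length]
  have heq : u.length = v.length :=
    le_antisymm (not_lt.1 (hlen hu hb ha fun i => (h i).symm)) (not_lt.1 (hlen hv ha hb h))
  have hword : ∀ {u v : List β} {c : ℕ}, u.length = v.length →
      (∀ i, periodicWord v i = periodicWord u (c + i)) → v = rot^[c % u.length] u := by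
    intro u v c huv hc
    rw [rot_iterate_eq_slice]
    conv_lhs => rw [← slice_periodicWord v]
    rw [← huv, slice_eq_slice_iff]
    intro i _
    rw [hc, Nat.zero_add, ← periodicWord_mod, ← Nat.mod_add_mod, periodicWord_mod]
  have hlt : ∀ {u v : List β} {a b : ℕ}, IsLyndon u → u.length = v.length → a < u.length →
      b < v.length → (∀ i, periodicWord u (a + i) = periodicWord v (b + i)) → a ≠ b → u < v := by
    intro u v a b hu huv ha hb h hab
    have hc : ∀ i, periodicWord v i = periodicWord u (a + (u.length - b) + i) := by
      intro i
      rw [Nat.add_assoc, h, huv, show b + (v.length - b + i) = i + v.length by omega,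
        periodicWord_add_length]
    rw [hword huv hc]
    refine hu.2 _ (Nat.mod_lt _ (by omega)) ?_
    rcases lt_or_gt_of_ne hab with h' | h'
    · rw [Nat.mod_eq_of_lt (by omega)]; omega
    · rw [show a + (u.length - b) = a - b + u.length by omega, Nat.add_mod_right,
        Nat.mod_eq_of_lt (by omega)]
      omega
  by_cases hab : a = b
  · refine ⟨?_, hab⟩
    subst hab
    have hc : ∀ i, periodicWord v i = periodicWord u (0 + i) := by
      intro i
      rw [← periodicWord_add_length v, ← periodicWord_add_length u,
        show i + v.length = a + (v.length - a + i) by omega, ← h,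
        show 0 + i + u.length = a + (v.length - a + i) by omega]
    have := hword heq hc
    rw [Nat.zero_mod] at this
    exact this.symm
  · exact absurd (hlt hu heq ha hb h hab)
      (lt_asymm (hlt hv heq.symm hb ha (fun i => (h i).symm) (Ne.symm hab)))

namespace IsLyndonStarts

variable {T : ℕ → β} {n m : ℕ} {s : ℕ → ℕ}

theorem mono (hs : IsLyndonStarts T n m s) {i j : ℕ} (hij : i ≤ j) (hj : j ≤ m) : s i ≤ s j := by
  induction j, hij using Nat.le_induction with
  | base => exact le_rfl
  | succ j _ ih => exact (ih (by omega)).trans (hs.lt_succ j (by omega)).le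

theorem exists_block (hs : IsLyndonStarts T n m s) (h0 : s 0 = 0) {p : ℕ} (hp : p < n) :
    ∃ i < m, s i ≤ p ∧ p < s (i + 1) := by
  have hex : ∃ i, p < s i := ⟨m, by rw [hs.last]; exact hp⟩
  classical
  have h1 := Nat.find_spec hex
  have h2 : Nat.find hex ≤ m := Nat.find_min' hex (by rw [hs.last]; exact hp)
  obtain ⟨i, hi⟩ : ∃ i, Nat.find hex = i + 1 := by
    refine Nat.exists_eq_succ_of_ne_zero fun h => ?_
    rw [h, h0] at h1
    exact absurd h1 (Nat.not_lt_zero _)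
  refine ⟨i, by omega, not_lt.1 (Nat.find_min hex (by omega)), by rwa [← hi]⟩

theorem false_of_straddle (hs : IsLyndonStarts T n m s) (h0 : s 0 = 0) {b q j : ℕ}
    (h : LyndonAt T b q) (hbq : b + q ≤ n) (hj : j < m) (hbj : b < s j) (hjq : s j < b + q) :
    False := by
  obtain ⟨a, ha, h1, h2⟩ := hs.exists_block h0 (show b < n by omega)
  have haj : a + 1 ≤ j := by
    by_contra hcon
    have := hs.mono (show j ≤ a by omega) (by omega)
    omega
  have h3 := hs.mono haj hj.le
  rcases h1.eq_or_lt with rfl | h1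
  · exact hs.maximal a ha q (by omega) hbq h
  · exact hs.maximal a ha (b + q - s a) (by omega) (by omega)
      ((hs.lyndon a ha).union_of_overlap h h1 (by omega) (by omega))

theorem length_le_of_mem_blocks (hs : IsLyndonStarts T n m s) {u : List β}
    (hu : u ∈ blocks T m s) : u.length ≤ n := by
  obtain ⟨i, hi, rfl⟩ := mem_blocks.1 hu
  have := hs.mono (show i + 1 ≤ m by omega) le_rfl
  rw [hs.last] at this
  rw [length_slice]
  omega

theorem sum_length_blocks (hs : IsLyndonStarts T n m s) :
    ((blocks T m s).map List.length).sum ≤ n := by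
  have : ∀ k ≤ m, ((blocks T k s).map List.length).sum + s 0 = s k := by
    intro k
    induction k with
    | zero => intro _; simp [blocks]
    | succ k ih =>
      intro hk
      have h1 := ih (by omega)
      have h2 := hs.lt_succ k (by omega)
      rw [blocks, List.range_succ, List.map_append, List.map_append, List.sum_append]
      change ((blocks T k s).map List.length).sum + _ + _ = _
      simp only [List.map_cons, List.map_nil, List.sum_cons, List.sum_nil, length_slice]
      omega
  have := this m le_rfl
  rw [hs.last] at this
  omega

theorem slice_succ_le (hs : IsLyndonStarts T n m s) {i : ℕ} (hi : i + 1 < m) :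
    slice T (s (i + 1)) (s (i + 2) - s (i + 1)) ≤ slice T (s i) (s (i + 1) - s i) := by
  refine not_lt.1 fun hlt => ?_
  have h1 := hs.lt_succ i (by omega)
  have h2 : s (i + 1) < s (i + 2) := hs.lt_succ (i + 1) hi
  have h3 := hs.mono (show i + 2 ≤ m by omega) le_rfl
  rw [hs.last] at h3
  have ha := hs.lyndon i (by omega)
  have hb := hs.lyndon (i + 1) hi
  have he : s i + (s (i + 1) - s i) = s (i + 1) := by omega
  refine hs.maximal i (by omega) (s (i + 1) - s i + (s (i + 2) - s (i + 1))) (by omega) (by omega)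
    (ha.append (by rwa [he]) (by rwa [he]))

theorem slice_anti (hs : IsLyndonStarts T n m s) {i j : ℕ} (hij : i ≤ j) (hj : j < m) :
    slice T (s j) (s (j + 1) - s j) ≤ slice T (s i) (s (i + 1) - s i) := by
  induction j, hij using Nat.le_induction with
  | base => exact le_rfl
  | succ j _ ih => exact (hs.slice_succ_le hj).trans (ih (by omega))

variable [Inhabited β]

theorem isLyndon_of_mem_blocks (hs : IsLyndonStarts T n m s) {u : List β}
    (hu : u ∈ blocks T m s) : IsLyndon u := by
  obtain ⟨i, hi, rfl⟩ := mem_blocks.1 hu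
  exact isLyndon_slice_iff.2 (hs.lyndon i hi)

theorem prefixCount_rotationWords_le (hs : IsLyndonStarts T n m s) (k : ℕ) :
    prefixCount (rotationWords (blocks T m s)) k
      ≤ factorCount T n k + k * (blocks T m s).toFinset.card := by
  have hsub : (rotationWords (blocks T m s)).image (fun f => window k (ofLex f)) ⊆
      ((Finset.range n).image fun p => window k fun r => T (p + r)) ∪
      (Finset.range k ×ˢ (blocks T m s).toFinset).image
        (fun e => window k fun r => periodicWord e.2 (e.2.length - (e.1 + 1) + r)) := by
    intro x hx
    obtain ⟨f, hf, rfl⟩ := Finset.mem_image.1 hx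
    obtain ⟨u, hu, t, ht, rfl⟩ := mem_rotationWords.1 hf
    rw [Finset.mem_union]
    by_cases htk : t + k ≤ u.length
    · left
      obtain ⟨i, hi, rfl⟩ := mem_blocks.1 hu
      rw [length_slice] at ht htk
      have h1 := hs.mono (show i + 1 ≤ m by omega) le_rfl
      rw [hs.last] at h1
      refine Finset.mem_image.2 ⟨s i + t, Finset.mem_range.2 (by omega), ?_⟩
      rw [window_eq_iff]
      intro r hr
      show _ = periodicWord _ (t + r)
      rw [periodicWord_of_lt (by rw [length_slice]; omega), getElem_slice, Nat.add_assoc]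
    · right
      refine Finset.mem_image.2 ⟨(u.length - t - 1, u), ?_, ?_⟩
      · rw [Finset.mem_product, Finset.mem_range, List.mem_toFinset]
        exact ⟨by show u.length - t - 1 < k; omega, hu⟩
      · rw [window_eq_iff]
        intro r hr
        show periodicWord u (u.length - (u.length - t - 1 + 1) + r) = periodicWord u (t + r)
        congr 2
        omega
  refine (Finset.card_le_card hsub).trans ((Finset.card_union_le _ _).trans ?_)
  refine Nat.add_le_add_left (Finset.card_image_le.trans ?_) _
  rw [Finset.card_product, Finset.card_range]

theorem eq_periodicWord_of_run (hs : IsLyndonStarts T n m s) {i e : ℕ} (hie : i ≤ e) (he : e < m)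
    (h : ∀ j, i ≤ j → j < e →
      slice T (s j) (s (j + 1) - s j) = slice T (s (j + 1)) (s (j + 2) - s (j + 1))) {q : ℕ}
    (hq : s i ≤ q) (hqe : q < s (e + 1)) :
    T q = periodicWord (slice T (s i) (s (i + 1) - s i)) (q - s i) := by
  set u := slice T (s i) (s (i + 1) - s i) with hu
  suffices hmain : slice T (s e) (s (e + 1) - s e) = u ∧ (∃ c, s e = s i + u.length * c) ∧
      ∀ q, s i ≤ q → q < s (e + 1) → T q = periodicWord u (q - s i) from hmain.2.2 q hq hqe
  clear hq hqe q
  have hloc : ∀ j < m, slice T (s j) (s (j + 1) - s j) = u → ∀ q, s j ≤ q → q < s (j + 1) →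
      T q = periodicWord u (q - s j) := by
    intro j _ hj q h1 h2
    rw [← hj, periodicWord_of_lt (by rw [length_slice]; omega), getElem_slice]
    congr 1
    omega
  induction e, hie using Nat.le_induction with
  | base => exact ⟨rfl, ⟨0, by simp⟩, hloc i he rfl⟩
  | succ e hie ih =>
    obtain ⟨h1, ⟨c, hc⟩, h2⟩ := ih (by omega) fun j hj hje => h j hj (by omega)
    have h3 : slice T (s (e + 1)) (s (e + 2) - s (e + 1)) = u := by
      rw [← h e hie (by omega), h1]
    have h4 : s (e + 1) = s i + u.length * (c + 1) := by
      have := congrArg List.length h1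
      rw [length_slice] at this
      have := hs.lt_succ e (by omega)
      rw [Nat.mul_succ]
      omega
    refine ⟨h3, ⟨c + 1, h4⟩, fun q hq1 hq2 => ?_⟩
    by_cases hqe : q < s (e + 1)
    · exact h2 q hq1 hqe
    · rw [hloc (e + 1) he h3 q (not_lt.1 hqe) hq2,
        show q - s i = q - s (e + 1) + u.length * (c + 1) by omega, periodicWord_add_mul_length]

theorem factorCount_le (hs : IsLyndonStarts T n m s) (h0 : s 0 = 0) (k : ℕ) :
    factorCount T n k ≤ prefixCount (rotationWords (blocks T m s)) k
      + k * (blocks T m s).toFinset.card := by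
  let Ch := (Finset.range m).filter fun e => e + 1 = m ∨
    slice T (s e) (s (e + 1) - s e) ≠ slice T (s (e + 1)) (s (e + 2) - s (e + 1))
  have hCh : ∀ e, e ∈ Ch ↔ e < m ∧ (e + 1 = m ∨
      slice T (s e) (s (e + 1) - s e) ≠ slice T (s (e + 1)) (s (e + 2) - s (e + 1))) := by
    intro e
    rw [Finset.mem_filter, Finset.mem_range]
  have hcard : Ch.card ≤ (blocks T m s).toFinset.card := by
    have hinj : ∀ e ∈ Ch, ∀ e' ∈ Ch, e < e' →
        slice T (s e) (s (e + 1) - s e) ≠ slice T (s e') (s (e' + 1) - s e') := by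
      intro e he e' he' hlt heq
      rw [hCh] at he he'
      rcases he.2 with h | h
      · omega
      · refine h (le_antisymm ?_ (hs.slice_anti (Nat.le_succ e) (by omega)))
        rw [heq]
        exact hs.slice_anti hlt he'.1
    refine Finset.card_le_card_of_injOn (fun e => slice T (s e) (s (e + 1) - s e)) ?_ ?_
    · intro e he
      rw [Finset.mem_coe, hCh] at he
      exact Finset.mem_coe.2 (List.mem_toFinset.2 (mem_blocks.2 ⟨e, he.1, rfl⟩))
    · intro e he e' he' heq
      by_contra hne
      rcases lt_or_gt_of_ne hne with h | h
      · exact hinj e he e' he' h heq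
      · exact hinj e' he' e he h heq.symm
  have hsub : ((Finset.range n).image fun p => window k fun r => T (p + r)) ⊆
      (rotationWords (blocks T m s)).image (fun f => window k (ofLex f)) ∪
      (Finset.range k ×ˢ Ch).image
        (fun e => window k fun r => T (s (e.2 + 1) - (e.1 + 1) + r)) := by
    intro x hx
    obtain ⟨p, hp, rfl⟩ := Finset.mem_image.1 hx
    obtain ⟨i, hi, h1, h2⟩ := hs.exists_block h0 (Finset.mem_range.1 hp)
    have hex : ∃ e, i ≤ e ∧ e ∈ Ch := ⟨m - 1, by omega, (hCh _).2 ⟨by omega, by omega⟩⟩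
    obtain ⟨hie, he⟩ := Nat.find_spec hex
    set e := Nat.find hex with hedef
    have hem := ((hCh e).1 he).1
    have hrun : ∀ j, i ≤ j → j < e →
        slice T (s j) (s (j + 1) - s j) = slice T (s (j + 1)) (s (j + 2) - s (j + 1)) := by
      intro j hij hje
      by_contra hne
      exact Nat.find_min hex hje ⟨hij, (hCh j).2 ⟨by omega, Or.inr hne⟩⟩
    have h3 := hs.mono (show i + 1 ≤ e + 1 by omega) hem
    rw [Finset.mem_union]
    by_cases hpk : p + k ≤ s (e + 1)
    · left
      have hmem : slice T (s i) (s (i + 1) - s i) ∈ blocks T m s := mem_blocks.2 ⟨i, hi, rfl⟩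
      refine Finset.mem_image.2 ⟨_, shift_mem_rotationWords hmem
        (hs.isLyndon_of_mem_blocks hmem).1 (p - s i), ?_⟩
      rw [window_eq_iff]
      intro r hr
      show periodicWord _ (p - s i + r) = T (p + r)
      rw [hs.eq_periodicWord_of_run hie hem hrun (q := p + r) (by omega) (by omega)]
      congr 1
      omega
    · right
      refine Finset.mem_image.2 ⟨(s (e + 1) - p - 1, e), ?_, ?_⟩
      · rw [Finset.mem_product, Finset.mem_range]
        exact ⟨by show s (e + 1) - p - 1 < k; omega, he⟩
      · rw [window_eq_iff]
        intro r hr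
        show T (s (e + 1) - (s (e + 1) - p - 1 + 1) + r) = T (p + r)
        congr 1
        omega
  refine (Finset.card_le_card hsub).trans ((Finset.card_union_le _ _).trans ?_)
  refine Nat.add_le_add_left (Finset.card_image_le.trans ?_) _
  rw [Finset.card_product, Finset.card_range]
  exact Nat.mul_le_mul_left _ hcard

theorem two_pow_mul_card_le_prefixCount (hs : IsLyndonStarts T n m s) (j : ℕ) :
    2 ^ j * ((blocks T m s).toFinset.filter fun u => Nat.log 2 u.length = j).card
      ≤ prefixCount (rotationWords (blocks T m s)) (4 * 2 ^ j) := by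
  have hlog : ∀ u ∈ (blocks T m s).toFinset.filter (fun u => Nat.log 2 u.length = j),
      u ∈ blocks T m s ∧ 2 ^ j ≤ u.length ∧ u.length < 2 * 2 ^ j := by
    intro u hu
    rw [Finset.mem_filter, List.mem_toFinset] at hu
    have hpos : u.length ≠ 0 :=
      (List.length_pos_iff.2 (hs.isLyndon_of_mem_blocks hu.1).1).ne'
    refine ⟨hu.1, ?_, ?_⟩
    · rw [← hu.2]; exact Nat.pow_log_le_self 2 hpos
    · rw [← hu.2, ← pow_succ']; exact Nat.lt_pow_succ_log_self (by norm_num) _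
  rw [← Finset.card_range (2 ^ j), ← Finset.card_product, Finset.card_range]
  refine Finset.card_le_card_of_injOn
    (fun e => window (4 * 2 ^ j) fun r => periodicWord e.2 (e.1 + r)) ?_ ?_
  · intro e he
    obtain ⟨h1, h2⟩ := Finset.mem_product.1 (Finset.mem_coe.1 he)
    obtain ⟨h3, _, _⟩ := hlog _ h2
    exact Finset.mem_coe.2 (Finset.mem_image.2 ⟨_, shift_mem_rotationWords h3
      (hs.isLyndon_of_mem_blocks h3).1 e.1, rfl⟩)
  · rintro ⟨a, u⟩ hu ⟨b, v⟩ hv heq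
    obtain ⟨ha, hu⟩ := Finset.mem_product.1 (Finset.mem_coe.1 hu)
    obtain ⟨hb, hv⟩ := Finset.mem_product.1 (Finset.mem_coe.1 hv)
    obtain ⟨hu1, hu2, hu3⟩ := hlog _ hu
    obtain ⟨hv1, hv2, hv3⟩ := hlog _ hv
    simp only [Finset.mem_range] at ha hb
    simp only [] at hu2 hu3 hv2 hv3 hu1 hv1
    have h := window_eq_iff.1 heq
    have h' : (fun i => periodicWord u (a + i)) = fun i => periodicWord v (b + i) :=
      eq_of_periodic_of_agree (p := u.length) (q := v.length) (by omega) (by omega)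
        (fun i => by rw [← Nat.add_assoc, periodicWord_add_length])
        (fun i => by rw [← Nat.add_assoc, periodicWord_add_length])
        fun i hi => h i (by omega)
    obtain ⟨rfl, rfl⟩ := (hs.isLyndon_of_mem_blocks hu1).eq_of_shift_eq
      (hs.isLyndon_of_mem_blocks hv1) (by omega) (by omega) (congrFun h')
    rfl

omit [Inhabited β] in
theorem two_pow_mul_card_le_factorCount (hs : IsLyndonStarts T n m s) (h0 : s 0 = 0) (j : ℕ) :
    2 ^ j * ((blocks T m s).toFinset.filter fun u => Nat.log 2 u.length = j).card
      ≤ 2 ^ j * 2 + factorCount T n (3 * 2 ^ j) := by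
  set K := (blocks T m s).toFinset.filter fun u => Nat.log 2 u.length = j with hK
  set l := 2 ^ j with hl
  have hex : ∀ u, ∃ i, u ∈ K → i < m ∧ slice T (s i) (s (i + 1) - s i) = u := by
    intro u
    by_cases hu : u ∈ K
    · rw [hK, Finset.mem_filter, List.mem_toFinset] at hu
      obtain ⟨i, hi, h⟩ := mem_blocks.1 hu.1
      exact ⟨i, fun _ => ⟨hi, h⟩⟩
    · exact ⟨0, fun h => absurd h hu⟩
  choose ι hι using hex
  have hlen : ∀ u ∈ K, s (ι u + 1) = s (ι u) + u.length ∧ l ≤ u.length ∧ u.length < 2 * l ∧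
      s (ι u + 1) ≤ n := by
    intro u hu
    obtain ⟨h1, h2⟩ := hι u hu
    have h3 := congrArg List.length h2
    rw [length_slice] at h3
    have h4 := hs.lt_succ _ h1
    have h5 := hs.mono (show ι u + 1 ≤ m from h1) le_rfl
    rw [hs.last] at h5
    have h6 := (Finset.mem_filter.1 hu).2
    refine ⟨by omega, ?_, ?_, h5⟩
    · rw [hl, ← h6]; exact Nat.pow_log_le_self 2 (by omega)
    · rw [hl, ← h6, ← pow_succ']; exact Nat.lt_pow_succ_log_self (by norm_num) _
  have hsep : ∀ u ∈ K, ∀ v ∈ K, u ≠ v → s (ι u) + l ≤ s (ι v) ∨ s (ι v) + l ≤ s (ι u) := by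
    intro u hu v hv huv
    have h1 := hlen u hu
    have h2 := hlen v hv
    rcases lt_trichotomy (ι u) (ι v) with h | h | h
    · have := hs.mono (show ι u + 1 ≤ ι v from h) (hι v hv).1.le
      omega
    · exact absurd ((hι u hu).2.symm.trans (h ▸ (hι v hv).2)) huv
    · have := hs.mono (show ι v + 1 ≤ ι u from h) (hι u hu).1.le
      omega
  set A := K.filter fun u => l ≤ s (ι u) ∧ s (ι u) + 2 * l ≤ n with hA
  have hKA : K.card ≤ 2 + A.card := by
    have h1 : (K.filter fun u => s (ι u) < l).card ≤ 1 := by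
      refine Finset.card_le_one.2 fun u hu v hv => ?_
      rw [Finset.mem_filter] at hu hv
      by_contra hne
      have := hsep u hu.1 v hv.1 hne
      omega
    have h2 : (K.filter fun u => n < s (ι u) + 2 * l).card ≤ 1 := by
      refine Finset.card_le_one.2 fun u hu v hv => ?_
      rw [Finset.mem_filter] at hu hv
      by_contra hne
      have := hsep u hu.1 v hv.1 hne
      have := hlen u hu.1
      have := hlen v hv.1
      omega
    have h3 : K ⊆ (K.filter fun u => s (ι u) < l) ∪ (K.filter fun u => n < s (ι u) + 2 * l) ∪ A := by
      intro u hu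
      simp only [hA, Finset.mem_union, Finset.mem_filter, hu, true_and]
      omega
    have h4 := Finset.card_le_card h3
    have h5 := Finset.card_union_le
      ((K.filter fun u => s (ι u) < l) ∪ (K.filter fun u => n < s (ι u) + 2 * l)) A
    have h6 := Finset.card_union_le (K.filter fun u => s (ι u) < l)
      (K.filter fun u => n < s (ι u) + 2 * l)
    omega
  have hmemA : ∀ u ∈ A, u ∈ K ∧ l ≤ s (ι u) ∧ s (ι u) + 2 * l ≤ n := fun u hu =>
    Finset.mem_filter.1 hu
  have hAcard : l * A.card ≤ factorCount T n (3 * l) := by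
    rw [← Finset.card_range l, ← Finset.card_product, Finset.card_range]
    have hoff : ∀ u ∈ A, ∀ v ∈ A, ∀ a < l, ∀ b < l,
        (∀ r < 3 * l, T (s (ι u) - a + r) = T (s (ι v) - b + r)) → ¬ a < b := by
      intro u hu v hv a ha b hb h hab
      obtain ⟨hu, hu1, hu2⟩ := hmemA u hu
      obtain ⟨hv, hv1, hv2⟩ := hmemA v hv
      have h1 := hlen u hu
      have hLyn : LyndonAt T (s (ι u)) u.length := by
        have := hs.lyndon _ (hι u hu).1
        rwa [h1.1, Nat.add_sub_cancel_left] at this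
      refine hs.false_of_straddle h0 (b := s (ι v) - (b - a)) (q := u.length) (hLyn.congr ?_)
        (by omega) (hι v hv).1 (by omega) (by omega)
      intro i hi
      have := h (a + i) (by omega)
      rwa [show s (ι u) - a + (a + i) = s (ι u) + i by omega,
        show s (ι v) - b + (a + i) = s (ι v) - (b - a) + i by omega] at this
    have hlong : ∀ u ∈ A, ∀ v ∈ A, (∀ r < 2 * l, T (s (ι u) + r) = T (s (ι v) + r)) →
        ¬ v.length < u.length := by
      intro u hu v hv h hlt
      obtain ⟨hu, hu1, hu2⟩ := hmemA u hu
      obtain ⟨hv, hv1, hv2⟩ := hmemA v hv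
      have h1 := hlen u hu
      have h2 := hlen v hv
      have hLyn : LyndonAt T (s (ι u)) u.length := by
        have := hs.lyndon _ (hι u hu).1
        rwa [h1.1, Nat.add_sub_cancel_left] at this
      exact hs.maximal (ι v) (hι v hv).1 u.length (by omega) (by omega)
        (hLyn.congr fun i hi => h i (by omega))
    refine Finset.card_le_card_of_injOn
      (fun e => window (3 * l) fun r => T (s (ι e.2) - e.1 + r)) ?_ ?_
    · intro e he
      obtain ⟨h1, h2⟩ := Finset.mem_product.1 (Finset.mem_coe.1 he)
      have h3 := hmemA _ h2
      have h4 := hlen _ h3.1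
      have h5 := Finset.mem_range.1 h1
      refine Finset.mem_coe.2 (Finset.mem_image.2 ⟨s (ι e.2) - e.1, ?_, rfl⟩)
      rw [Finset.mem_range]
      omega
    · rintro ⟨a, u⟩ hau ⟨b, v⟩ hbv heq
      obtain ⟨ha, hu⟩ := Finset.mem_product.1 (Finset.mem_coe.1 hau)
      obtain ⟨hb, hv⟩ := Finset.mem_product.1 (Finset.mem_coe.1 hbv)
      simp only [Finset.mem_range] at ha hb
      change u ∈ A at hu
      change v ∈ A at hv
      have h : ∀ r < 3 * l, T (s (ι u) - a + r) = T (s (ι v) - b + r) := window_eq_iff.1 heq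
      have hab : a = b := le_antisymm
        (not_lt.1 (hoff v hv u hu b hb a ha fun r hr => (h r hr).symm))
        (not_lt.1 (hoff u hu v hv a ha b hb h))
      subst hab
      have hu' := hmemA u hu
      have hv' := hmemA v hv
      have h' : ∀ r < 2 * l, T (s (ι u) + r) = T (s (ι v) + r) := by
        intro r hr
        have := h (a + r) (by omega)
        rwa [show s (ι u) - a + (a + r) = s (ι u) + r by omega,
          show s (ι v) - a + (a + r) = s (ι v) + r by omega] at this
      have hlenuv : u.length = v.length := le_antisymm
        (not_lt.1 (hlong u hu v hv h'))
        (not_lt.1 (hlong v hv u hu fun r hr => (h' r hr).symm))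
      have hlu := hlen u hu'.1
      have hlv := hlen v hv'.1
      have huv : u = v := by
        rw [← (hι u hu'.1).2, ← (hι v hv'.1).2,
          show s (ι u + 1) - s (ι u) = u.length by omega,
          show s (ι v + 1) - s (ι v) = u.length by omega, slice_eq_slice_iff]
        exact fun i hi => h' i (by omega)
      rw [huv]
  calc l * K.card ≤ l * (2 + A.card) := Nat.mul_le_mul_left _ hKA
    _ = l * 2 + l * A.card := Nat.mul_add _ _ _
    _ ≤ _ := Nat.add_le_add_left hAcard _

omit [Inhabited β] in
theorem card_toFinset_blocks_le (hs : IsLyndonStarts T n m s) {M : ℕ}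
    (h : ∀ j, ((blocks T m s).toFinset.filter fun u => Nat.log 2 u.length = j).card ≤ M) :
    (blocks T m s).toFinset.card ≤ (Nat.log 2 n + 1) * M := by
  rw [Finset.card_eq_sum_card_fiberwise (f := fun u : List β => Nat.log 2 u.length)
    (t := Finset.range (Nat.log 2 n + 1))]
  · refine (Finset.sum_le_card_nsmul _ _ M fun j _ => h j).trans ?_
    rw [Finset.card_range, smul_eq_mul]
  · intro u hu
    rw [Finset.mem_coe, List.mem_toFinset] at hu
    rw [Finset.mem_coe, Finset.mem_range]
    exact Nat.lt_succ_of_le (Nat.log_mono_right (hs.length_le_of_mem_blocks hu))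

end IsLyndonStarts

end Blocks

section Main

variable {β : Type*} [LinearOrder β]

namespace IsLyndonStarts

variable [Inhabited β] {T : ℕ → β} {n m : ℕ} {s : ℕ → ℕ}

theorem ne_nil_and_dvd_of_mem_blocks (hs : IsLyndonStarts T n m s) {u : List β}
    (hu : u ∈ blocks T m s) : u ≠ [] ∧ u.length ∣ n.factorial :=
  have hne := (hs.isLyndon_of_mem_blocks hu).1
  ⟨hne, Nat.dvd_factorial (List.length_pos_iff.2 hne) (hs.length_le_of_mem_blocks hu)⟩

theorem shiftSystem (hs : IsLyndonStarts T n m s) :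
    ShiftSystem (rotationWords (blocks T m s)) (fun f => f (n.factorial - 1)) :=
  shiftSystem_rotationWords n.factorial_pos fun _ => hs.ne_nil_and_dvd_of_mem_blocks

theorem runsCount_BBWT_eq (hs : IsLyndonStarts T n m s) (h0 : s 0 = 0) (hn : 0 < n) {w : List β}
    (hw : lyndonFactorization w = blocks T m s) :
    runsCount (BBWT w) =
      1 + (jumpSet (rotationWords (blocks T m s)) (fun f => f (n.factorial - 1))).card := by
  have hm : 0 < m := by
    rcases Nat.eq_zero_or_pos m with rfl | hm
    · have := hs.last; omega
    · exact hm
  rw [_root_.runsCount_BBWT_eq n.factorial_pos, hw]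
  · rw [hw]
    exact List.ne_nil_of_mem (mem_blocks.2 ⟨0, hm, rfl⟩)
  · rw [hw]
    exact fun u => hs.ne_nil_and_dvd_of_mem_blocks

/-- The number of distinct factors is at most logarithmically larger than the number of runs. -/
theorem card_toFinset_blocks_le_of_prefixCount_le (hs : IsLyndonStarts T n m s) {r : ℕ}
    (h : ∀ k, 1 ≤ k → prefixCount (rotationWords (blocks T m s)) k ≤ k * r) :
    (blocks T m s).toFinset.card ≤ (Nat.log 2 n + 1) * (4 * r) := by
  refine hs.card_toFinset_blocks_le fun j => ?_
  have h1 := hs.two_pow_mul_card_le_prefixCount j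
  have hpos : 0 < 2 ^ j := by positivity
  have h2 := h (4 * 2 ^ j) (by omega)
  refine Nat.le_of_mul_le_mul_left (h1.trans (h2.trans (le_of_eq ?_))) hpos
  ring

omit [Inhabited β] in
theorem card_toFinset_blocks_le_of_factorCount_le (hs : IsLyndonStarts T n m s) (h0 : s 0 = 0)
    {r : ℕ} (h : ∀ k, 1 ≤ k → factorCount T n k ≤ k * r) :
    (blocks T m s).toFinset.card ≤ (Nat.log 2 n + 1) * (2 + 3 * r) := by
  refine hs.card_toFinset_blocks_le fun j => ?_
  have h1 := hs.two_pow_mul_card_le_factorCount h0 j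
  have hpos : 0 < 2 ^ j := by positivity
  have h2 := h (3 * 2 ^ j) (by omega)
  refine Nat.le_of_mul_le_mul_left (h1.trans ((Nat.add_le_add_left h2 _).trans (le_of_eq ?_))) hpos
  ring

theorem card_jumpSet_le (hs : IsLyndonStarts T n m s) (hn : 0 < n) {M : ℕ}
    (hM : ∀ k, 1 ≤ k → prefixCount (rotationWords (blocks T m s)) k ≤ k * M) :
    (jumpSet (rotationWords (blocks T m s)) (fun f => f (n.factorial - 1))).card
      ≤ (Nat.log 2 n + 2) * (6 * Nat.log 2 n * M) := by
  have h1 := hs.shiftSystem.card_jumpSet_le (B := 2 * n) (fun f hf g hg =>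
    eq_of_agree_of_mem_rotationWords (fun u => hs.length_le_of_mem_blocks) hf hg) hM
  have h2 : Nat.log 2 (2 * n) = Nat.log 2 n + 1 := by
    rw [Nat.mul_comm, Nat.log_mul_base (by norm_num) hn.ne']
  have h3 : Nat.log 2 (rotationWords (blocks T m s)).card ≤ Nat.log 2 n :=
    Nat.log_mono_right ((card_rotationWords_le _).trans hs.sum_length_blocks)
  rw [h2] at h1
  exact h1.trans (Nat.mul_le_mul_left _ (Nat.mul_le_mul_right _ (Nat.mul_le_mul_left _ h3)))

end IsLyndonStarts

theorem runsCount_BBWT_rot_le {n : ℕ} (hn : 2 ≤ n) {w : List β} (hw : w.length = n) (i : ℕ) :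
    runsCount (BBWT (rot^[i] w)) ≤ 1783 * Nat.log 2 n ^ 4 * runsCount (BBWT w) := by
  have hne : w ≠ [] := List.length_pos_iff.1 (by omega)
  have : Inhabited β := ⟨w.head hne⟩
  obtain ⟨m, s, h0, hs, hfac⟩ := exists_lyndonFactorization_eq w
  obtain ⟨m', s', h0', hs', hfac'⟩ := exists_lyndonFactorization_eq (rot^[i] w)
  rw [length_rot_iterate, hw] at hs'
  rw [hw] at hs
  change _ = blocks (periodicWord w) m s at hfac
  change _ = blocks (periodicWord (rot^[i] w)) m' s' at hfac'
  set X := rotationWords (blocks (periodicWord w) m s)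
  set X' := rotationWords (blocks (periodicWord (rot^[i] w)) m' s')
  set L := Nat.log 2 n
  have hL : 1 ≤ L := Nat.log_pos (by norm_num) hn
  set r := runsCount (BBWT w)
  have hr := hs.runsCount_BBWT_eq h0 (by omega) hfac
  have hr' := hs'.runsCount_BBWT_eq h0' (by omega) hfac'
  change r = _ at hr
  have hr1 : 1 ≤ r := by omega
  have hD : ∀ k, 1 ≤ k → prefixCount X k ≤ k * r := by
    intro k hk
    refine (hs.shiftSystem.prefixCount_le k).trans ?_
    rw [hr, Nat.mul_add]
    omega
  set lam := (blocks (periodicWord w) m s).toFinset.card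
  set lam' := (blocks (periodicWord (rot^[i] w)) m' s').toFinset.card
  have hlam : lam ≤ (L + 1) * (4 * r) := hs.card_toFinset_blocks_le_of_prefixCount_le hD
  have hc : ∀ k, 1 ≤ k → factorCount (periodicWord (rot^[i] w)) n k ≤ k * (r + lam) := by
    intro k hk
    rw [periodicWord_rot_iterate hne]
    refine (factorCount_shift_le (by omega)
      (fun j => by rw [← hw, periodicWord_mod]) i k).trans ?_
    refine (hs.factorCount_le h0 k).trans ?_
    rw [Nat.mul_add]
    exact Nat.add_le_add_right (hD k hk) _
  have hlam' : lam' ≤ (L + 1) * (2 + 3 * (r + lam)) :=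
    hs'.card_toFinset_blocks_le_of_factorCount_le h0' hc
  have hD' : ∀ k, 1 ≤ k → prefixCount X' k ≤ k * (r + lam + lam') := by
    intro k hk
    refine (hs'.prefixCount_rotationWords_le k).trans ?_
    rw [Nat.mul_add k (r + lam)]
    exact Nat.add_le_add_right (hc k hk) _
  have hJ := hs'.card_jumpSet_le (by omega) hD'
  rw [hr']
  have h1 : r + lam ≤ 9 * L * r := by
    calc r + lam ≤ L * r + (L + L) * (4 * r) := by
          gcongr
          · exact Nat.le_mul_of_pos_left _ hL
          · exact hlam.trans (by gcongr)
      _ = _ := by ring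
  have h2 : lam' ≤ 10 * L * (r + lam) := by
    calc lam' ≤ (L + L) * (2 * (r + lam) + 3 * (r + lam)) := hlam'.trans (by gcongr; omega)
      _ = _ := by ring
  have h3 : r + lam + lam' ≤ 99 * L ^ 2 * r := by
    calc r + lam + lam' ≤ L * (r + lam) + 10 * L * (r + lam) := by
          gcongr
          exact Nat.le_mul_of_pos_left _ hL
      _ = 11 * L * (r + lam) := by ring
      _ ≤ 11 * L * (9 * L * r) := by gcongr
      _ = _ := by ring
  have h4 : 1 ≤ L ^ 4 * r := Nat.mul_pos (by positivity) hr1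
  calc _ ≤ L ^ 4 * r + (L + 2 * L) * (6 * L * (99 * L ^ 2 * r)) := by
        refine Nat.add_le_add h4 (hJ.trans ?_)
        gcongr
        omega
    _ = _ := by ring

end Main

/-- there is a constant `C > 0` such that for every `n ≥ 2` and
all strings `w, w'` of length `n` that are cyclic rotations of each other,
`r_B(w') ≤ C · r_B(w) · (log₂ n)⁴`. -/
theorem stmt9 :
    ∃ C : ℝ, 0 < C ∧
      ∀ (β : Type) [LinearOrder β] (n : ℕ), 2 ≤ n →
        ∀ w w' : List β, w.length = n → (∃ i : ℕ, w' = rot^[i] w) →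
          (runsCount (BBWT w') : ℝ) ≤
            C * (runsCount (BBWT w) : ℝ) * (Real.logb 2 (n : ℝ)) ^ 4 := by
  refine ⟨1783, by norm_num, fun β _ n hn w w' hw ⟨i, hi⟩ => ?_⟩
  subst hi
  have h : (runsCount (BBWT (rot^[i] w)) : ℝ) ≤
      1783 * (Nat.log 2 n : ℝ) ^ 4 * runsCount (BBWT w) := by
    exact_mod_cast runsCount_BBWT_rot_le hn hw i
  refine h.trans ?_
  rw [mul_right_comm]
  gcongr
  exact Real.natLog_le_logb n 2
end

section
/- There is a constant C > 0 such that for every string w of length n ≥ 2, both r_B(w) ≤ C · r(w) · (log₂ n)⁴ and r(w) ≤ C · r_B(w) · (log₂ n)⁴ hold. -/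
/-! Basic definitions: strings as `List α`, rotations, runs, BWT, Lyndon
factorization, ω-order, bijective BWT, and Fibonacci words. -/

variable {α : Type*}

/-! ### Runs of lists -/

section Runs

variable {γ δ : Type*}

theorem runsCount_cons_cons [DecidableEq γ] (a b : γ) (t : List γ) :
    runsCount (a :: b :: t) = (if a = b then 0 else 1) + runsCount (b :: t) := rfl

theorem one_le_runsCount [DecidableEq γ] : ∀ {l : List γ}, l ≠ [] → 1 ≤ runsCount l
  | [_], _ => le_rfl
  | a :: b :: t, _ => by
    have := one_le_runsCount (l := b :: t) (by simp)
    rw [runsCount_cons_cons]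
    omega

theorem card_toFinset_le_runsCount [DecidableEq γ] :
    ∀ l : List γ, l.toFinset.card ≤ runsCount l
  | [] => by simp
  | [_] => by simp [runsCount]
  | a :: b :: t => by
    have ih := card_toFinset_le_runsCount (b :: t)
    rw [runsCount_cons_cons, List.toFinset_cons]
    split_ifs with h
    · subst h
      rw [Finset.insert_eq_of_mem (by simp)]
      omega
    · have := Finset.card_insert_le a (b :: t).toFinset
      omega

/-- In a list sorted by an antisymmetric relation equal symbols are contiguous. -/
theorem runsCount_le_card_toFinset [DecidableEq γ] {R : γ → γ → Prop}
    (hR : ∀ a b, R a b → R b a → a = b) :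
    ∀ l : List γ, l.Pairwise R → runsCount l ≤ l.toFinset.card
  | [], _ => by simp [runsCount]
  | [_], _ => by simp [runsCount]
  | a :: b :: t, hl => by
    have ih := runsCount_le_card_toFinset hR (b :: t) hl.of_cons
    rw [runsCount_cons_cons, List.toFinset_cons]
    split_ifs with h
    · subst h
      rw [Finset.insert_eq_of_mem (by simp)]
      omega
    · have ha : a ∉ (b :: t).toFinset := by
        intro hmem
        rw [List.mem_toFinset, List.mem_cons] at hmem
        rcases hmem with hmem | hmem
        · exact h hmem
        · rw [List.pairwise_cons] at hl
          exact h (hR _ _ (hl.1 b (by simp)) ((List.pairwise_cons.1 hl.2).1 a hmem))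
      rw [Finset.card_insert_of_notMem ha]
      omega

theorem runsCount_map_prod_le {ε : Type*} [DecidableEq γ] [DecidableEq δ]
    (f : ε → γ) (g : ε → δ) :
    ∀ s : List ε, s ≠ [] → runsCount (s.map fun x => (f x, g x)) + 1 ≤
      runsCount (s.map f) + runsCount (s.map g)
  | [_], _ => by simp [runsCount]
  | a :: b :: t, _ => by
    have ih := runsCount_map_prod_le f g (b :: t) (by simp)
    simp only [List.map_cons, runsCount_cons_cons, Prod.mk.injEq] at ih ⊢
    split_ifs <;> first | omega | tauto

theorem runsCount_le_card_filter [DecidableEq γ] (d : γ) :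
    ∀ l : List γ, runsCount l ≤ 1 +
      ((Finset.range (l.length - 1)).filter fun i => l.getD i d ≠ l.getD (i + 1) d).card
  | [] => by simp [runsCount]
  | [_] => by simp [runsCount]
  | a :: b :: t => by
    have ih := runsCount_le_card_filter d (b :: t)
    rw [runsCount_cons_cons]
    have e : (a :: b :: t).length - 1 = ((b :: t).length - 1) + 1 := by simp
    rw [e, Finset.range_eq_Ico, ← Finset.insert_Ico_add_one_left_eq_Ico (by omega),
      Finset.filter_insert]
    have hc : ((Finset.range ((b :: t).length - 1)).filter
          fun i => (b :: t).getD i d ≠ (b :: t).getD (i + 1) d).card ≤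
        ((Finset.Ico (0 + 1) ((b :: t).length - 1 + 1)).filter
          fun i => (a :: b :: t).getD i d ≠ (a :: b :: t).getD (i + 1) d).card := by
      refine Finset.card_le_card_of_injOn (fun i => i + 1) ?_ (fun x _ y _ h => by simpa using h)
      intro i hi
      simp only [Finset.coe_filter, Finset.mem_range, Set.mem_ofPred_eq, Finset.mem_Ico] at hi ⊢
      exact ⟨by omega, by simpa using hi.2⟩
    by_cases h : a = b
    · simp only [h, if_true, List.getD_cons_zero, List.getD_cons_succ, ne_eq, not_true, if_false]
      subst h
      simp only [List.getD_cons_succ, ne_eq] at hc ih ⊢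
      omega
    · rw [if_neg h, if_pos (by simpa using h), Finset.card_insert_of_notMem (by simp)]
      omega

end Runs

/-! ### Finite shift-invariant families of bi-infinite sequences -/

section Sequences

variable {β : Type*}

/-- The sequence `x` shifted by `t`. -/
def shiftSeq (x : ℤ → β) (t : ℤ) : ℤ → β := fun i => x (i + t)

/-- The length-`m` window of `x` at the origin. -/
def win (m : ℕ) (x : ℤ → β) : Fin m → β := fun j => x (j : ℕ)

theorem win_eq_iff {m : ℕ} {x y : ℤ → β} :
    win m x = win m y ↔ ∀ j : ℕ, j < m → x j = y j := by
  simp [funext_iff, win, Fin.forall_iff]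

/-- The right-infinite half of `x`, in lexicographic order. -/
def key (x : ℤ → β) : Lex (ℕ → β) := toLex fun i => x i

theorem key_eq_iff {x y : ℤ → β} : key x = key y ↔ ∀ i : ℕ, x i = y i := by
  unfold key
  rw [toLex_inj, funext_iff]

variable [LinearOrder β]

theorem key_lt_iff {x y : ℤ → β} :
    key x < key y ↔ ∃ i : ℕ, (∀ j : ℕ, j < i → x j = y j) ∧ x i < y i := Iff.rfl

theorem toLex_win_le {m : ℕ} {x y : ℤ → β} (h : key x ≤ key y) :
    toLex (win m x) ≤ toLex (win m y) := by
  rcases h.lt_or_eq with h | h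
  · obtain ⟨i, hi, hlt⟩ := key_lt_iff.1 h
    by_cases him : i < m
    · exact le_of_lt ⟨⟨i, him⟩, fun j hj => hi j hj, hlt⟩
    · exact le_of_eq (congrArg toLex (win_eq_iff.2 fun j hj => hi j (by omega)))
  · exact le_of_eq (congrArg toLex (win_eq_iff.2 fun j _ => key_eq_iff.1 h j))

/-- A sequence lying between two sequences with the same window shares this window. -/
theorem win_eq_of_le_of_le {m : ℕ} {x y z : ℤ → β} (hxy : key x ≤ key y) (hyz : key y ≤ key z)
    (h : win m x = win m z) : win m x = win m y := by
  have h1 := toLex_win_le (m := m) hxy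
  have h2 := toLex_win_le (m := m) hyz
  rw [← h] at h2
  exact toLex_inj.1 (le_antisymm h1 h2)

/-- The set of windows of length `m`. -/
def windows (s : List (ℤ → β)) (m : ℕ) : Finset (Fin m → β) := (s.map (win m)).toFinset

theorem mem_windows {s : List (ℤ → β)} {m : ℕ} {U : Fin m → β} :
    U ∈ windows s m ↔ ∃ x ∈ s, win m x = U := by
  simp [windows]

theorem win_mem_windows {s : List (ℤ → β)} {x : ℤ → β} (hx : x ∈ s) (m : ℕ) :
    win m x ∈ windows s m := mem_windows.2 ⟨x, hx, rfl⟩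

theorem windows_eq_of_perm {s s' : List (ℤ → β)} (h : s.Perm s') (m : ℕ) :
    windows s m = windows s' m :=
  List.toFinset_eq_of_perm _ _ (h.map _)

theorem card_windows_le (s : List (ℤ → β)) (m : ℕ) : (windows s m).card ≤ s.length :=
  (List.toFinset_card_le (s.map (win m))).trans_eq (List.length_map _)

theorem card_windows_succ_add_one_le {s : List (ℤ → β)} (hs : s ≠ [])
    (hsort : s.Pairwise fun x y => key x ≤ key y) (hinv : ∀ x ∈ s, ∀ t, shiftSeq x t ∈ s)
    (m : ℕ) :
    (windows s (m + 1)).card + 1 ≤ (windows s m).card + runsCount (s.map fun x => x (-1)) := by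
  have h1 : (windows s (m + 1)).card ≤
      (s.map fun x => (x (-1), win m x)).toFinset.card := by
    refine Finset.card_le_card_of_injOn (fun U => (U 0, fun j : Fin m => U j.succ)) ?_ ?_
    · intro U hU
      obtain ⟨x, hx, rfl⟩ := mem_windows.1 (Finset.mem_coe.1 hU)
      simp only [List.coe_toFinset, List.mem_map, Set.mem_ofPred_eq]
      refine ⟨shiftSeq x 1, hinv x hx 1, ?_⟩
      simp [win, shiftSeq, funext_iff]
    · intro U _ V _ h
      simp only [Prod.mk.injEq, funext_iff] at h
      funext j
      exact Fin.cases h.1 h.2 j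
  have h2 := card_toFinset_le_runsCount (s.map fun x => (x (-1), win m x))
  have h3 := runsCount_map_prod_le (fun x : ℤ → β => x (-1)) (win m) s hs
  have h4 : runsCount (s.map (win m)) ≤ (windows s m).card := by
    refine runsCount_le_card_toFinset (R := fun U V => toLex U ≤ toLex V)
      (fun U V h h' => toLex_inj.1 (le_antisymm h h')) _ ?_
    rw [List.pairwise_map]
    exact hsort.imp fun h => toLex_win_le h
  omega

theorem card_windows_le_mul_runsCount {s : List (ℤ → β)} (hs : s ≠ [])
    (hsort : s.Pairwise fun x y => key x ≤ key y) (hinv : ∀ x ∈ s, ∀ t, shiftSeq x t ∈ s)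
    (m : ℕ) :
    (windows s m).card ≤ 1 + m * (runsCount (s.map fun x => x (-1)) - 1) := by
  have hr := one_le_runsCount (l := s.map fun x => x (-1)) (by simpa using hs)
  induction m with
  | zero =>
    simpa using Finset.card_le_one_of_subsingleton (windows s 0)
  | succ m ih =>
    have := card_windows_succ_add_one_le hs hsort hinv m
    rw [Nat.succ_mul]
    omega

/-- The number of factors of length `m` is at most `m` times the number of runs. -/
theorem card_windows_le_mul {s : List (ℤ → β)} (hs : s ≠ [])
    (hsort : s.Pairwise fun x y => key x ≤ key y) (hinv : ∀ x ∈ s, ∀ t, shiftSeq x t ∈ s)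
    {m : ℕ} (hm : 0 < m) :
    (windows s m).card ≤ m * runsCount (s.map fun x => x (-1)) := by
  have h := card_windows_le_mul_runsCount hs hsort hinv m
  obtain ⟨r, hr⟩ := Nat.exists_eq_add_of_le
    (one_le_runsCount (l := s.map fun x => x (-1)) (by simpa using hs))
  rw [hr] at h ⊢
  rw [Nat.add_sub_cancel_left] at h
  rw [Nat.mul_add]
  omega

/-- A sequence of positive integers starting at `M` is halved at most `log₂ M` times. -/
theorem card_halvings_le (N : ℕ → ℕ) (hmono : ∀ k, N (k + 1) ≤ N k) (hpos : ∀ k, 0 < N k)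
    (L : ℕ) :
    ((Finset.range L).filter fun k => 2 * N (k + 1) ≤ N k).card ≤ Nat.log 2 (N 0) := by
  have key : ∀ L, 2 ^ ((Finset.range L).filter fun k => 2 * N (k + 1) ≤ N k).card * N L ≤ N 0 := by
    intro L
    induction L with
    | zero => simp
    | succ L ih =>
      rw [Finset.range_add_one, Finset.filter_insert]
      split_ifs with h
      · rw [Finset.card_insert_of_notMem (by simp), pow_succ, mul_assoc]
        exact (Nat.mul_le_mul_left _ h).trans ih
      · exact (Nat.mul_le_mul_left _ (hmono L)).trans ih
  refine Nat.le_log_of_pow_le (by norm_num) ?_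
  exact (Nat.le_mul_of_pos_right _ (hpos L)).trans (key L)

/-- The number of windows in `A` agreeing with `U` on the `k` symbols preceding index `L`. -/
def leftCount {m : ℕ} (A : Finset (Fin m → β)) (L : ℕ) (U : Fin m → β) (k : ℕ) : ℕ :=
  (A.filter fun V => ∀ j : Fin m, L ≤ j + k → (j : ℕ) < L → V j = U j).card

theorem leftCount_zero {m : ℕ} (A : Finset (Fin m → β)) (L : ℕ) (U : Fin m → β) :
    leftCount A L U 0 = A.card := by
  unfold leftCount
  rw [Finset.filter_true_of_mem]
  intro V _ j h1 h2
  omega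

theorem leftCount_succ_le {m : ℕ} (A : Finset (Fin m → β)) (L : ℕ) (U : Fin m → β) (k : ℕ) :
    leftCount A L U (k + 1) ≤ leftCount A L U k :=
  Finset.card_le_card (Finset.monotone_filter_right _ fun _ _ h j h1 h2 => h j (by omega) h2)

theorem leftCount_pos {m : ℕ} {A : Finset (Fin m → β)} {U : Fin m → β} (hU : U ∈ A) (L k : ℕ) :
    0 < leftCount A L U k :=
  Finset.card_pos.2 ⟨U, Finset.mem_filter.2 ⟨hU, fun _ _ _ => rfl⟩⟩

/-- Two windows whose left contexts branch after exactly `k` symbols cannot both keep more than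
half of the windows sharing these `k` symbols. -/
theorem leftCount_branch {m : ℕ} (A : Finset (Fin m → β)) {L k : ℕ} {U V : Fin m → β}
    (hUV : ∀ j : Fin m, L ≤ j + k → (j : ℕ) < L → U j = V j) (j₀ : Fin m)
    (hj₀ : (j₀ : ℕ) + k + 1 = L) (hne : U j₀ ≠ V j₀) :
    2 * leftCount A L U (k + 1) ≤ leftCount A L U k ∨
      2 * leftCount A L V (k + 1) ≤ leftCount A L V k := by
  have e : leftCount A L U k = leftCount A L V k := by
    unfold leftCount
    congr 1
    refine Finset.filter_congr fun W _ => forall_congr' fun j => ?_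
    refine imp_congr_right fun h1 => imp_congr_right fun h2 => ?_
    rw [hUV j h1 h2]
  have hle : leftCount A L U (k + 1) + leftCount A L V (k + 1) ≤ leftCount A L U k := by
    unfold leftCount
    rw [← Finset.card_union_of_disjoint]
    · refine Finset.card_le_card fun W hW => ?_
      rw [Finset.mem_union, Finset.mem_filter, Finset.mem_filter] at hW
      rw [Finset.mem_filter]
      rcases hW with ⟨hA, hW⟩ | ⟨hA, hW⟩
      · exact ⟨hA, fun j h1 h2 => hW j (by omega) h2⟩
      · exact ⟨hA, fun j h1 h2 => (hW j (by omega) h2).trans (hUV j h1 h2).symm⟩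
    · rw [Finset.disjoint_filter]
      intro W _ h1 h2
      exact hne ((h1 j₀ (by omega) (by omega)).symm.trans (h2 j₀ (by omega) (by omega)))
  omega

end Sequences

section RunBound

variable {β : Type*} [LinearOrder β]

/-- The pairs of neighbours in a sorted list preceded by distinct symbols whose common prefix has
length `ℓ` with `L ≤ ℓ + 1 < 2 * L`. -/
def branchings (v : ℕ → ℤ → β) (n L : ℕ) : Set ℕ :=
  {i | i + 1 < n ∧ v i (-1) ≠ v (i + 1) (-1) ∧ ∃ l : ℕ, L ≤ l + 1 ∧ l + 1 < 2 * L ∧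
    (∀ j : ℕ, j < l → v i j = v (i + 1) j) ∧ v i l < v (i + 1) l}

theorem eq_of_win_eq_of_mem_branchings {v : ℕ → ℤ → β} {n L : ℕ}
    (hv : ∀ i j, i ≤ j → j < n → key (v i) ≤ key (v j)) {b : ℕ} (hb : b ≤ 1) {i i' : ℕ}
    (hi : i ∈ branchings v n L) (hi' : i' ∈ branchings v n L)
    (h : win (2 * L) (v (i + b)) = win (2 * L) (v (i' + b))) : i = i' := by
  wlog hlt : i < i' generalizing i i' with H
  · rcases lt_trichotomy i i' with h1 | h1 | h1
    · exact H hi hi' h h1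
    · exact h1
    · exact (H hi' hi h.symm h1).symm
  exfalso
  have contra : ∀ {i}, i ∈ branchings v n L → win (2 * L) (v i) ≠ win (2 * L) (v (i + 1)) := by
    rintro i ⟨-, -, l, -, h2, -, h4⟩ h
    exact h4.ne (win_eq_iff.1 h l (by omega))
  have h1 := hi.1
  have h2 := hi'.1
  rcases Nat.le_one_iff_eq_zero_or_eq_one.1 hb with rfl | rfl
  · exact contra hi (win_eq_of_le_of_le (hv _ _ (by omega) (by omega))
      (hv _ _ (by omega) (by omega)) h)
  · refine contra hi' ?_
    rw [← h]
    exact (win_eq_of_le_of_le (hv _ _ (by omega) (by omega))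
      (hv i' (i' + 1) (by omega) (by omega)) h).symm

open Classical in
theorem card_branchings_mul_le {s : List (ℤ → β)} (hinv : ∀ x ∈ s, ∀ t, shiftSeq x t ∈ s)
    {v : ℕ → ℤ → β} {n L : ℕ} (hmem : ∀ i, i < n → v i ∈ s)
    (hv : ∀ i j, i ≤ j → j < n → key (v i) ≤ key (v j)) (I : Finset ℕ)
    (hI : ∀ i ∈ I, i ∈ branchings v n L) :
    I.card * L ≤ 2 * ((windows s (3 * L)).card * Nat.log 2 (windows s (3 * L)).card) := by
  set A := windows s (3 * L) with hA
  let f : ℕ → ℕ → Fin (3 * L) → β := fun i k => win (3 * L) (shiftSeq (v i) ((k : ℤ) - L))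
  have hf : ∀ i k, ∀ j : Fin (3 * L), f i k j = v i ((j : ℤ) + (k - L)) := fun _ _ _ => rfl
  let light : Finset (Σ _ : Fin (3 * L) → β, ℕ) :=
    A.sigma fun U => (Finset.range L).filter fun k =>
      2 * leftCount A L U (k + 1) ≤ leftCount A L U k
  have hlight : light.card ≤ A.card * Nat.log 2 A.card := by
    rw [Finset.card_sigma]
    refine Finset.sum_le_card_nsmul _ _ _ fun U hU => ?_
    rw [← leftCount_zero A L U]
    exact card_halvings_le _ (leftCount_succ_le A L U) (leftCount_pos hU L) L
  let P : ℕ → Finset (ℕ × ℕ) := fun b => (I ×ˢ Finset.range L).filter fun p =>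
    2 * leftCount A L (f (p.1 + b) p.2) (p.2 + 1) ≤ leftCount A L (f (p.1 + b) p.2) p.2
  have hP : ∀ b ≤ 1, (P b).card ≤ light.card := by
    intro b hb
    refine Finset.card_le_card_of_injOn (fun p => ⟨f (p.1 + b) p.2, p.2⟩) ?_ ?_
    · rintro ⟨i, k⟩ hp
      obtain ⟨hp, hk⟩ := Finset.mem_filter.1 (Finset.mem_coe.1 hp)
      obtain ⟨h1, h2⟩ := Finset.mem_product.1 hp
      have := (hI i h1).1
      exact Finset.mem_coe.2 (Finset.mem_sigma.2
        ⟨win_mem_windows (hinv _ (hmem _ (by dsimp only; omega)) _) _,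
          Finset.mem_filter.2 ⟨h2, hk⟩⟩)
    · rintro ⟨i, k⟩ hp ⟨i', k'⟩ hp' h
      obtain ⟨hp, -⟩ := Finset.mem_filter.1 (Finset.mem_coe.1 hp)
      obtain ⟨hp', -⟩ := Finset.mem_filter.1 (Finset.mem_coe.1 hp')
      obtain ⟨h1, hk⟩ := Finset.mem_product.1 hp
      obtain ⟨h2, -⟩ := Finset.mem_product.1 hp'
      simp only [Sigma.mk.injEq, heq_eq_eq] at h
      obtain ⟨h, rfl⟩ := h
      rw [Finset.mem_range] at hk
      dsimp only at hk h1 h2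
      rw [Prod.mk.injEq]
      refine ⟨eq_of_win_eq_of_mem_branchings hv hb (hI i h1) (hI i' h2) ?_, rfl⟩
      refine win_eq_iff.2 fun j hj => ?_
      have := congrFun h ⟨j + (L - k), by omega⟩
      rw [hf, hf] at this
      convert this using 2 <;> push_cast [Nat.cast_sub hk.le] <;> ring
  have hcover : I ×ˢ Finset.range L ⊆ P 0 ∪ P 1 := by
    rintro ⟨i, k⟩ hp
    obtain ⟨h1, hk⟩ := Finset.mem_product.1 hp
    rw [Finset.mem_range] at hk
    dsimp only at hk h1
    obtain ⟨h3, h4, l, h5, h6, h7, h8⟩ := hI i h1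
    rw [Finset.mem_union, Finset.mem_filter, Finset.mem_filter, ← and_or_left]
    refine ⟨hp, ?_⟩
    refine leftCount_branch A (fun j hj1 hj2 => ?_) ⟨L - k - 1, by omega⟩
      (by dsimp only; omega) ?_
    · rw [hf, hf]
      have := h7 (j + k - L) (by omega)
      convert this using 2 <;> push_cast [Nat.cast_sub hj1] <;> ring
    · rw [hf, hf]
      have e : ((L - k - 1 : ℕ) : ℤ) + (k - L) = -1 := by omega
      dsimp only
      rw [e]
      exact h4
  calc I.card * L = (I ×ˢ Finset.range L).card := by simp
    _ ≤ (P 0).card + (P 1).card := (Finset.card_le_card hcover).trans (Finset.card_union_le _ _)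
    _ ≤ light.card + light.card := Nat.add_le_add (hP 0 (by norm_num)) (hP 1 le_rfl)
    _ ≤ _ := by omega

end RunBound

section Periodic

variable {β : Type*}

theorem periodic_mul {x : ℤ → β} {p : ℕ} (hx : ∀ i, x (i + p) = x i) (k i : ℤ) :
    x (i + p * k) = x i := by
  induction k generalizing i with
  | zero => simp
  | succ k ih => rw [mul_add, mul_one, ← add_assoc, hx, ih]
  | pred k ih => rw [← hx, mul_sub, mul_one, add_assoc, sub_add_cancel, ih]

theorem exists_lt_eq_add_mul {p : ℕ} (hp : 0 < p) (i : ℤ) :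
    ∃ r : ℕ, r < p ∧ ∃ k : ℤ, i = r + p * k := by
  obtain ⟨r, hr⟩ := Int.eq_ofNat_of_zero_le
    (Int.emod_nonneg i (show (p : ℤ) ≠ 0 by exact_mod_cast hp.ne'))
  have hrp := Int.emod_lt_of_pos i (show (0 : ℤ) < p by exact_mod_cast hp)
  have := Int.emod_add_mul_ediv i p
  exact ⟨r, by omega, i / p, by omega⟩

/-- Sequences with periods `p` and `q` which agree on `p + q` symbols are equal. -/
theorem eq_of_periodic {x y : ℤ → β} {p q : ℕ} (hp : 0 < p) (hq : 0 < q)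
    (hx : ∀ i, x (i + p) = x i) (hy : ∀ i, y (i + q) = y i)
    (h : ∀ i : ℕ, i < p + q → x i = y i) : x = y := by
  have hxq : ∀ i, x (i + q) = x i := by
    intro i
    obtain ⟨r, hr, k, rfl⟩ := exists_lt_eq_add_mul hp i
    rw [periodic_mul hx, add_right_comm, periodic_mul hx]
    have h1 := h (r + q) (by omega)
    push_cast at h1
    rw [h1, hy, h r (by omega)]
  funext i
  obtain ⟨r, hr, k, rfl⟩ := exists_lt_eq_add_mul hq i
  rw [periodic_mul hxq, periodic_mul hy, h r (by omega)]

end Periodic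

section RunBound

variable {β : Type*} [LinearOrder β]

/-- The number of runs is bounded by the substring complexity up to two logarithmic factors. -/
theorem runsCount_le_of_card_windows_le [Inhabited β] {s : List (ℤ → β)} {n δ : ℕ}
    (hn : s.length ≤ n) (hsort : s.Pairwise fun x y => key x ≤ key y)
    (hinv : ∀ x ∈ s, ∀ t, shiftSeq x t ∈ s)
    (hper : ∀ x ∈ s, ∃ p : ℕ, 0 < p ∧ p ≤ n ∧ ∀ i, x (i + p) = x i)
    (hδ : ∀ m, 0 < m → (windows s m).card ≤ m * δ) :
    runsCount (s.map fun x => x (-1)) ≤ 1 + (Nat.log 2 n + 2) * (6 * δ * Nat.log 2 n) := by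
  classical
  refine (runsCount_le_card_filter default _).trans (Nat.add_le_add_left ?_ 1)
  rw [List.length_map]
  let v : ℕ → ℤ → β := fun i => s.getD i default
  have hv : ∀ {i} (h : i < s.length), v i = s[i] := fun h => List.getD_eq_getElem _ _ h
  have hmem : ∀ i, i < s.length → v i ∈ s := fun i h => by rw [hv h]; exact List.getElem_mem h
  have hmono : ∀ i j, i ≤ j → j < s.length → key (v i) ≤ key (v j) := by
    intro i j hij hj
    rcases hij.eq_or_lt with rfl | hij
    · exact le_rfl
    · rw [hv (hij.trans hj), hv hj]
      exact List.pairwise_iff_getElem.1 hsort i j _ _ hij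
  let B : ℕ → Finset ℕ := fun a =>
    (Finset.range s.length).filter fun i => i ∈ branchings v s.length (2 ^ a)
  have hB : ∀ a, (B a).card ≤ 6 * δ * Nat.log 2 n := by
    intro a
    have h1 := card_branchings_mul_le hinv hmem hmono (B a) fun i hi => (Finset.mem_filter.1 hi).2
    have h2 := hδ (3 * 2 ^ a) (by positivity)
    have h3 : Nat.log 2 (windows s (3 * 2 ^ a)).card ≤ Nat.log 2 n :=
      Nat.log_mono_right ((card_windows_le _ _).trans hn)
    refine Nat.le_of_mul_le_mul_right (h1.trans ?_) (show 0 < 2 ^ a by positivity)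
    calc 2 * ((windows s (3 * 2 ^ a)).card * Nat.log 2 (windows s (3 * 2 ^ a)).card)
        ≤ 2 * ((3 * 2 ^ a * δ) * Nat.log 2 n) :=
          Nat.mul_le_mul_left _ (Nat.mul_le_mul h2 h3)
      _ = 6 * δ * Nat.log 2 n * 2 ^ a := by ring
  have hsub : ((Finset.range (s.length - 1)).filter fun i =>
      (s.map fun x => x (-1)).getD i default ≠ (s.map fun x => x (-1)).getD (i + 1) default) ⊆
      (Finset.range (Nat.log 2 n + 2)).biUnion B := by
    intro i hi
    rw [Finset.mem_filter, Finset.mem_range] at hi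
    obtain ⟨hi, hne⟩ := hi
    have hi0 : i < s.length := by omega
    have hi1 : i + 1 < s.length := by omega
    rw [List.getD_eq_getElem _ _ (by simpa using hi0), List.getD_eq_getElem _ _ (by simpa using hi1),
      List.getElem_map, List.getElem_map, ← hv hi0, ← hv hi1] at hne
    have hle := hmono i (i + 1) (by omega) hi1
    obtain ⟨p, hp, hpn, hpx⟩ := hper _ (hmem i hi0)
    obtain ⟨q, hq, hqn, hqx⟩ := hper _ (hmem (i + 1) hi1)
    have hlt : key (v i) < key (v (i + 1)) := by
      refine lt_of_le_of_ne hle fun h => hne ?_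
      exact congrFun (eq_of_periodic hp hq hpx hqx fun j _ => key_eq_iff.1 h j) (-1)
    obtain ⟨l, hl, hll⟩ := key_lt_iff.1 hlt
    have hl2 : l < p + q := by
      by_contra hc
      refine hne ?_
      exact congrFun (eq_of_periodic hp hq hpx hqx fun j hj => hl j (by omega)) (-1)
    rw [Finset.mem_biUnion]
    refine ⟨Nat.log 2 (l + 1), ?_, ?_⟩
    · rw [Finset.mem_range]
      have h1 : Nat.log 2 (l + 1) ≤ Nat.log 2 (n * 2) := Nat.log_mono_right (by omega)
      rw [Nat.log_mul_base (by norm_num) (by omega)] at h1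
      omega
    · rw [Finset.mem_filter, Finset.mem_range]
      refine ⟨hi0, hi1, hne, l, Nat.pow_log_le_self 2 (by omega), ?_, hl, hll⟩
      have := Nat.lt_pow_succ_log_self (b := 2) (by norm_num) (l + 1)
      rw [pow_succ] at this
      omega
  refine (Finset.card_le_card hsub).trans ?_
  refine (Finset.card_biUnion_le_card_mul _ _ _ fun a _ => hB a).trans ?_
  rw [Finset.card_range]

end RunBound

/-! ### From words to periodic sequences -/

section Words

variable {β : Type*} [Inhabited β]

/-- The bi-infinite periodic sequence with period `l`. -/
def cyc (l : List β) (i : ℤ) : β := l.getD (i % l.length).toNat default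

theorem cyc_natCast {l : List β} {i : ℕ} (hi : i < l.length) : cyc l i = l[i] := by
  have e : ((i : ℤ) % l.length).toNat = i := by
    rw [Int.emod_eq_of_lt (by omega) (by omega), Int.toNat_natCast]
  rw [cyc, e, List.getD_eq_getElem _ _ hi]

theorem cyc_add_length (l : List β) (i : ℤ) : cyc l (i + l.length) = cyc l i := by
  simp [cyc]

theorem cyc_add_mul_length (l : List β) (i k : ℤ) : cyc l (i + l.length * k) = cyc l i :=
  periodic_mul (cyc_add_length l) k i

theorem shiftSeq_cyc_add_length (l : List β) (t i : ℤ) :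
    shiftSeq (cyc l) t (i + l.length) = shiftSeq (cyc l) t i := by
  simp only [shiftSeq]
  rw [add_right_comm, cyc_add_length]

theorem eq_cyc {l : List β} (hl : l ≠ []) {x : ℤ → β} (hx : ∀ i, x (i + l.length) = x i)
    (h : ∀ (i : ℕ) (hi : i < l.length), x i = l[i]) : x = cyc l := by
  funext i
  obtain ⟨r, hr, k, rfl⟩ := exists_lt_eq_add_mul (List.length_pos_iff.2 hl) i
  rw [periodic_mul hx, cyc_add_mul_length, h r hr, cyc_natCast hr]

theorem cyc_rotate (l : List β) (t : ℕ) : cyc (l.rotate t) = shiftSeq (cyc l) t := by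
  by_cases hl : l = []
  · subst hl
    funext i
    simp [cyc, shiftSeq]
  · refine (eq_cyc (by simpa using hl) (fun i => ?_) fun i hi => ?_).symm
    · rw [List.length_rotate, shiftSeq_cyc_add_length]
    · rw [List.length_rotate] at hi
      have hpos := List.length_pos_iff.2 hl
      rw [List.getElem_rotate, ← cyc_natCast (Nat.mod_lt _ hpos)]
      simp only [shiftSeq, cyc]
      push_cast
      rw [Int.emod_emod]

theorem length_listPow {β : Type*} (x : List β) (k : ℕ) : (listPow x k).length = k * x.length := by
  induction k with
  | zero => simp [listPow]
  | succ k ih => rw [listPow, List.length_append, ih]; ring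

theorem getElem_listPow (x : List β) (k i : ℕ) (hi : i < (listPow x k).length) :
    (listPow x k)[i] = cyc x i := by
  induction k generalizing i with
  | zero => simp [listPow] at hi
  | succ k ih =>
    simp only [listPow]
    rw [List.getElem_append]
    split_ifs with h
    · rw [cyc_natCast h]
    · rw [ih]
      rw [Nat.cast_sub (by omega), ← cyc_add_length, sub_add_cancel]

theorem cyc_listPow {x : List β} (hx : x ≠ []) {k : ℕ} (hk : 0 < k) :
    cyc (listPow x k) = cyc x := by
  have hpos := List.length_pos_iff.2 hx
  refine (eq_cyc ?_ (fun i => ?_) fun i hi => (getElem_listPow x k i hi).symm).symm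
  · rw [← List.length_pos_iff, length_listPow]
    positivity
  · rw [length_listPow, Nat.cast_mul, mul_comm, cyc_add_mul_length]

theorem rot_iterate {β : Type*} (x : List β) (i : ℕ) : rot^[i] x = x.rotate i := by
  induction i with
  | zero => simp
  | succ i ih =>
    have e : ∀ y : List β, rot y = y.rotate 1 := by
      rintro (_ | ⟨a, y⟩) <;> simp [rot]
    rw [Function.iterate_succ_apply', ih, e, List.rotate_rotate]

theorem mem_map_cyc_rotations {x : List β} (hx : x ≠ []) {y : ℤ → β} :
    y ∈ (rotations x).map cyc ↔ ∃ t : ℤ, y = shiftSeq (cyc x) t := by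
  simp only [rotations, List.mem_map, List.mem_range, exists_exists_and_eq_and, rot_iterate,
    cyc_rotate]
  constructor
  · rintro ⟨i, -, rfl⟩
    exact ⟨i, rfl⟩
  · rintro ⟨t, rfl⟩
    obtain ⟨r, hr, k, rfl⟩ := exists_lt_eq_add_mul (List.length_pos_iff.2 hx) t
    refine ⟨r, hr, ?_⟩
    funext i
    simp only [shiftSeq]
    rw [← add_assoc, cyc_add_mul_length]

theorem getLast?_eq_cyc {l : List β} (hl : l ≠ []) : l.getLast? = some (cyc l (-1)) := by
  have hpos := List.length_pos_iff.2 hl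
  rw [← cyc_add_length, List.getLast?_eq_getElem?, List.getElem?_eq_getElem (by omega)]
  have e : (-1 + l.length : ℤ) = ((l.length - 1 : ℕ) : ℤ) := by omega
  rw [e, cyc_natCast (by omega)]

/-- The conjugates of the words in `F`, as periodic sequences. -/
def conjugates (F : List (List β)) : List (ℤ → β) := ((F.map rotations).flatten).map cyc

theorem mem_conjugates {F : List (List β)} (hF : ∀ x ∈ F, x ≠ []) {y : ℤ → β} :
    y ∈ conjugates F ↔ ∃ x ∈ F, ∃ t : ℤ, y = shiftSeq (cyc x) t := by
  unfold conjugates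
  rw [List.map_flatten, List.mem_flatten]
  simp only [List.map_map, List.mem_map, Function.comp_apply, exists_exists_and_eq_and]
  refine exists_congr fun x => and_congr_right fun hx => ?_
  rw [← mem_map_cyc_rotations (hF x hx), List.mem_map]

theorem length_rotations {β : Type*} (x : List β) : (rotations x).length = x.length := by
  simp [rotations]

theorem length_conjugates (F : List (List β)) : (conjugates F).length = F.flatten.length := by
  simp [conjugates, List.length_flatten, Function.comp_def, length_rotations]

theorem length_of_mem_rotations {β : Type*} {x y : List β} (h : y ∈ rotations x) :
    y.length = x.length := by
  simp only [rotations, List.mem_map, rot_iterate] at h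
  obtain ⟨i, -, rfl⟩ := h
  exact List.length_rotate _ _

theorem shiftSeq_mem_of_perm_conjugates {F : List (List β)} {s : List (ℤ → β)} (hF : ∀ x ∈ F, x ≠ [])
    (hs : s.Perm (conjugates F)) {x : ℤ → β} (hx : x ∈ s) (t : ℤ) : shiftSeq x t ∈ s := by
  rw [hs.mem_iff, mem_conjugates hF] at hx ⊢
  obtain ⟨y, hy, u, rfl⟩ := hx
  refine ⟨y, hy, t + u, ?_⟩
  funext i
  simp only [shiftSeq, add_assoc]

variable [LinearOrder β]

theorem key_cyc_lt {l l' : List β} (hlen : l.length = l'.length) (h : l < l') :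
    key (cyc l) < key (cyc l') := by
  rcases List.lt_iff_exists.1 h with h | ⟨i, h1, h2, h3, h4⟩
  · omega
  · refine key_lt_iff.2 ⟨i, fun j hj => ?_, ?_⟩
    · rw [cyc_natCast (hj.trans h1), cyc_natCast (hj.trans h2), h3 j hj]
    · rwa [cyc_natCast h1, cyc_natCast h2]

theorem le_iff_key_cyc_le {l l' : List β} (hlen : l.length = l'.length) :
    l ≤ l' ↔ key (cyc l) ≤ key (cyc l') := by
  constructor
  · intro h
    rcases h.lt_or_eq with h | rfl
    · exact (key_cyc_lt hlen h).le
    · exact le_rfl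
  · intro h
    by_contra hc
    exact absurd h (not_le.2 (key_cyc_lt hlen.symm (not_le.1 hc)))

theorem omegaLE_iff_key_cyc_le {l l' : List β} (hl : l ≠ []) (hl' : l' ≠ []) :
    omegaLE l l' ↔ key (cyc l) ≤ key (cyc l') := by
  unfold omegaLE
  rw [le_iff_key_cyc_le (by simp only [length_listPow]; ring),
    cyc_listPow hl (List.length_pos_iff.2 hl'), cyc_listPow hl' (List.length_pos_iff.2 hl)]

theorem exists_sorted_of_insertionSort (r : List β → List β → Prop) [DecidableRel r]
    (l : List (List β)) (hne : ∀ a ∈ l, a ≠ [])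
    (hr : ∀ a ∈ l, ∀ b ∈ l, r a b ↔ key (cyc a) ≤ key (cyc b)) :
    ∃ s : List (ℤ → β), s.Perm (l.map cyc) ∧ (s.Pairwise fun x y => key x ≤ key y) ∧
      (l.insertionSort r).filterMap List.getLast? = s.map fun x => x (-1) := by
  classical
  have hp := List.perm_insertionSort r l
  refine ⟨(l.insertionSort r).map cyc, hp.map _, ?_, ?_⟩
  · rw [List.map_insertionSort r (fun x y => key x ≤ key y) cyc l hr]
    have : Std.Total fun x y : ℤ → β => key x ≤ key y := ⟨fun x y => le_total _ _⟩
    have : IsTrans (ℤ → β) fun x y => key x ≤ key y := ⟨fun x y z => le_trans⟩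
    exact List.pairwise_insertionSort _ _
  · rw [List.map_map, ← List.filterMap_eq_map]
    refine List.filterMap_congr fun a ha => ?_
    exact getLast?_eq_cyc (hne a (hp.mem_iff.1 ha))

theorem exists_sorted_bwt {w : List β} (hw : w ≠ []) :
    ∃ s : List (ℤ → β), s.Perm (conjugates [w]) ∧ (s.Pairwise fun x y => key x ≤ key y) ∧
      BWT w = s.map fun x => x (-1) := by
  have e : conjugates [w] = (rotations w).map cyc := by simp [conjugates]
  rw [e]
  refine exists_sorted_of_insertionSort _ _ (fun a ha => ?_) fun a ha b hb => ?_
  · rw [← List.length_pos_iff, length_of_mem_rotations ha]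
    exact List.length_pos_iff.2 hw
  · exact le_iff_key_cyc_le ((length_of_mem_rotations ha).trans (length_of_mem_rotations hb).symm)

theorem exists_sorted_bbwt {w : List β} (hF : ∀ x ∈ lyndonFactorization w, x ≠ []) :
    ∃ s : List (ℤ → β), s.Perm (conjugates (lyndonFactorization w)) ∧
      (s.Pairwise fun x y => key x ≤ key y) ∧ BBWT w = s.map fun x => x (-1) := by
  have hne : ∀ a ∈ ((lyndonFactorization w).map rotations).flatten, a ≠ [] := by
    intro a ha
    rw [List.mem_flatten] at ha
    obtain ⟨m, hm, ha⟩ := ha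
    obtain ⟨x, hx, rfl⟩ := List.mem_map.1 hm
    rw [← List.length_pos_iff, length_of_mem_rotations ha]
    exact List.length_pos_iff.2 (hF x hx)
  exact exists_sorted_of_insertionSort _ _ hne fun a ha b hb =>
    omegaLE_iff_key_cyc_le (hne a ha) (hne b hb)

section Bounds

variable {F : List (List β)} {s : List (ℤ → β)}

theorem card_windows_conjugates_le (hF : ∀ x ∈ F, x ≠ []) (hne : F ≠ [])
    (hs : s.Perm (conjugates F)) (hsort : s.Pairwise fun x y => key x ≤ key y)
    {m : ℕ} (hm : 0 < m) :
    (windows (conjugates F) m).card ≤ m * runsCount (s.map fun x => x (-1)) := by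
  rw [← windows_eq_of_perm hs]
  refine card_windows_le_mul ?_ hsort (fun x hx t => shiftSeq_mem_of_perm_conjugates hF hs hx t) hm
  obtain ⟨x, hx⟩ := List.exists_mem_of_ne_nil F hne
  exact List.ne_nil_of_mem (hs.mem_iff.2 ((mem_conjugates hF).2 ⟨x, hx, 0, rfl⟩))

theorem runsCount_le_of_card_windows_conjugates_le (hF : ∀ x ∈ F, x ≠ [])
    (hs : s.Perm (conjugates F)) (hsort : s.Pairwise fun x y => key x ≤ key y) {δ : ℕ}
    (hδ : ∀ m, 0 < m → (windows (conjugates F) m).card ≤ m * δ) :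
    runsCount (s.map fun x => x (-1)) ≤
      1 + (Nat.log 2 F.flatten.length + 2) * (6 * δ * Nat.log 2 F.flatten.length) := by
  refine runsCount_le_of_card_windows_le ?_ hsort
    (fun x hx t => shiftSeq_mem_of_perm_conjugates hF hs hx t) ?_ ?_
  · rw [hs.length_eq, length_conjugates]
  · intro x hx
    rw [hs.mem_iff, mem_conjugates hF] at hx
    obtain ⟨y, hy, u, rfl⟩ := hx
    refine ⟨y.length, List.length_pos_iff.2 (hF y hy), ?_, shiftSeq_cyc_add_length y u⟩
    rw [List.length_flatten]
    exact List.le_sum_of_mem (List.mem_map_of_mem hy)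
  · intro m hm
    rw [windows_eq_of_perm hs]
    exact hδ m hm

end Bounds

end Words

/-! ### Lyndon factorization -/

section Lyndon

variable {β : Type*} [LinearOrder β]

theorem append_lt_append_of_not_prefix_of_lt {a b : List β} (h : a < b) (hp : ¬ a <+: b)
    (c d : List β) : a ++ c < b ++ d := by
  induction a generalizing b with
  | nil => exact absurd ⟨b, rfl⟩ hp
  | cons x a ih =>
    cases b with
    | nil => exact absurd h (List.not_lt_nil _)
    | cons y b =>
      rw [List.cons_append, List.cons_append, List.cons_lt_cons_iff]
      rcases List.cons_lt_cons_iff.1 h with h1 | ⟨h1, h2⟩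
      · exact Or.inl h1
      · subst h1
        exact Or.inr ⟨rfl, ih h2 fun h3 => hp ((List.prefix_cons_inj x).2 h3)⟩

theorem append_lt_append_of_lt_of_length_eq {a b : List β} (h : a < b)
    (hl : a.length = b.length) (c d : List β) : a ++ c < b ++ d :=
  append_lt_append_of_not_prefix_of_lt h (fun hp => h.ne (hp.eq_of_length hl)) c d

theorem append_lt_append_left_iff {a b c : List β} : c ++ a < c ++ b ↔ a < b := by
  induction c with
  | nil => rfl
  | cons x c ih => simp [ih]

theorem IsLyndon.lt_rotate {x : List β} (hx : IsLyndon x) {p : ℕ} (h0 : 0 < p)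
    (hp : p < x.length) : x < x.drop p ++ x.take p := by
  rw [← List.rotate_eq_drop_append_take hp.le, ← rot_iterate]
  exact hx.2 p hp h0

theorem IsLyndon.lt_drop {x : List β} (hx : IsLyndon x) {p : ℕ} (h0 : 0 < p)
    (hp : p < x.length) : x < x.drop p := by
  by_contra hc
  have hne : x.drop p ≠ x := fun h => by
    have := congrArg List.length h
    rw [List.length_drop] at this
    omega
  have hlt : x.drop p < x := lt_of_le_of_ne (not_lt.1 hc) hne
  have hrot := hx.lt_rotate h0 hp
  by_cases hpre : x.drop p <+: x
  · obtain ⟨z, hz⟩ := hpre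
    have hlen := congrArg List.length hz
    rw [List.length_append, List.length_drop] at hlen
    have h1 : z < x.take p := by
      refine (append_lt_append_left_iff (c := x.drop p)).1 ?_
      rwa [hz]
    have h2 := hx.lt_rotate (p := x.length - p) (by omega) (by omega)
    have h3 : x.drop (x.length - p) = z := by
      have := List.drop_left' (l₂ := z) (List.length_drop (i := p) (l := x))
      rwa [hz] at this
    have h4 : x.take (x.length - p) = x.drop p := by
      have := List.take_left' (l₂ := z) (List.length_drop (i := p) (l := x))
      rwa [hz] at this
    rw [h3, h4] at h2
    have h5 := append_lt_append_of_lt_of_length_eq h1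
      (by rw [List.length_take]; omega) (x.drop p) (x.drop p)
    rw [List.take_append_drop] at h5
    exact lt_asymm h2 h5
  · have := append_lt_append_of_not_prefix_of_lt hlt hpre (x.take p) []
    rw [List.append_nil] at this
    exact lt_asymm hrot this

theorem not_prefix_drop {β : Type*} {x : List β} {p : ℕ} (h0 : 0 < p) (hp : p < x.length) :
    ¬ x <+: x.drop p := by
  intro h
  have := h.length_le
  rw [List.length_drop] at this
  omega

/-- The shortest prefix of `w` followed by a smaller suffix is a Lyndon word. -/
theorem isLyndon_take {w : List β} {j : ℕ} (h0 : 0 < j) (hj : j ≤ w.length)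
    (hlt : w.drop j < w) (hmin : ∀ i, 0 < i → i < j → w < w.drop i) : IsLyndon (w.take j) := by
  have hlen : (w.take j).length = j := by simpa using hj
  refine ⟨List.length_pos_iff.1 (by omega), fun i hi hi0 => ?_⟩
  rw [hlen] at hi
  rw [rot_iterate, List.rotate_eq_drop_append_take (by omega)]
  have e1 : (w.take j).drop i ++ w.drop j = w.drop i := by
    conv_rhs => rw [← List.take_append_drop j w]
    rw [List.drop_append_of_le_length (by omega)]
  have hv : ((w.take j).drop i).length = j - i := by rw [List.length_drop, hlen]
  rcases lt_trichotomy (w.take j) ((w.take j).drop i) with h | h | h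
  · have := append_lt_append_of_not_prefix_of_lt h
      (not_prefix_drop hi0 (by omega)) [] ((w.take j).take i)
    rwa [List.append_nil] at this
  · have := congrArg List.length h
    omega
  · exfalso
    have hi' := hmin i hi0 hi
    by_cases hpre : (w.take j).drop i <+: w.take j
    · obtain ⟨z, hz⟩ := hpre.trans ⟨_, List.take_append_drop j w⟩
      have e2 : w.drop (j - i) = z := by
        conv_lhs => rw [← hz]
        exact List.drop_left' hv
      have h1 : (w.take j).drop i ++ z < (w.take j).drop i ++ w.drop j := by
        rwa [hz, e1]
      rw [append_lt_append_left_iff, ← e2] at h1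
      exact lt_asymm (hmin (j - i) (by omega) (by omega)) (h1.trans hlt)
    · have := append_lt_append_of_not_prefix_of_lt h hpre (w.drop j) (w.drop j)
      rw [e1, List.take_append_drop] at this
      exact lt_asymm hi' this

theorem not_isLyndon_take {w : List β} {j i : ℕ} (h0 : 0 < j) (hji : j < i) (hi : i ≤ w.length)
    (hlt : w.drop j < w) : ¬ IsLyndon (w.take i) := by
  intro h
  have hlen : (w.take i).length = i := by simpa using hi
  have h1 := append_lt_append_of_not_prefix_of_lt (h.lt_drop h0 (by omega))
    (not_prefix_drop h0 (by omega)) (w.drop i) (w.drop i)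
  rw [List.take_append_drop, ← List.drop_append_of_le_length (by omega),
    List.take_append_drop] at h1
  exact lt_asymm h1 hlt

theorem getLastD_filter_map_range {γ : Type*} (f : ℕ → γ) (P : γ → Bool) (d : γ) {j n : ℕ}
    (hjn : j ≤ n) (hj : P (f j) = true) (h : ∀ i, j < i → i ≤ n → P (f i) ≠ true) :
    (((List.range (n + 1)).map f).filter P).getLastD d = f j := by
  have e : List.range (n + 1) = List.range (j + 1) ++ List.range' (j + 1) (n - j) := by
    rw [List.range_eq_range', List.range_eq_range']
    have := List.range'_append (s := 0) (m := j + 1) (n := n - j) (step := 1)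
    rw [show 0 + 1 * (j + 1) = j + 1 by omega, show j + 1 + (n - j) = n + 1 by omega] at this
    exact this.symm
  have e2 : ((List.range' (j + 1) (n - j)).map f).filter P = [] := by
    rw [List.filter_eq_nil_iff]
    intro a ha
    obtain ⟨i, hi, rfl⟩ := List.mem_map.1 ha
    rw [List.mem_range'_1] at hi
    exact h i (by omega) (by omega)
  rw [e, List.map_append, List.filter_append, e2, List.append_nil, List.range_succ,
    List.map_append, List.filter_append]
  simp [hj]

theorem firstLyndonFactor_eq {w : List β} {j : ℕ} (h0 : 0 < j) (hj : j ≤ w.length)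
    (hlt : w.drop j < w) (hmin : ∀ i, 0 < i → i < j → w < w.drop i) :
    firstLyndonFactor w = w.take j := by
  refine getLastD_filter_map_range (fun i => w.take i) _ _ hj ?_ fun i h1 h2 => ?_
  · simpa using isLyndon_take h0 hj hlt hmin
  · simpa using not_isLyndon_take h0 h1 h2 hlt

/-- Factorizations obtained by repeatedly splitting off the shortest prefix followed by a smaller
suffix. -/
inductive SuffixFactorization : List β → List (List β) → Prop
  | nil : SuffixFactorization [] []
  | cons (w : List β) (j : ℕ) (F : List (List β)) (h0 : 0 < j) (hj : j ≤ w.length)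
      (hlt : w.drop j < w) (hmin : ∀ i, 0 < i → i < j → w < w.drop i)
      (hF : SuffixFactorization (w.drop j) F) : SuffixFactorization w (w.take j :: F)

theorem suffixFactorization_lyndonFactAux :
    ∀ (k : ℕ) (w : List β), w.length ≤ k → SuffixFactorization w (lyndonFactAux k w)
  | 0, w, h => by
    obtain rfl : w = [] := List.length_eq_zero_iff.1 (by omega)
    exact SuffixFactorization.nil
  | k + 1, [], _ => SuffixFactorization.nil
  | k + 1, a :: t, h => by
    set w := a :: t with hw
    have hex : ∃ j, 0 < j ∧ w.drop j < w :=
      ⟨w.length, by simp [hw], by rw [List.drop_length, hw]; exact List.nil_lt_cons _ _⟩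
    classical
    have h0 := (Nat.find_spec hex).1
    have hlt := (Nat.find_spec hex).2
    have hj : Nat.find hex ≤ w.length :=
      Nat.find_le ⟨by simp [hw], by rw [List.drop_length, hw]; exact List.nil_lt_cons _ _⟩
    have hmin : ∀ i, 0 < i → i < Nat.find hex → w < w.drop i := by
      intro i hi0 hi
      have h1 := Nat.find_min hex hi
      refine lt_of_le_of_ne (not_lt.1 fun h => h1 ⟨hi0, h⟩) fun h => ?_
      have := congrArg List.length h
      rw [List.length_drop] at this
      omega
    generalize Nat.find hex = j at h0 hlt hj hmin
    have e := firstLyndonFactor_eq h0 hj hlt hmin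
    have hlen : (w.take j).length = j := by simpa using hj
    have hunf : lyndonFactAux (k + 1) w = w.take j :: lyndonFactAux k (w.drop j) := by
      rw [hw, lyndonFactAux, ← hw, e]
      · rw [if_neg, hlen]
        rw [List.isEmpty_iff, ← List.length_eq_zero_iff]
        omega
      · simp
    rw [hunf]
    refine SuffixFactorization.cons w j _ h0 hj hlt hmin
      (suffixFactorization_lyndonFactAux k _ ?_)
    rw [List.length_drop]
    omega

theorem suffixFactorization_lyndonFactorization (w : List β) :
    SuffixFactorization w (lyndonFactorization w) :=
  suffixFactorization_lyndonFactAux _ _ le_rfl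

namespace SuffixFactorization

variable {w : List β} {F : List (List β)}

theorem flatten_eq (h : SuffixFactorization w F) : F.flatten = w := by
  induction h with
  | nil => rfl
  | cons w j F h0 hj hlt hmin hF ih => rw [List.flatten_cons, ih, List.take_append_drop]

theorem isLyndon (h : SuffixFactorization w F) : ∀ x ∈ F, IsLyndon x := by
  induction h with
  | nil => simp
  | cons w j F h0 hj hlt hmin hF ih =>
    rw [List.forall_mem_cons]
    exact ⟨isLyndon_take h0 hj hlt hmin, ih⟩

theorem pairwise_ge (h : SuffixFactorization w F) : F.Pairwise (· ≥ ·) := by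
  rw [← List.isChain_iff_pairwise]
  induction h with
  | nil => simp
  | cons w j F h0 hj hlt hmin hF ih =>
    generalize hv : w.drop j = v at hF
    cases hF with
    | nil => simp
    | cons _ j' F' h0' hj' hlt' hmin' hF' =>
      subst hv
      rw [List.isChain_cons_cons]
      refine ⟨?_, ih⟩
      have hlen : (w.take j).length = j := by simpa using hj
      have hlen' : ((w.drop j).take j').length = j' := by simpa using hj'
      by_contra hc
      replace hc := not_le.1 hc
      by_cases hpre : w.take j <+: (w.drop j).take j'
      · have hjj : j < j' := by
          refine lt_of_le_of_ne (by simpa [hlen, hlen'] using hpre.length_le) fun hjj => ?_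
          exact hc.ne (hpre.eq_of_length (by omega))
        obtain ⟨z, hz⟩ := hpre.trans ⟨_, List.take_append_drop j' _⟩
        have e : (w.drop j).drop j = z := by
          conv_lhs => rw [← hz]
          exact List.drop_left' hlen
        have h1 := hmin' j h0 hjj
        have h2 : w.take j ++ z < w.take j ++ w.drop j := by
          rwa [hz, List.take_append_drop]
        rw [append_lt_append_left_iff, ← e] at h2
        exact lt_asymm h1 h2
      · have := append_lt_append_of_not_prefix_of_lt hc hpre (w.drop j) ((w.drop j).drop j')
        rw [List.take_append_drop, List.take_append_drop] at this
        exact lt_asymm this hlt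

/-- Every factor starts and ends at a position whose suffix is smaller than all earlier ones. -/
theorem exists_record (h : SuffixFactorization w F) :
    ∀ x ∈ F, ∃ a, a + x.length ≤ w.length ∧ (w.drop a).take x.length = x ∧
      (∀ p < a, w.drop a < w.drop p) ∧
      ∀ p < a + x.length, w.drop (a + x.length) < w.drop p := by
  induction h with
  | nil => simp
  | cons w j F h0 hj hlt hmin hF ih =>
    have hlen : (w.take j).length = j := by simpa using hj
    have hstep : ∀ p < j, w.drop j < w.drop p := by
      intro p hp
      rcases Nat.eq_zero_or_pos p with rfl | hp0
      · exact hlt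
      · exact hlt.trans (hmin p hp0 hp)
    have hlift : ∀ a, (∀ p < a, (w.drop j).drop a < (w.drop j).drop p) →
        ∀ p < j + a, w.drop (j + a) < w.drop p := by
      intro a ha p hp
      simp only [List.drop_drop] at ha
      rcases lt_or_ge p j with hpj | hpj
      · rcases Nat.eq_zero_or_pos a with rfl | ha0
        · exact hstep p hpj
        · exact (ha 0 ha0).trans (hstep p hpj)
      · have := ha (p - j) (by omega)
        rwa [Nat.add_sub_cancel' hpj] at this
    rw [List.forall_mem_cons]
    refine ⟨⟨0, by omega, by rw [hlen, List.drop_zero], by simp, ?_⟩, fun x hx => ?_⟩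
    · rw [hlen, Nat.zero_add]
      exact hstep
    · obtain ⟨a, h1, h2, h3, h4⟩ := ih x hx
      rw [List.length_drop] at h1
      refine ⟨j + a, by omega, by rwa [List.drop_drop] at h2, hlift a h3, ?_⟩
      rw [Nat.add_assoc]
      exact hlift _ h4

end SuffixFactorization

end Lyndon

/-! ### Counting windows through the Lyndon factors -/

section Counting

variable {β : Type*} [Inhabited β]

theorem cyc_occurrence {w x : List β} {a : ℕ} (ha : a + x.length ≤ w.length)
    (h : (w.drop a).take x.length = x) {i : ℕ} (hi : i < x.length) :
    cyc w ((a : ℤ) + i) = cyc x i := by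
  rw [← Nat.cast_add, cyc_natCast (by omega), cyc_natCast hi]
  have h1 : ((w.drop a).take x.length)[i]? = x[i]? := by rw [h]
  rw [List.getElem?_take_of_lt hi, List.getElem?_drop, List.getElem?_eq_getElem (by omega),
    List.getElem?_eq_getElem hi] at h1
  exact Option.some_injective _ h1

/-- The word `w` as a sequence that is `none` outside the range of positions of `w`. -/
def paddedWord (w : List β) (i : ℤ) : Option β :=
  if 0 ≤ i ∧ i < w.length then some (cyc w i) else none

theorem paddedWord_of_mem {w : List β} {i : ℤ} (h0 : 0 ≤ i) (h1 : i < w.length) :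
    paddedWord w i = some (cyc w i) := if_pos ⟨h0, h1⟩

theorem paddedWord_eq_some {w : List β} {i : ℤ} {b : β} (h : paddedWord w i = some b) :
    0 ≤ i ∧ i < w.length ∧ cyc w i = b := by
  unfold paddedWord at h
  split_ifs at h with hi
  exact ⟨hi.1, hi.2, Option.some_injective _ h⟩

/-- A concatenation of words splits into as many locally periodic blocks as it has runs of equal
words. -/
theorem exists_periodic_blocks [DecidableEq β] :
    ∀ F : List (List β), (∀ x ∈ F, x ≠ []) → ∃ E : Finset ℕ, E.card ≤ runsCount F ∧
      ∀ p < F.flatten.length, ∃ e ∈ E, p < e ∧ e ≤ F.flatten.length ∧ ∃ x ∈ F, ∃ c : ℤ,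
        (∀ i : ℕ, p ≤ i → i < e → F.flatten[i]? = some (cyc x (c + i))) ∧
        (p = 0 → F.head? = some x ∧ c = 0)
  | [], _ => ⟨∅, by simp, by simp⟩
  | [x], _ => by
    refine ⟨{x.length}, by simp [runsCount], fun p hp => ⟨x.length, by simp, ?_⟩⟩
    rw [List.flatten_singleton] at hp ⊢
    refine ⟨hp, le_rfl, x, by simp, 0, fun i _ hi => ?_, by simp⟩
    rw [zero_add, cyc_natCast hi, List.getElem?_eq_getElem hi]
  | x :: y :: t, hF => by
    obtain ⟨E, hE, h⟩ := exists_periodic_blocks (y :: t) fun z hz => hF z (List.mem_cons_of_mem _ hz)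
    have hx := List.length_pos_iff.2 (hF x (by simp))
    have hy := List.length_pos_iff.2 (hF y (by simp))
    generalize hW : (y :: t).flatten = W at h
    have hWlen : 0 < W.length := by
      rw [← hW, List.flatten_cons, List.length_append]
      omega
    have hfl : (x :: y :: t).flatten = x ++ W := by rw [List.flatten_cons, hW]
    have hshift : ∀ p, x.length ≤ p → p < (x ++ W).length → ∃ e ∈ E.image (x.length + ·),
        p < e ∧ e ≤ (x ++ W).length ∧ ∃ z ∈ x :: y :: t, ∃ c : ℤ,
        (∀ i : ℕ, p ≤ i → i < e → (x ++ W)[i]? = some (cyc z (c + i))) ∧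
        (p = 0 → (x :: y :: t).head? = some z ∧ c = 0) := by
      intro p hp1 hp2
      rw [List.length_append] at hp2
      obtain ⟨e, he, h1, h2, z, hz, c, h3, -⟩ := h (p - x.length) (by omega)
      refine ⟨x.length + e, Finset.mem_image_of_mem _ he, by omega,
        by rw [List.length_append]; omega, z, List.mem_cons_of_mem _ hz, c - x.length,
        fun i hi1 hi2 => ?_, by omega⟩
      rw [List.getElem?_append_right (by omega), h3 _ (by omega) (by omega),
        Nat.cast_sub (by omega)]
      congr 2
      ring
    rw [hfl]
    by_cases hxy : x = y
    · refine ⟨E.image (x.length + ·), ?_, fun p hp => ?_⟩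
      · rw [runsCount, if_pos hxy, zero_add]
        exact Finset.card_image_le.trans hE
      · rcases le_or_gt x.length p with hpx | hpx
        · exact hshift p hpx hp
        · obtain ⟨e, he, h1, h2, z, hz, c, h3, h4⟩ := h 0 hWlen
          obtain ⟨h5, rfl⟩ := h4 rfl
          obtain rfl : y = z := by simpa using h5
          refine ⟨x.length + e, Finset.mem_image_of_mem _ he, by omega,
            by rw [List.length_append]; omega, x, by simp, 0, fun i hi1 hi2 => ?_, by simp⟩
          rcases lt_or_ge i x.length with hi | hi
          · rw [List.getElem?_append_left hi, zero_add, cyc_natCast hi,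
              List.getElem?_eq_getElem hi]
          · rw [List.getElem?_append_right hi, h3 _ (by omega) (by omega),
              Nat.cast_sub hi, ← hxy, ← cyc_add_length]
            congr 2
            ring
    · refine ⟨insert x.length (E.image (x.length + ·)), ?_, fun p hp => ?_⟩
      · rw [runsCount, if_neg hxy]
        have h1 := Finset.card_insert_le x.length (E.image (x.length + ·))
        have h2 := Finset.card_image_le (s := E) (f := (x.length + ·))
        omega
      · rcases le_or_gt x.length p with hpx | hpx
        · obtain ⟨e, he, h1⟩ := hshift p hpx hp
          exact ⟨e, Finset.mem_insert_of_mem he, h1⟩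
        · refine ⟨x.length, Finset.mem_insert_self _ _, hpx,
            by rw [List.length_append]; omega, x, by simp, 0, fun i hi1 hi => ?_, by simp⟩
          rw [List.getElem?_append_left hi, zero_add, cyc_natCast hi, List.getElem?_eq_getElem hi]

variable [LinearOrder β]

theorem drop_lt_drop {w : List β} {p b k : ℕ} (hp : p + k < w.length) (hb : b + k < w.length)
    (h : ∀ j : ℕ, j < k → cyc w ((p : ℤ) + j) = cyc w ((b : ℤ) + j))
    (hk : cyc w ((p : ℤ) + k) < cyc w ((b : ℤ) + k)) : w.drop p < w.drop b := by
  refine List.lt_iff_exists.2 (Or.inr ⟨k, by rw [List.length_drop]; omega,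
    by rw [List.length_drop]; omega, fun j hj => ?_, ?_⟩)
  · have := h j hj
    rw [← Nat.cast_add, ← Nat.cast_add, cyc_natCast (by omega), cyc_natCast (by omega)] at this
    simpa using this
  · rw [← Nat.cast_add, ← Nat.cast_add, cyc_natCast (by omega), cyc_natCast (by omega)] at hk
    simpa using hk

theorem IsLyndon.exists_lt_shift {x : List β} (hx : IsLyndon x) {p : ℕ} (h0 : 0 < p)
    (hp : p < x.length) : ∃ k, p + k < x.length ∧
      (∀ j : ℕ, j < k → cyc x j = cyc x ((p : ℤ) + j)) ∧ cyc x k < cyc x ((p : ℤ) + k) := by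
  rcases List.lt_iff_exists.1 (hx.lt_drop h0 hp) with h | ⟨k, h1, h2, h3, h4⟩
  · have := h.2
    rw [List.length_drop] at this
    omega
  · rw [List.length_drop] at h2
    refine ⟨k, by omega, fun j hj => ?_, ?_⟩
    · rw [← Nat.cast_add, cyc_natCast (by omega), cyc_natCast (by omega), h3 j hj]
      simp
    · rw [← Nat.cast_add, cyc_natCast (by omega), cyc_natCast (by omega)]
      simpa using h4

theorem IsLyndon.key_lt {x : List β} (hx : IsLyndon x) {t : ℤ} (ht : ¬ (x.length : ℤ) ∣ t) :
    key (cyc x) < key (shiftSeq (cyc x) t) := by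
  obtain ⟨r, hr, k, rfl⟩ := exists_lt_eq_add_mul (List.length_pos_iff.2 hx.1) t
  have hr0 : 0 < r := by
    rcases Nat.eq_zero_or_pos r with rfl | h
    · exact absurd (by simp) ht
    · exact h
  have e : shiftSeq (cyc x) (r + x.length * k) = cyc (x.rotate r) := by
    rw [cyc_rotate]
    funext i
    simp only [shiftSeq]
    rw [← add_assoc, cyc_add_mul_length]
  rw [e]
  refine key_cyc_lt (by simp) ?_
  rw [← rot_iterate]
  exact hx.2 r hr hr0

theorem IsLyndon.dvd_of_key_le {x : List β} (hx : IsLyndon x) {t : ℤ}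
    (h : key (shiftSeq (cyc x) t) ≤ key (cyc x)) : (x.length : ℤ) ∣ t := by
  by_contra ht
  exact absurd (hx.key_lt ht) (not_lt.2 h)

theorem IsLyndon.key_le {x : List β} (hx : IsLyndon x) (t : ℤ) :
    key (cyc x) ≤ key (shiftSeq (cyc x) t) := by
  by_cases ht : (x.length : ℤ) ∣ t
  · obtain ⟨k, rfl⟩ := ht
    refine le_of_eq (congrArg key (funext fun i => ?_))
    rw [shiftSeq, cyc_add_mul_length]
  · exact (hx.key_lt ht).le

theorem IsLyndon.eq_of_cyc_eq {x y : List β} (hx : IsLyndon x) (hy : IsLyndon y)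
    (h : cyc x = cyc y) : x = y := by
  have h1 : (x.length : ℤ) ∣ y.length := hx.dvd_of_key_le <| le_of_eq <| congrArg key <| by
    funext i
    rw [shiftSeq, h, cyc_add_length]
  have h2 : (y.length : ℤ) ∣ x.length := hy.dvd_of_key_le <| le_of_eq <| congrArg key <| by
    funext i
    rw [shiftSeq, ← h, cyc_add_length]
  have hlen := Nat.dvd_antisymm (Int.natCast_dvd_natCast.1 h1) (Int.natCast_dvd_natCast.1 h2)
  refine List.ext_getElem hlen fun i hi hi' => ?_
  rw [← cyc_natCast hi, ← cyc_natCast hi', h]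

theorem IsLyndon.eq_of_shiftSeq_eq {x y : List β} (hx : IsLyndon x) (hy : IsLyndon y) {s t : ℕ}
    (hst : s < t + y.length) (hts : t < s + y.length)
    (h : shiftSeq (cyc x) s = shiftSeq (cyc y) t) : x = y ∧ s = t := by
  have h1 : cyc x = shiftSeq (cyc y) (t - s) := by
    funext i
    have := congrFun h (i - s)
    simp only [shiftSeq] at this ⊢
    rw [sub_add_cancel] at this
    rw [this]
    congr 1
    ring
  have h2 : cyc y = shiftSeq (cyc x) (s - t) := by
    funext i
    have := congrFun h (i - t)
    simp only [shiftSeq] at this ⊢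
    rw [sub_add_cancel] at this
    rw [← this]
    congr 1
    ring
  have h3 : key (shiftSeq (cyc y) (t - s)) ≤ key (cyc y) := by
    rw [← h1, h2]
    exact hx.key_le _
  have h4 := hy.dvd_of_key_le h3
  have h5 : ((t : ℤ) - s) = 0 := Int.eq_zero_of_abs_lt_dvd h4 (by rw [abs_lt]; omega)
  refine ⟨hx.eq_of_cyc_eq hy ?_, by omega⟩
  rw [h1, h5]
  funext i
  simp [shiftSeq]

/-- Distinct Lyndon words of comparable lengths contribute disjoint sets of long windows. -/
theorem card_mul_le_card_windows_factors {F : List (List β)} (hF : ∀ x ∈ F, IsLyndon x)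
    {G : Finset (List β)} (hG : ∀ x ∈ G, x ∈ F) {l : ℕ}
    (hl : ∀ x ∈ G, l ≤ x.length ∧ x.length < 2 * l) :
    G.card * l ≤ (windows (conjugates F) (4 * l)).card := by
  have hcard : (G ×ˢ Finset.range l).card = G.card * l := by simp
  rw [← hcard]
  refine Finset.card_le_card_of_injOn (fun q => win (4 * l) (shiftSeq (cyc q.1) (q.2 : ℕ)))
    ?_ ?_
  · rintro ⟨x, o⟩ hq
    simp only [Finset.coe_product, Set.mem_prod, Finset.mem_coe] at hq ⊢
    refine win_mem_windows ((mem_conjugates fun y hy => (hF y hy).1).2 ⟨x, hG x hq.1, o, rfl⟩) _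
  · rintro ⟨x, o⟩ hq ⟨y, u⟩ hq' h
    simp only [Finset.coe_product, Set.mem_prod, Finset.mem_coe, Finset.mem_range] at hq hq' h
    have hxl := hl x hq.1
    have hyl := hl y hq'.1
    have h1 := eq_of_periodic (p := x.length) (q := y.length) (by omega) (by omega)
      (shiftSeq_cyc_add_length x o) (shiftSeq_cyc_add_length y u)
      fun i hi => win_eq_iff.1 h i (by omega)
    obtain ⟨rfl, rfl⟩ := (hF x (hG x hq.1)).eq_of_shiftSeq_eq (hF y (hG y hq'.1))
      (by omega) (by omega) h1
    rfl

theorem false_of_record {w x : List β} (hx : IsLyndon x) {d b : ℕ} (h0 : 0 < d)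
    (hd : d < x.length) (hrec : ∀ q < b, w.drop b < w.drop q) {p : ℤ} (hb : (b : ℤ) = p + d)
    (h : ∀ j : ℕ, j < x.length → paddedWord w (p + j) = some (cyc x j)) : False := by
  obtain ⟨k, hk, hlt, hk'⟩ := hx.exists_lt_shift h0 hd
  have hp0 := paddedWord_eq_some (h 0 (by omega))
  have hpk := paddedWord_eq_some (h (d + k) hk)
  obtain ⟨q, rfl⟩ := Int.eq_ofNat_of_zero_le (a := p) (by simpa using hp0.1)
  have hval : ∀ j, j < x.length → cyc w ((q : ℤ) + j) = cyc x j := fun j hj =>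
    (paddedWord_eq_some (h j hj)).2.2
  obtain rfl : b = q + d := by omega
  have hval' : ∀ j, d + j < x.length → cyc w (((q + d : ℕ) : ℤ) + j) = cyc x ((d : ℤ) + j) := by
    intro j hj
    rw [← Nat.cast_add d j, ← hval _ hj]
    congr 1
    push_cast
    ring
  refine lt_asymm (hrec q (by omega)) (drop_lt_drop (k := k) (by omega) (by omega)
    (fun j hj => ?_) ?_)
  · rw [hval j (by omega), hval' j (by omega), hlt j hj]
  · rwa [hval k (by omega), hval' k (by omega)]

theorem card_mul_le_card_windows_word {w : List β} (hw : w ≠ []) {F : List (List β)}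
    (hF : SuffixFactorization w F) {G : Finset (List β)} (hG : ∀ x ∈ G, x ∈ F) {l : ℕ}
    (hl : ∀ x ∈ G, l ≤ x.length ∧ x.length < 2 * l) :
    G.card * l ≤ (windows (conjugates [w]) (3 * l)).card + 4 * l := by
  classical
  have hex : ∀ x : List β, ∃ a : ℕ, x ∈ F → a + x.length ≤ w.length ∧
      (∀ i < x.length, cyc w ((a : ℤ) + i) = cyc x i) ∧
      (∀ p < a, w.drop a < w.drop p) ∧
      ∀ p < a + x.length, w.drop (a + x.length) < w.drop p := by
    intro x
    by_cases hx : x ∈ F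
    · obtain ⟨a, h1, h2, h3, h4⟩ := hF.exists_record x hx
      exact ⟨a, fun _ => ⟨h1, fun i hi => cyc_occurrence h1 h2 hi, h3, h4⟩⟩
    · exact ⟨0, fun h => absurd h hx⟩
  choose a ha using hex
  let g : ℤ → Fin (3 * l) → Option β := fun z => win (3 * l) (shiftSeq (paddedWord w) z)
  have hcard : (G ×ˢ Finset.range l).card = G.card * l := by simp
  let T : Finset (Fin (3 * l) → Option β) :=
    (windows (conjugates [w]) (3 * l)).image (fun U j => some (U j)) ∪
      ((Finset.Ico (-l : ℤ) 0 ∪ Finset.Ico (w.length - 3 * l : ℤ) w.length).image g)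
  have hT : T.card ≤ (windows (conjugates [w]) (3 * l)).card + 4 * l := by
    refine (Finset.card_union_le _ _).trans (Nat.add_le_add Finset.card_image_le ?_)
    refine Finset.card_image_le.trans ((Finset.card_union_le _ _).trans ?_)
    rw [Int.card_Ico, Int.card_Ico]
    omega
  have hocc : ∀ x ∈ F, ∀ j : ℕ, j < x.length →
      paddedWord w ((a x : ℤ) + j) = some (cyc x j) := by
    intro x hx j hj
    obtain ⟨h1, h2, -⟩ := ha x hx
    rw [paddedWord_of_mem (by omega) (by omega), h2 j hj]
  rw [← hcard]
  refine (Finset.card_le_card_of_injOn (t := T)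
    (fun q => g ((a q.1 : ℤ) - (q.2 : ℕ))) ?_ ?_).trans hT
  · rintro ⟨x, o⟩ hq
    simp only [Finset.coe_product, Set.mem_prod, Finset.mem_coe, Finset.mem_range] at hq ⊢
    have h1 := (ha x (hG x hq.1)).1
    have hxl := hl x hq.1
    rw [Finset.mem_union]
    by_cases hin : 0 ≤ (a x : ℤ) - o ∧ (a x : ℤ) - o + 3 * l ≤ w.length
    · left
      rw [Finset.mem_image]
      refine ⟨win (3 * l) (shiftSeq (cyc w) ((a x : ℤ) - o)), win_mem_windows
        ((mem_conjugates (by simpa using hw)).2 ⟨w, by simp, _, rfl⟩) _, ?_⟩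
      funext j
      have hj := j.2
      simp only [g, win, shiftSeq]
      rw [paddedWord_of_mem (by omega) (by omega)]
    · right
      refine Finset.mem_image_of_mem _ ?_
      rw [Finset.mem_union, Finset.mem_Ico, Finset.mem_Ico]
      omega
  · have key_ne : ∀ x y o u, x ∈ G → y ∈ G → o < u → u < l →
        g ((a x : ℤ) - (o : ℕ)) ≠ g ((a y : ℤ) - (u : ℕ)) := by
      intro x y o u hx hy hou hul h
      have hxl := hl x hx
      refine false_of_record (w := w) (p := (a y : ℤ) - u + o) (b := a y) (d := u - o)
        (hF.isLyndon x (hG x hx)) (by omega) (by omega) (ha y (hG y hy)).2.2.1 (by omega) ?_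
      intro j hj
      have := win_eq_iff.1 h (o + j) (by omega)
      simp only [shiftSeq] at this
      rw [← hocc x (hG x hx) j hj]
      convert this.symm using 2 <;> push_cast <;> ring
    have len_ge : ∀ x y o, x ∈ G → y ∈ G → o < l →
        g ((a x : ℤ) - (o : ℕ)) = g ((a y : ℤ) - (o : ℕ)) → y.length ≤ x.length := by
      intro x y o hx hy hol h
      by_contra hlt
      have hxl := hl x hx
      have hyl := hl y hy
      refine false_of_record (w := w) (p := (a x : ℤ)) (b := a x + x.length) (d := x.length)
        (hF.isLyndon y (hG y hy)) (by omega) (by omega) (ha x (hG x hx)).2.2.2 (by omega) ?_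
      intro j hj
      have := win_eq_iff.1 h (o + j) (by omega)
      simp only [shiftSeq] at this
      rw [← hocc y (hG y hy) j hj]
      convert this using 2 <;> push_cast <;> ring
    rintro ⟨x, o⟩ hq ⟨y, u⟩ hq' h
    simp only [Finset.coe_product, Set.mem_prod, Finset.mem_coe, Finset.mem_range] at hq hq' h
    obtain rfl : o = u := by
      rcases lt_trichotomy o u with h1 | h1 | h1
      · exact absurd h (key_ne x y o u hq.1 hq'.1 h1 hq'.2)
      · exact h1
      · exact absurd h.symm (key_ne y x u o hq'.1 hq.1 h1 hq.2)
    have hlen : x.length = y.length :=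
      le_antisymm (len_ge y x o hq'.1 hq.1 hq.2 h.symm) (len_ge x y o hq.1 hq'.1 hq.2 h)
    have hxl := hl x hq.1
    obtain rfl : x = y := by
      refine List.ext_getElem hlen fun i hi hi' => ?_
      have := win_eq_iff.1 h (o + i) (by omega)
      simp only [shiftSeq] at this
      rw [← cyc_natCast hi, ← cyc_natCast hi']
      refine Option.some_injective _ ?_
      rw [← hocc x (hG x hq.1) i hi, ← hocc y (hG y hq'.1) i hi']
      convert this using 2 <;> push_cast <;> ring
    rfl

/-- A bound on the number of distinct words in every dyadic range of lengths bounds the number of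
all distinct words. -/
theorem card_le_of_dyadic {γ : Type*} [DecidableEq γ] {G : Finset γ} {len : γ → ℕ} {n c : ℕ}
    (hlen : ∀ x ∈ G, 0 < len x ∧ len x ≤ n)
    (hG : ∀ j, (G.filter fun x => 2 ^ j ≤ len x ∧ len x < 2 * 2 ^ j).card ≤ c) :
    G.card ≤ (Nat.log 2 n + 1) * c := by
  have hsub : G ⊆ (Finset.range (Nat.log 2 n + 1)).biUnion
      fun j => G.filter fun x => 2 ^ j ≤ len x ∧ len x < 2 * 2 ^ j := by
    intro x hx
    obtain ⟨h1, h2⟩ := hlen x hx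
    rw [Finset.mem_biUnion]
    refine ⟨Nat.log 2 (len x), ?_, ?_⟩
    · rw [Finset.mem_range, Nat.lt_succ_iff]
      exact Nat.log_mono_right h2
    · rw [Finset.mem_filter]
      refine ⟨hx, Nat.pow_log_le_self 2 (by omega), ?_⟩
      have := Nat.lt_pow_succ_log_self (b := 2) (by omega) (len x)
      rwa [pow_succ, mul_comm] at this
  refine (Finset.card_le_card hsub).trans ((Finset.card_biUnion_le_card_mul _ _ c
    fun j _ => hG j).trans ?_)
  rw [Finset.card_range]

theorem card_windows_factors_le {w : List β} (hw : w ≠ []) {F : List (List β)}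
    (hF : SuffixFactorization w F) (k : ℕ) :
    (windows (conjugates F) k).card ≤
      (windows (conjugates [w]) k).card + F.toFinset.card * k := by
  have hne : ∀ x ∈ F, x ≠ [] := fun x hx => (hF.isLyndon x hx).1
  have hcard : (F.toFinset ×ˢ Finset.range k).card = F.toFinset.card * k := by simp
  have hsub : windows (conjugates F) k ⊆ windows (conjugates [w]) k ∪
      (F.toFinset ×ˢ Finset.range k).image
        (fun q => win k (shiftSeq (cyc q.1) (q.1.length - 1 - (q.2 : ℕ)))) := by
    intro U hU
    obtain ⟨y, hy, rfl⟩ := mem_windows.1 hU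
    obtain ⟨x, hx, t, rfl⟩ := (mem_conjugates hne).1 hy
    obtain ⟨p, hp, c, rfl⟩ := exists_lt_eq_add_mul (List.length_pos_iff.2 (hne x hx)) t
    have e : shiftSeq (cyc x) (p + x.length * c) = shiftSeq (cyc x) p := by
      funext i
      simp only [shiftSeq]
      rw [← add_assoc, cyc_add_mul_length]
    rw [e, Finset.mem_union]
    rcases le_or_gt (p + k) x.length with h | h
    · left
      obtain ⟨a, h1, h2, -⟩ := hF.exists_record x hx
      have h3 : win k (shiftSeq (cyc x) p) = win k (shiftSeq (cyc w) (a + p : ℕ)) := by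
        refine win_eq_iff.2 fun j hj => ?_
        simp only [shiftSeq]
        rw [← Nat.cast_add, ← cyc_occurrence h1 h2 (show j + p < x.length by omega)]
        congr 1
        push_cast
        ring
      rw [h3]
      exact win_mem_windows ((mem_conjugates (by simpa using hw)).2 ⟨w, by simp, _, rfl⟩) _
    · right
      refine Finset.mem_image.2 ⟨(x, x.length - 1 - p), ?_, ?_⟩
      · rw [Finset.mem_product, List.mem_toFinset, Finset.mem_range]
        exact ⟨hx, by simp only; omega⟩
      · dsimp only
        congr 2
        omega
  rw [← hcard]
  exact (Finset.card_le_card hsub).trans ((Finset.card_union_le _ _).trans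
    (Nat.add_le_add_left Finset.card_image_le _))

theorem card_windows_word_le {w : List β} (hw : w ≠ []) {F : List (List β)}
    (hF : SuffixFactorization w F) (k : ℕ) :
    (windows (conjugates [w]) k).card ≤
      (windows (conjugates F) k).card + F.toFinset.card * k := by
  have hne : ∀ x ∈ F, x ≠ [] := fun x hx => (hF.isLyndon x hx).1
  obtain ⟨E, hE, hblock⟩ := exists_periodic_blocks F hne
  rw [hF.flatten_eq] at hblock
  have hruns : runsCount F ≤ F.toFinset.card :=
    runsCount_le_card_toFinset (fun a b h1 h2 => le_antisymm h2 h1) F hF.pairwise_ge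
  have hcard : (E ×ˢ Finset.range k).card ≤ F.toFinset.card * k := by
    rw [Finset.card_product, Finset.card_range]
    exact Nat.mul_le_mul_right _ (hE.trans hruns)
  have hsub : windows (conjugates [w]) k ⊆ windows (conjugates F) k ∪
      (E ×ˢ Finset.range k).image
        (fun q => win k (shiftSeq (cyc w) ((q.1 : ℕ) - 1 - (q.2 : ℕ)))) := by
    intro U hU
    obtain ⟨y, hy, rfl⟩ := mem_windows.1 hU
    obtain ⟨x, hx, t, rfl⟩ := (mem_conjugates (by simpa using hw)).1 hy
    obtain rfl : x = w := by simpa using hx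
    obtain ⟨p, hp, c, rfl⟩ := exists_lt_eq_add_mul (List.length_pos_iff.2 hw) t
    have e : shiftSeq (cyc x) (p + x.length * c) = shiftSeq (cyc x) p := by
      funext i
      simp only [shiftSeq]
      rw [← add_assoc, cyc_add_mul_length]
    rw [e, Finset.mem_union]
    obtain ⟨e, he, h1, h2, y, hy, c, h3, -⟩ := hblock p hp
    rcases le_or_gt (p + k) e with h | h
    · left
      have h3 : win k (shiftSeq (cyc x) p) = win k (shiftSeq (cyc y) (c + p)) := by
        refine win_eq_iff.2 fun j hj => ?_
        have := h3 (j + p) (by omega) (by omega)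
        rw [List.getElem?_eq_getElem (by omega)] at this
        simp only [shiftSeq]
        rw [← Nat.cast_add, cyc_natCast (by omega), Option.some_injective _ this]
        congr 1
        push_cast
        ring
      rw [h3]
      exact win_mem_windows ((mem_conjugates hne).2 ⟨y, hy, _, rfl⟩) _
    · right
      refine Finset.mem_image.2 ⟨(e, e - 1 - p), ?_, ?_⟩
      · rw [Finset.mem_product, Finset.mem_range]
        exact ⟨he, by simp only; omega⟩
      · dsimp only
        congr 2
        omega
  exact (Finset.card_le_card hsub).trans ((Finset.card_union_le _ _).trans
    (Nat.add_le_add_left (Finset.card_image_le.trans hcard) _))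

end Counting

/-! ### Comparison of the two transforms -/

section Comparison

variable {β : Type*} [LinearOrder β]

theorem one_add_le_mul_pow {L r c : ℕ} (hL : 1 ≤ L) (hr : 1 ≤ r) (hc : c ≤ 7 * r) :
    1 + (L + 2) * (6 * (r + (L + 1) * c) * L) ≤ 271 * r * L ^ 4 := by
  have h1 : (L + 1) * c ≤ (2 * L) * (7 * r) := Nat.mul_le_mul (by omega) hc
  have h2 : r ≤ L * r := Nat.le_mul_of_pos_left _ hL
  have h3 : r + (L + 1) * c ≤ 15 * (L * r) := by nlinarith
  calc 1 + (L + 2) * (6 * (r + (L + 1) * c) * L)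
      ≤ r * L ^ 4 + (3 * L) * (6 * (15 * (L * r)) * L) := by
        refine Nat.add_le_add (Nat.mul_pos hr (by positivity)) (Nat.mul_le_mul (by omega) ?_)
        gcongr
    _ = r * L ^ 4 + 270 * r * L ^ 3 := by ring
    _ ≤ r * L ^ 4 + 270 * r * L ^ 4 := by
        gcongr
        norm_num
    _ = 271 * r * L ^ 4 := by ring

theorem one_le_runsCount_of_perm_conjugates [Inhabited β] {F : List (List β)}
    {s : List (ℤ → β)} (hF : ∀ x ∈ F, x ≠ []) (hne : F ≠ []) (hs : s.Perm (conjugates F)) :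
    1 ≤ runsCount (s.map fun x => x (-1)) := by
  refine one_le_runsCount ?_
  obtain ⟨x, hx⟩ := List.exists_mem_of_ne_nil F hne
  have : cyc x ∈ s := hs.mem_iff.2 ((mem_conjugates hF).2 ⟨x, hx, 0, by
    funext i
    simp [shiftSeq]⟩)
  simpa using List.ne_nil_of_mem this

theorem runsCount_le_mul_log_pow [Inhabited β] {F F' : List (List β)} {s s' : List (ℤ → β)}
    (hF : ∀ x ∈ F, x ≠ []) (hF' : ∀ x ∈ F', x ≠ []) (hne : F ≠ [])
    (hs : s.Perm (conjugates F)) (hsort : s.Pairwise fun x y => key x ≤ key y)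
    (hs' : s'.Perm (conjugates F')) (hsort' : s'.Pairwise fun x y => key x ≤ key y)
    {m c : ℕ} (hn : 2 ≤ F'.flatten.length) (hm : m ≤ (Nat.log 2 F'.flatten.length + 1) * c)
    (hc : c ≤ 7 * runsCount (s.map fun x => x (-1)))
    (hwin : ∀ k, (windows (conjugates F') k).card ≤ (windows (conjugates F) k).card + m * k) :
    runsCount (s'.map fun x => x (-1)) ≤
      271 * runsCount (s.map fun x => x (-1)) * Nat.log 2 F'.flatten.length ^ 4 := by
  have hr := one_le_runsCount_of_perm_conjugates hF hne hs
  refine (runsCount_le_of_card_windows_conjugates_le hF' hs' hsort' fun k hk => ?_).trans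
    (one_add_le_mul_pow (Nat.log_pos (by omega) hn) hr hc)
  calc _ ≤ (windows (conjugates F) k).card + m * k := hwin k
    _ ≤ k * runsCount (s.map fun x => x (-1)) +
          ((Nat.log 2 F'.flatten.length + 1) * c) * k :=
        Nat.add_le_add (card_windows_conjugates_le hF hne hs hsort hk) (Nat.mul_le_mul_right _ hm)
    _ = _ := by ring

theorem runsCount_bwt_bbwt_le {w : List β} (hw : 2 ≤ w.length) :
    runsCount (BBWT w) ≤ 271 * runsCount (BWT w) * Nat.log 2 w.length ^ 4 ∧
      runsCount (BWT w) ≤ 271 * runsCount (BBWT w) * Nat.log 2 w.length ^ 4 := by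
  have hw0 : w ≠ [] := List.length_pos_iff.1 (by omega)
  have : Inhabited β := ⟨w.head hw0⟩
  have hF := suffixFactorization_lyndonFactorization w
  have hne : ∀ x ∈ lyndonFactorization w, x ≠ [] := fun x hx => (hF.isLyndon x hx).1
  obtain ⟨s, hs, hsort, e⟩ := exists_sorted_bwt hw0
  obtain ⟨s', hs', hsort', e'⟩ := exists_sorted_bbwt hne
  generalize lyndonFactorization w = F at hF hne hs'
  have hflat := hF.flatten_eq
  have hflat' : [w].flatten = w := List.flatten_singleton
  have hF0 : F ≠ [] := by
    rintro rfl
    exact hw0 hflat.symm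
  have hw1 : ∀ x ∈ [w], x ≠ [] := by simpa using hw0
  have hlen : ∀ x ∈ F.toFinset, 0 < x.length ∧ x.length ≤ w.length := by
    intro x hx
    rw [List.mem_toFinset] at hx
    refine ⟨List.length_pos_iff.2 (hne x hx), ?_⟩
    rw [← hflat, List.length_flatten]
    exact List.le_sum_of_mem (List.mem_map_of_mem hx)
  have hm : F.toFinset.card ≤
      (Nat.log 2 w.length + 1) * (7 * runsCount (s.map fun x => x (-1))) := by
    refine card_le_of_dyadic hlen fun j => ?_
    have hl : 0 < 2 ^ j := by positivity
    have h1 := card_mul_le_card_windows_word hw0 hF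
      (G := F.toFinset.filter fun x => 2 ^ j ≤ x.length ∧ x.length < 2 * 2 ^ j) (l := 2 ^ j)
      (fun x hx => List.mem_toFinset.1 (Finset.mem_filter.1 hx).1)
      fun x hx => (Finset.mem_filter.1 hx).2
    have h2 := card_windows_conjugates_le hw1 (by simp) hs hsort (m := 3 * 2 ^ j) (by omega)
    have hr := one_le_runsCount_of_perm_conjugates hw1 (by simp) hs
    refine Nat.le_of_mul_le_mul_right (h1.trans ?_) hl
    nlinarith
  have hm' : F.toFinset.card ≤
      (Nat.log 2 w.length + 1) * (4 * runsCount (s'.map fun x => x (-1))) := by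
    refine card_le_of_dyadic hlen fun j => ?_
    have hl : 0 < 2 ^ j := by positivity
    have h1 := card_mul_le_card_windows_factors hF.isLyndon
      (G := F.toFinset.filter fun x => 2 ^ j ≤ x.length ∧ x.length < 2 * 2 ^ j) (l := 2 ^ j)
      (fun x hx => List.mem_toFinset.1 (Finset.mem_filter.1 hx).1)
      fun x hx => (Finset.mem_filter.1 hx).2
    have h2 := card_windows_conjugates_le hne hF0 hs' hsort' (m := 4 * 2 ^ j) (by omega)
    refine Nat.le_of_mul_le_mul_right (h1.trans ?_) hl
    linarith
  have h1 := runsCount_le_mul_log_pow hw1 hne (by simp) hs hsort hs' hsort'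
    (by rwa [hflat]) (by rwa [hflat]) le_rfl (card_windows_factors_le hw0 hF)
  have h2 := runsCount_le_mul_log_pow hne hw1 hF0 hs' hsort' hs hsort
    (by rwa [hflat']) (by rwa [hflat']) (Nat.mul_le_mul_right _ (by norm_num))
    (card_windows_word_le hw0 hF)
  rw [hflat] at h1
  rw [hflat'] at h2
  rw [e, e']
  exact ⟨h1, h2⟩

theorem cast_le_mul_logb_pow {a b n : ℕ} (h : a ≤ 271 * b * Nat.log 2 n ^ 4) :
    (a : ℝ) ≤ 271 * (b : ℝ) * Real.logb 2 (n : ℝ) ^ 4 := by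
  calc (a : ℝ) ≤ ((271 * b * Nat.log 2 n ^ 4 : ℕ) : ℝ) := Nat.cast_le.2 h
    _ = 271 * (b : ℝ) * (Nat.log 2 n : ℝ) ^ 4 := by push_cast; ring
    _ ≤ 271 * (b : ℝ) * Real.logb 2 (n : ℝ) ^ 4 := by
        have := Real.natLog_le_logb n 2
        push_cast at this
        gcongr

end Comparison

/-- there is a constant `C > 0` such that for every string `w` of
length `n ≥ 2`, both `r_B(w) ≤ C · r(w) · (log₂ n)⁴` and
`r(w) ≤ C · r_B(w) · (log₂ n)⁴`. -/
theorem stmt10 :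
    ∃ C : ℝ, 0 < C ∧
      ∀ (β : Type) [LinearOrder β] (w : List β), 2 ≤ w.length →
        (runsCount (BBWT w) : ℝ) ≤
            C * (runsCount (BWT w) : ℝ) * (Real.logb 2 (w.length : ℝ)) ^ 4 ∧
        (runsCount (BWT w) : ℝ) ≤
            C * (runsCount (BBWT w) : ℝ) * (Real.logb 2 (w.length : ℝ)) ^ 4 := by
  exact ⟨271, by norm_num, fun β _ w hw => (runsCount_bwt_bbwt_le hw).imp cast_le_mul_logb_pow
    cast_le_mul_logb_pow⟩
end
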